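/- arXiv:0902.2291 — 2 statements merged into one kernel-verified Lean document; each statement's English description precedes it below -/
import Mathlib

section
/- Let F be a field of characteristic p ≠ 2, let λ be a partition of n+1, and let r be the p-residue of a removable node of [λ]. Let λ_1 ◁ λ_2 ◁ … ◁ λ_m (in the dominance order) be all the partitions of n whose Young diagram is obtained by removing a single node of p-residue r from [λ], and for each i = 2, …, m let f_i be a non-zero FΣ_n-homomorphism S^{λ_i} → S^{λ_{i−1}}. Then for all 1 ≤ j < i ≤ m, the composite f_i ∘ f_{i−1} ∘ … ∘ f_{j+2} ∘ f_{j+1} spans Hom_{FΣ_n}(S^{λ_i}, S^{λ_j}); in particular all these composites are non-zero. -/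
namespace CarterPayne

open Finset

/-- A partition of `n`, presented by its parts function; rows are indexed from `1`. -/
structure Partition (n : ℕ) where
  parts : ℕ → ℕ
  parts_zero : parts 0 = 0
  antitone : ∀ ⦃i j : ℕ⦄, 0 < i → i ≤ j → parts j ≤ parts i
  finite_support : (Function.support parts).Finite
  sum_parts : ∑ᶠ i, parts i = n

variable {n : ℕ}

/-- The set of cells `(row, column)` (both 1-indexed) of the Young diagram of `μ`. -/
def Partition.cells (μ : Partition n) : Set (ℕ × ℕ) :=
  {c | 0 < c.1 ∧ 0 < c.2 ∧ c.2 ≤ μ.parts c.1}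

/-- A tabloid for the composition `c` of `n`: an assignment of the `n` symbols to rows
(rows indexed from 1), row `i` receiving exactly `c i` symbols. -/
def Tabloid (n : ℕ) (c : ℕ → ℕ) : Type :=
  {g : Fin n → ℕ // ∀ i, (Finset.univ.filter fun k => g k = i).card = c i}

/-- The permutation module `M^c` over `R`: the free `R`-module on the set of tabloids. -/
abbrev PermMod (R : Type*) [CommRing R] (n : ℕ) (c : ℕ → ℕ) := Tabloid n c →₀ R

/-- The action of a permutation of the symbols on tabloids. -/
def permTabloid (c : ℕ → ℕ) (π : Equiv.Perm (Fin n)) (f : Tabloid n c) : Tabloid n c :=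
  ⟨fun k => f.1 (π.symm k), fun i => by
    rw [← f.2 i]
    exact Finset.card_equiv π.symm fun a => by simp⟩

/-- The `R`-linear action of a permutation of the symbols on `M^c`. -/
noncomputable def permM (R : Type*) [CommRing R] (c : ℕ → ℕ) (π : Equiv.Perm (Fin n)) :
    PermMod R n c →ₗ[R] PermMod R n c :=
  Finsupp.lmapDomain R R (permTabloid c π)

/-- A bijective `μ`-tableau, presented by the placement map which sends each of the
`n` symbols to the cell of the Young diagram containing it. -/
structure Placement (μ : Partition n) where
  pos : Fin n → ℕ × ℕ
  mem : ∀ k, pos k ∈ μ.cells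
  inj : Function.Injective pos
  surj : ∀ c ∈ μ.cells, ∃ k, pos k = c

/-- The column stabilizer of a bijective tableau, as a set of permutations of the symbols. -/
def colStab {μ : Partition n} (T : Placement μ) : Finset (Equiv.Perm (Fin n)) :=
  Finset.univ.filter fun π => ∀ k, (T.pos (π k)).2 = (T.pos k).2

lemma rowFiber_card {μ : Partition n} (T : Placement μ) (i : ℕ) :
    (Finset.univ.filter fun k => (T.pos k).1 = i).card = μ.parts i := by
  classical
  have h : (Finset.univ.filter fun k => (T.pos k).1 = i).card
      = (Finset.Icc 1 (μ.parts i)).card := by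
    apply Finset.card_bij (fun k _ => (T.pos k).2)
    · intro a ha
      simp only [Finset.mem_filter, Finset.mem_univ, true_and] at ha
      obtain ⟨h1, h2, h3⟩ := T.mem a
      exact Finset.mem_Icc.mpr ⟨h2, ha ▸ h3⟩
    · intro a ha b hb hab
      simp only [Finset.mem_filter, Finset.mem_univ, true_and] at ha hb
      exact T.inj (Prod.ext (ha.trans hb.symm) hab)
    · intro j hj
      rw [Finset.mem_Icc] at hj
      have hi0 : 0 < i := by
        rcases Nat.eq_zero_or_pos i with h0 | h0
        · exfalso; rw [h0, μ.parts_zero] at hj; omega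
        · exact h0
      obtain ⟨k, hk⟩ := T.surj (i, j) ⟨hi0, hj.1, hj.2⟩
      exact ⟨k, by simp [hk], by simp [hk]⟩
  rw [h, Nat.card_Icc]
  omega

/-- The row tabloid `{tπ}` associated to the bijective tableau `tπ`. -/
def rowTabloid {μ : Partition n} (T : Placement μ) (π : Equiv.Perm (Fin n)) :
    Tabloid n μ.parts :=
  ⟨fun k => (T.pos (π k)).1, fun i => by
    rw [← rowFiber_card T i]
    exact Finset.card_equiv π fun a => by simp⟩

/-- The polytabloid `e_t` attached to a bijective tableau `t`. -/
noncomputable def polytabloid (R : Type*) [CommRing R] {μ : Partition n} (T : Placement μ) :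
    PermMod R n μ.parts :=
  ∑ π ∈ colStab T, ((Equiv.Perm.sign π : ℤ) : R) • Finsupp.single (rowTabloid T π) (1 : R)

/-- The Specht module `S^μ`, the span in `M^μ` of all polytabloids. -/
noncomputable def Specht (R : Type*) [CommRing R] (μ : Partition n) :
    Submodule R (PermMod R n μ.parts) :=
  Submodule.span R (Set.range fun T : Placement μ => polytabloid R T)

/-- `β` is obtained from the partition `α` of `n` by moving one box from
(the end of) row `a` to (the end of) row `b`; i.e. `β` is a one-box-shift of `α`. -/
structure OneBoxShift {n : ℕ} (α β : Partition n) (a b : ℕ) : Prop where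
  a_pos : 0 < a
  a_lt_b : a < b
  rem : α.parts (a + 1) < α.parts a
  add : α.parts b < α.parts (b - 1)
  at_a : β.parts a = α.parts a - 1
  at_b : β.parts b = α.parts b + 1
  elsewhere : ∀ i, i ≠ a → i ≠ b → β.parts i = α.parts i

/-- The space of `RΣ_n`-homomorphisms from `S^α` to `M^c` whose image lies in the
submodule `target` of `M^c`; an `R`-linear map is an `RΣ_n`-homomorphism when it
intertwines the permutation actions on source and target. -/
noncomputable def SpechtHom (R : Type*) [CommRing R] (α : Partition n) (c : ℕ → ℕ)
    (target : Submodule R (PermMod R n c)) :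
    Submodule R (↥(Specht R α) →ₗ[R] PermMod R n c) where
  carrier := {f | (∀ x, f x ∈ target) ∧
    ∀ (π : Equiv.Perm (Fin n)) (x y : ↥(Specht R α)),
      (x : PermMod R n α.parts) = permM R α.parts π (y : PermMod R n α.parts) →
      f x = permM R c π (f y)}
  add_mem' := by
    rintro f g ⟨hf1, hf2⟩ ⟨hg1, hg2⟩
    refine ⟨fun x => target.add_mem (hf1 x) (hg1 x), fun π x y hxy => ?_⟩
    simp only [LinearMap.add_apply, hf2 π x y hxy, hg2 π x y hxy, map_add]
  zero_mem' :=
    ⟨fun _ => target.zero_mem, fun π x y _ => by simp⟩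
  smul_mem' := by
    rintro r f ⟨hf1, hf2⟩
    refine ⟨fun x => target.smul_mem r (hf1 x), fun π x y hxy => ?_⟩
    simp only [LinearMap.smul_apply, hf2 π x y hxy, map_smul]

/-- `μ` (a partition of `n`) is obtained from `λ` (a partition of `n+1`) by removing
the removable node in row `row`. -/
def Removes {n : ℕ} (lam : Partition (n + 1)) (mu : Partition n) (row : ℕ) : Prop :=
  lam.parts row = mu.parts row + 1 ∧ ∀ j, j ≠ row → mu.parts j = lam.parts j

/-- The dominance order: `mu ⊵ nu`. -/
def Dominates {n : ℕ} (mu nu : Partition n) : Prop :=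
  ∀ k, ∑ i ∈ Finset.Icc 1 k, nu.parts i ≤ ∑ i ∈ Finset.Icc 1 k, mu.parts i

/-- Strict dominance `mu ◁ nu`. -/
def DomLT {n : ℕ} (mu nu : Partition n) : Prop :=
  Dominates nu mu ∧ mu.parts ≠ nu.parts


/-! ### The `gl`-operators on functions of labelings -/

/-- Functions on labelings of the `n` symbols by natural numbers. -/
abbrev LFun (F : Type*) (n : ℕ) := (Fin n → ℕ) → F

/-- The operator which replaces one label `j` by a label `i`, in coefficient form. -/
noncomputable def opE (F : Type*) [Field F] {n : ℕ} (i j : ℕ) : Module.End F (LFun F n) where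
  toFun X := fun g => ∑ u, if g u = i then X (Function.update g u j) else 0
  map_add' X Y := by
    funext g
    simp only [Pi.add_apply, ← Finset.sum_add_distrib]
    refine Finset.sum_congr rfl fun u _ => ?_
    split_ifs <;> simp
  map_smul' c X := by
    funext g
    simp only [Pi.smul_apply, smul_eq_mul, RingHom.id_apply, Finset.mul_sum]
    refine Finset.sum_congr rfl fun u _ => ?_
    split_ifs <;> simp

section Ops

variable {F : Type*} [Field F]

lemma opE_apply (i j : ℕ) (X : LFun F n) (g : Fin n → ℕ) :
    opE F i j X g = ∑ u, if g u = i then X (Function.update g u j) else 0 := rfl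

lemma opE_opE (i j k l : ℕ) (X : LFun F n) (g : Fin n → ℕ) :
    opE F i j (opE F k l X) g = (if j = k then opE F i l X g else 0) +
      ∑ u, ∑ v, if u ≠ v ∧ g u = i ∧ g v = k then
        X (Function.update (Function.update g u j) v l) else 0 := by
  have h1 : (if j = k then opE F i l X g else 0) =
      ∑ u, if g u = i ∧ j = k then X (Function.update g u l) else 0 := by
    split_ifs with h
    · simp [opE_apply, h]
    · simp [h]
  rw [h1, ← Finset.sum_add_distrib, opE_apply]
  refine Finset.sum_congr rfl fun u _ => ?_
  rw [opE_apply]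
  by_cases hu : g u = i
  · simp only [hu, if_true, true_and]
    rw [← Finset.sum_erase_add _ _ (Finset.mem_univ u), add_comm]
    congr 1
    · simp
    · rw [← Finset.sum_erase_add (a := u) Finset.univ _ (Finset.mem_univ u)]
      simp only [ne_eq, not_true_eq_false, false_and, if_false, add_zero]
      refine Finset.sum_congr rfl fun v hv => ?_
      have hvu : v ≠ u := Finset.ne_of_mem_erase hv
      simp [Function.update_of_ne hvu, Ne.symm hvu]
  · simp [hu]

lemma opE_comm (i j k l : ℕ) (X : LFun F n) :
    opE F i j (opE F k l X) = opE F k l (opE F i j X) +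
      (if j = k then opE F i l X else 0) - (if l = i then opE F k j X else 0) := by
  funext g
  have h : ∀ (P : Prop) [Decidable P] (Y : LFun F n),
      (if P then Y else 0) g = if P then Y g else 0 := by
    intro P _ Y; split_ifs <;> rfl
  simp only [Pi.sub_apply, Pi.add_apply, h]
  rw [opE_opE, opE_opE]
  have hs : (∑ u, ∑ v, if u ≠ v ∧ g u = i ∧ g v = k then
        X (Function.update (Function.update g u j) v l) else 0) =
      ∑ u, ∑ v, if u ≠ v ∧ g u = k ∧ g v = i then
        X (Function.update (Function.update g u l) v j) else 0 := by
    rw [Finset.sum_comm]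
    refine Finset.sum_congr rfl fun u _ => Finset.sum_congr rfl fun v _ => ?_
    by_cases huv : u = v
    · simp [huv]
    · rw [Function.update_comm huv]
      simp only [ne_eq, huv, Ne.symm huv]
      congr 1
      simp [and_comm]
  rw [hs]
  ring

/-- The action of a permutation of the symbols on functions of labelings. -/
def opP (F : Type*) [Field F] {n : ℕ} (π : Equiv.Perm (Fin n)) : Module.End F (LFun F n) where
  toFun X := fun g => X (g ∘ π)
  map_add' X Y := rfl
  map_smul' c X := rfl

lemma opP_apply (π : Equiv.Perm (Fin n)) (X : LFun F n) (g : Fin n → ℕ) :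
    opP F π X g = X (g ∘ π) := rfl

lemma opE_opP (i j : ℕ) (π : Equiv.Perm (Fin n)) (X : LFun F n) :
    opE F i j (opP F π X) = opP F π (opE F i j X) := by
  funext g
  rw [opP_apply, opE_apply, opE_apply]
  refine (Fintype.sum_equiv π _ _ fun u => ?_).symm
  simp only [Function.comp_apply, opP_apply]
  congr 2
  funext v
  by_cases h : v = u
  · simp [h]
  · simp [Function.update_of_ne h, Function.update_of_ne (π.injective.ne h)]

end Ops

/-! ### Lowering operators -/

section Lowering

variable {F : Type*} [Field F]

lemma opE_comm_ne {i j k l : ℕ} (h1 : j ≠ k) (h2 : l ≠ i) (X : LFun F n) :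
    opE F i j (opE F k l X) = opE F k l (opE F i j X) := by
  rw [opE_comm]; simp [h1, h2]

/-- The partial lowering operators: `lowW a d c i m` starts at row `a`, uses at most one row
of each of the blocks `(d 0, d 1], …, (d (i-1), d i]`, and finally jumps to row `m`. -/
noncomputable def lowW (n : ℕ) (a : ℕ) (d : ℕ → ℕ) (c : ℕ → F) : ℕ → ℕ → Module.End F (LFun F n)
  | 0, m => opE F m a
  | i + 1, m => c i • lowW n a d c i m +
      ∑ j ∈ Finset.Ioc (d i) (d (i + 1)), opE F m j * lowW n a d c i j

lemma lowW_zero (a : ℕ) (d : ℕ → ℕ) (c : ℕ → F) (m : ℕ) (X : LFun F n) :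
    lowW n a d c 0 m X = opE F m a X := rfl

lemma lowW_succ (a : ℕ) (d : ℕ → ℕ) (c : ℕ → F) (i m : ℕ) (X : LFun F n) :
    lowW n a d c (i + 1) m X = c i • lowW n a d c i m X +
      ∑ j ∈ Finset.Ioc (d i) (d (i + 1)), opE F m j (lowW n a d c i j X) := by
  rw [lowW]
  simp [LinearMap.sum_apply]

lemma lowW_opP (a : ℕ) (d : ℕ → ℕ) (c : ℕ → F) (π : Equiv.Perm (Fin n)) (i : ℕ) :
    ∀ (m : ℕ) (X : LFun F n), lowW n a d c i m (opP F π X) = opP F π (lowW n a d c i m X) := by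
  induction i with
  | zero => intro m X; simp only [lowW_zero, opE_opP]
  | succ i ih => intro m X; simp only [lowW_succ, ih, opE_opP, map_add, map_smul, map_sum]

variable {a : ℕ} {d : ℕ → ℕ} {c : ℕ → F}

lemma lowW_comm (hd : StrictMono d) (hd0 : d 0 = a) (i : ℕ) :
    ∀ (m x y : ℕ) (X : LFun F n), d i < x → d i < y →
      opE F x y (lowW n a d c i m X) = lowW n a d c i m (opE F x y X) +
        if y = m then lowW n a d c i x X else 0 := by
  induction i with
  | zero =>
    intro m x y X hx hy
    have : a ≠ x := by omega
    simp only [lowW_zero]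
    rw [opE_comm, if_neg this, sub_zero]
  | succ i ih =>
    intro m x y X hx hy
    have hlt : d i < d (i + 1) := hd (Nat.lt_succ_self i)
    simp only [lowW_succ, map_add, map_smul, map_sum]
    rw [ih m x y X (by omega) (by omega)]
    have h1 : ∀ j ∈ Finset.Ioc (d i) (d (i + 1)), opE F x y (opE F m j (lowW n a d c i j X)) =
        opE F m j (lowW n a d c i j (opE F x y X)) +
          if y = m then opE F x j (lowW n a d c i j X) else 0 := by
      intro j hj
      rw [Finset.mem_Ioc] at hj
      rw [opE_comm, ih j x y X (by omega) (by omega), if_neg (show y ≠ j by omega), add_zero,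
        if_neg (show j ≠ x by omega), sub_zero]
    rw [Finset.sum_congr rfl h1, Finset.sum_add_distrib]
    split_ifs
    · rw [smul_add]; abel
    · simp

/-- The operator which precedes the last jump. -/
noncomputable def lowZ (n : ℕ) (a : ℕ) (d : ℕ → ℕ) (c : ℕ → F) : ℕ → Module.End F (LFun F n)
  | 0 => 1
  | i + 1 => lowW n a d c i (d (i + 1))

lemma lowZ_comm (hd : StrictMono d) (hd0 : d 0 = a) (i : ℕ) (x y : ℕ) (X : LFun F n)
    (hx : d i < x) (hy : d i < y) :
    opE F x y (lowZ n a d c i X) = lowZ n a d c i (opE F x y X) := by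
  cases i with
  | zero => rfl
  | succ i =>
    have hlt : d i < d (i + 1) := hd (Nat.lt_succ_self i)
    simp only [lowZ]
    rw [lowW_comm hd hd0 i _ _ _ _ (by omega) (by omega), if_neg (by omega), add_zero]

/-- The scalars in the lowering operators. -/
def lowC (F : Type*) [Field F] (β : ℕ → ℕ) (a : ℕ) (d : ℕ → ℕ) (i : ℕ) : F :=
  ((β a : F) - a) - ((β (d i + 1) : F) - ((d i + 1 : ℕ) : F)) - 1

lemma lowW_raise (hd : StrictMono d) (hd0 : d 0 = a) (β : ℕ → ℕ)
    (hc : c = lowC F β a d) (v : LFun F n) (q : ℕ)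
    (hE : ∀ t, 1 ≤ t → opE F t (t + 1) v = 0)
    (hH : ∀ t, opE F t t v = (β t : F) • v)
    (hβ : ∀ i, i < q → β (d i + 1) = β (d (i + 1)))
    (hB : ∀ i, i < q → ∀ j j', d i < j → j < j' → j' ≤ d (i + 1) → opE F j' j v = 0)
    (ha : 1 ≤ a) (i : ℕ) : i ≤ q →
    (∀ t m, 1 ≤ t → t < d i → d i < m → opE F t (t + 1) (lowW n a d c i m v) = 0) ∧
    (∀ m, d i + 1 < m → opE F (d i) (d i + 1) (lowW n a d c i m v) =
      - opE F m (d i + 1) (lowZ n a d c i v)) ∧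
    opE F (d i) (d i + 1) (lowW n a d c i (d i + 1) v) = c i • lowZ n a d c i v := by
  induction i with
  | zero =>
    intro _
    refine ⟨fun t m ht hta hm => ?_, fun m hm => ?_, ?_⟩
    · rw [lowW_zero, opE_comm_ne (by omega) (by omega), hE t ht, map_zero]
    · rw [lowW_zero, hd0, opE_comm, hE a ha, map_zero, if_neg (by omega), if_pos rfl]
      simp [lowZ]
    · rw [lowW_zero, hd0, opE_comm, hE a ha, map_zero, if_pos rfl, if_pos rfl, hH, hH, hc, lowC, hd0]
      simp only [lowZ, Module.End.one_apply, zero_add]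
      rw [← sub_smul]
      congr 1
      push_cast
      ring
  | succ i ih =>
    intro hiq
    obtain ⟨hR, hS1, hS2⟩ := ih (by omega)
    have hlt : d i < d (i + 1) := hd (Nat.lt_succ_self i)
    have hdi : 1 ≤ d i := by
      have := hd.monotone (Nat.zero_le i)
      omega
    have hhi : ∀ t m, d i < t → opE F t (t + 1) (lowW n a d c i m v) =
        if t + 1 = m then lowW n a d c i t v else 0 := by
      intro t m ht
      rw [lowW_comm hd hd0 i _ _ _ _ ht (by omega), hE t (by omega), map_zero, zero_add]
    refine ⟨fun t m ht htd hm => ?_, fun m hm => ?_, ?_⟩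
    · rw [lowW_succ, map_add, map_smul, map_sum]
      rcases lt_trichotomy t (d i) with h | h | h
      · rw [hR t m ht h (by omega), smul_zero, zero_add]
        refine Finset.sum_eq_zero fun j hj => ?_
        rw [Finset.mem_Ioc] at hj
        rw [opE_comm_ne (by omega) (by omega), hR t j ht h (by omega), map_zero]
      · subst h
        rw [hS1 m (by omega)]
        have hmem : d i + 1 ∈ Finset.Ioc (d i) (d (i + 1)) := by
          rw [Finset.mem_Ioc]; omega
        rw [Finset.sum_eq_single_of_mem _ hmem]
        · rw [opE_comm_ne (by omega) (by omega), hS2, map_smul]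
          simp
        · intro j hj hne
          rw [Finset.mem_Ioc] at hj
          rw [opE_comm_ne (by omega) (by omega), hS1 j (by omega),
            lowZ_comm hd hd0 i _ _ _ (by omega) (by omega),
            hB i (by omega) (d i + 1) j (by omega) (by omega) (by omega)]
          simp
      · rw [hhi t m h, if_neg (by omega), smul_zero, zero_add]
        have h1 : ∀ j ∈ Finset.Ioc (d i) (d (i + 1)),
            opE F t (t + 1) (opE F m j (lowW n a d c i j v)) =
            (if j = t + 1 then opE F m (t + 1) (lowW n a d c i t v) else 0) -
            (if j = t then opE F m (t + 1) (lowW n a d c i t v) else 0) := by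
          intro j hj
          rw [Finset.mem_Ioc] at hj
          rw [opE_comm, hhi t j h, if_neg (show t + 1 ≠ m by omega), add_zero]
          by_cases h1 : j = t + 1
          · subst h1; simp
          · by_cases h2 : j = t
            · subst h2; simp
            · simp [h1, h2, Ne.symm h1]
        rw [Finset.sum_congr rfl h1, Finset.sum_sub_distrib, Finset.sum_ite_eq', Finset.sum_ite_eq',
          if_pos (by rw [Finset.mem_Ioc]; omega), if_pos (by rw [Finset.mem_Ioc]; omega), sub_self]
    · rw [lowW_succ, map_add, map_smul, map_sum, hhi _ _ hlt, if_neg (by omega), smul_zero,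
        zero_add]
      have h1 : ∀ j ∈ Finset.Ioc (d i) (d (i + 1)),
          opE F (d (i + 1)) (d (i + 1) + 1) (opE F m j (lowW n a d c i j v)) =
          (if j = d (i + 1) then - opE F m (d (i + 1) + 1) (lowW n a d c i j v) else 0) := by
        intro j hj
        rw [Finset.mem_Ioc] at hj
        rw [opE_comm, hhi _ j hlt, if_neg (show d (i + 1) + 1 ≠ m by omega), add_zero,
          if_neg (show d (i + 1) + 1 ≠ j by omega), map_zero]
        split_ifs <;> simp
      rw [Finset.sum_congr rfl h1, Finset.sum_ite_eq', if_pos (by rw [Finset.mem_Ioc]; omega)]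
      rfl
    · rw [lowW_succ, map_add, map_smul, map_sum, hhi _ _ hlt, if_pos rfl]
      have h1 : ∀ j ∈ Finset.Ioc (d i) (d (i + 1)),
          opE F (d (i + 1)) (d (i + 1) + 1) (opE F (d (i + 1) + 1) j (lowW n a d c i j v)) =
          lowW n a d c i (d (i + 1)) v + (if j = d (i + 1) then
            ((β (d (i + 1)) : F) - β (d (i + 1) + 1)) • lowW n a d c i (d (i + 1)) v else 0) := by
        intro j hj
        rw [Finset.mem_Ioc] at hj
        rw [opE_comm, hhi _ j hlt, if_pos rfl, if_neg (show d (i + 1) + 1 ≠ j by omega), map_zero,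
          zero_add, lowW_comm hd hd0 i _ _ _ _ (by omega) (by omega), if_pos rfl]
        by_cases hj' : j = d (i + 1)
        · subst hj'
          rw [hH, if_pos rfl, if_pos rfl, map_smul,
            lowW_comm hd hd0 i _ _ _ _ (by omega) (by omega), hH, map_smul, if_neg (by omega)]
          rw [sub_smul]; abel
        · rw [hB i (by omega) j (d (i + 1)) (by omega) (by omega) le_rfl, map_zero, if_neg hj',
            if_neg hj']
          simp
      rw [Finset.sum_congr rfl h1, Finset.sum_add_distrib, Finset.sum_ite_eq',
        if_pos (by rw [Finset.mem_Ioc]; omega), Finset.sum_const, Nat.card_Ioc]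
      simp only [lowZ]
      rw [← Nat.cast_smul_eq_nsmul F, ← add_smul, ← add_smul]
      congr 1
      rw [hc, lowC, lowC, hβ i (by omega), Nat.cast_sub hlt.le]
      push_cast
      ring

/-- The lowering operator from row `a` to row `b = d q + 1` produces vectors killed by all raising
operators, provided that the residues agree. -/
lemma lowW_killed (hd : StrictMono d) (hd0 : d 0 = a) (β : ℕ → ℕ)
    (hc : c = lowC F β a d) (v : LFun F n) (q : ℕ)
    (hE : ∀ t, 1 ≤ t → opE F t (t + 1) v = 0)
    (hH : ∀ t, opE F t t v = (β t : F) • v)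
    (hβ : ∀ i, i < q → β (d i + 1) = β (d (i + 1)))
    (hB : ∀ i, i < q → ∀ j j', d i < j → j < j' → j' ≤ d (i + 1) → opE F j' j v = 0)
    (ha : 1 ≤ a) (hres : c q = 0) (t : ℕ) (ht : 1 ≤ t) :
    opE F t (t + 1) (lowW n a d c q (d q + 1) v) = 0 := by
  obtain ⟨hR, -, hS2⟩ := lowW_raise hd hd0 β hc v q hE hH hβ hB ha q le_rfl
  rcases lt_trichotomy t (d q) with h | h | h
  · exact hR t _ ht h (by omega)
  · subst h; rw [hS2, hres, zero_smul]
  · rw [lowW_comm hd hd0 q _ _ _ _ h (by omega), hE t ht, map_zero, if_neg (by omega), add_zero]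

/-- Functions supported on labelings of content `β - ε_a + ε_m`. -/
def HasContent (X : LFun F n) (β : ℕ → ℕ) : Prop :=
  ∀ g, X g ≠ 0 → ∀ i, (Finset.univ.filter fun k => g k = i).card = β i

lemma card_update (g : Fin n → ℕ) (u : Fin n) (j i : ℕ) :
    (Finset.univ.filter fun k => Function.update g u j k = i).card + (if g u = i then 1 else 0) =
      (Finset.univ.filter fun k => g k = i).card + (if j = i then 1 else 0) := by
  simp only [Finset.card_filter]
  rw [← Finset.sum_erase_add _ _ (Finset.mem_univ u),
    ← Finset.sum_erase_add (a := u) Finset.univ (fun k => if g k = i then 1 else 0)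
      (Finset.mem_univ u)]
  have : ∑ x ∈ Finset.univ.erase u, (if Function.update g u j x = i then 1 else 0) =
      ∑ x ∈ Finset.univ.erase u, (if g x = i then 1 else 0) := by
    refine Finset.sum_congr rfl fun x hx => ?_
    rw [Function.update_of_ne (Finset.ne_of_mem_erase hx)]
  rw [this, Function.update_self]
  ring

lemma exists_of_opE_ne_zero {i j : ℕ} {X : LFun F n} {g : Fin n → ℕ} (h : opE F i j X g ≠ 0) :
    ∃ u, g u = i ∧ X (Function.update g u j) ≠ 0 := by
  rw [opE_apply] at h
  obtain ⟨u, -, hu⟩ := Finset.exists_ne_zero_of_sum_ne_zero h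
  by_cases h1 : g u = i
  · exact ⟨u, h1, by simpa [h1] using hu⟩
  · simp [h1] at hu

lemma opE_diag {X : LFun F n} {β : ℕ → ℕ} (hX : HasContent X β) (t : ℕ) :
    opE F t t X = (β t : F) • X := by
  funext g
  rw [opE_apply, Pi.smul_apply, smul_eq_mul]
  by_cases hg : X g = 0
  · rw [hg, mul_zero]
    refine Finset.sum_eq_zero fun u _ => ?_
    split_ifs with h
    · rw [← h, Function.update_eq_self, hg]
    · rfl
  · rw [← hX g hg t, Finset.card_filter]
    push_cast
    rw [Finset.sum_mul]
    refine Finset.sum_congr rfl fun u _ => ?_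
    split_ifs with h
    · rw [← h, Function.update_eq_self, one_mul]
    · simp

lemma lowW_content (a : ℕ) (d : ℕ → ℕ) (c : ℕ → F) (β : ℕ → ℕ) (X : LFun F n)
    (hX : HasContent X β) (i : ℕ) : ∀ m g, lowW n a d c i m X g ≠ 0 → ∀ t,
      (Finset.univ.filter fun k => g k = t).card + (if a = t then 1 else 0) =
        β t + (if m = t then 1 else 0) := by
  induction i with
  | zero =>
    intro m g hg t
    obtain ⟨u, hu, h⟩ := exists_of_opE_ne_zero hg
    have h1 := card_update g u a t
    rw [hX _ h t, hu] at h1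
    omega
  | succ i ih =>
    intro m g hg t
    rw [lowW_succ, Pi.add_apply, Pi.smul_apply, Finset.sum_apply] at hg
    by_cases h0 : lowW n a d c i m X g = 0
    · rw [h0, smul_zero, zero_add] at hg
      obtain ⟨j, -, hj⟩ := Finset.exists_ne_zero_of_sum_ne_zero hg
      obtain ⟨u, hu, h⟩ := exists_of_opE_ne_zero hj
      have h1 := card_update g u j t
      have h2 := ih _ _ h t
      rw [hu] at h1
      omega
    · exact ih m g h0 t

/-- Functions whose support consists of labelings such that the column `y` contains `k`. -/
def HasLabel (col : Fin n → ℕ) (X : LFun F n) (k y : ℕ) : Prop :=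
  ∀ g, X g ≠ 0 → ∃ u, col u = y ∧ g u = k

lemma HasLabel.opE {col : Fin n → ℕ} {X : LFun F n} {k y : ℕ} (h : HasLabel col X k y) {i j : ℕ}
    (hj : j ≠ k) : HasLabel col (opE F i j X) k y := by
  intro g hg
  obtain ⟨u, hu, hX⟩ := exists_of_opE_ne_zero hg
  obtain ⟨w, hw, hk⟩ := h _ hX
  refine ⟨w, hw, ?_⟩
  have : w ≠ u := by
    rintro rfl
    rw [Function.update_self] at hk
    exact hj hk
  rwa [Function.update_of_ne this] at hk

lemma HasLabel.lowW {col : Fin n → ℕ} {X : LFun F n} {k y : ℕ} (h : HasLabel col X k y)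
    (hd : StrictMono d) (hd0 : d 0 = a) (i : ℕ) : d i < k → ∀ m,
      HasLabel col (lowW n a d c i m X) k y := by
  induction i with
  | zero => intro hk m; exact h.opE (by omega)
  | succ i ih =>
    intro hk m g hg
    have hlt : d i < d (i + 1) := hd (Nat.lt_succ_self i)
    rw [lowW_succ, Pi.add_apply, Pi.smul_apply, Finset.sum_apply] at hg
    by_cases h0 : CarterPayne.lowW n a d c i m X g = 0
    · rw [h0, smul_zero, zero_add] at hg
      obtain ⟨j, hjm, hj⟩ := Finset.exists_ne_zero_of_sum_ne_zero hg
      rw [Finset.mem_Ioc] at hjm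
      exact (ih (by omega) j).opE (by omega) g hj
    · exact ih (by omega) m g h0

/-- The test labelings for the non-vanishing of the lowering operators. -/
def testG (g0 : Fin n → ℕ) (w : ℕ → Fin n) (d : ℕ → ℕ) : ℕ → Fin n → ℕ
  | 0 => g0
  | i + 1 => Function.update (testG g0 w d i) (w i) (d (i + 1))

lemma testG_of_ne (g0 : Fin n → ℕ) (w : ℕ → Fin n) (d : ℕ → ℕ) (i : ℕ) (z : Fin n)
    (h : ∀ j, j < i → z ≠ w j) : testG g0 w d i z = g0 z := by
  induction i with
  | zero => rfl
  | succ i ih =>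
    rw [testG, Function.update_of_ne (h i (by omega)), ih fun j hj => h j (by omega)]

/-- Evaluation of a sum of the form `opE` at a test labeling. -/
lemma opE_eval {col : Fin n → ℕ} {Y : LFun F n} {k y m : ℕ} (hY : HasLabel col Y k y)
    {g : Fin n → ℕ} {u : Fin n} (hu : col u = y) (hgu : g u = m)
    (hno : ∀ z, col z = y → g z ≠ k) (huniq : ∀ z, col z = y → g z = m → z = u) :
    opE F m k Y g = Y (Function.update g u k) := by
  rw [opE_apply, Finset.sum_eq_single u, if_pos hgu]
  · intro z _ hz
    split_ifs with h
    · by_contra hne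
      obtain ⟨x, hx, hxk⟩ := hY _ hne
      by_cases hxz : x = z
      · subst hxz
        exact hz (huniq x hx h)
      · rw [Function.update_of_ne hxz] at hxk
        exact hno x hx hxk
    · rfl
  · simp

lemma lowW_test {col : Fin n → ℕ} {X : LFun F n} {g0 : Fin n → ℕ} {w : ℕ → Fin n} {q : ℕ}
    (hd : StrictMono d) (hd0 : d 0 = a)
    (hX : ∀ i, i ≤ q → HasLabel col X (d i) (col (w i)))
    (hinj : ∀ i j, i ≤ q → j ≤ q → col (w i) = col (w j) → i = j)
    (hg0 : ∀ i, i ≤ q → ∀ z, col z = col (w i) → (g0 z = d i ↔ z = w i))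
    (hno : ∀ i, i ≤ q → ∀ z, col z = col (w i) → g0 z ≠ d (i + 1)) (i : ℕ) : i ≤ q →
    lowW n a d c i (d (i + 1)) X (testG g0 w d (i + 1)) = X g0 := by
  have key : ∀ i, i ≤ q → ∀ z, col z = col (w i) → z ≠ w i → testG g0 w d (i + 1) z = g0 z := by
    intro i hi z hz hzi
    refine testG_of_ne _ _ _ _ _ fun j hj => ?_
    rintro rfl
    have := hinj j i (by omega) hi hz
    subst this
    exact hzi rfl
  have hself : ∀ i, testG g0 w d (i + 1) (w i) = d (i + 1) := by
    intro i; rw [testG, Function.update_self]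
  have hback : ∀ i, i ≤ q →
      Function.update (testG g0 w d (i + 1)) (w i) (d i) = testG g0 w d i := by
    intro i hi
    rw [testG, Function.update_idem]
    have : testG g0 w d i (w i) = d i := by
      rw [testG_of_ne, (hg0 i hi (w i) rfl).2 rfl]
      intro j hj h
      have := hinj i j hi (by omega) (by rw [h])
      omega
    rw [← this, Function.update_eq_self]
  have hno1 : ∀ i, i ≤ q → ∀ z, col z = col (w i) → testG g0 w d (i + 1) z ≠ d i := by
    intro i hi z hz h
    by_cases hzi : z = w i
    · subst hzi
      rw [hself] at h
      have : d i < d (i + 1) := hd (Nat.lt_succ_self i)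
      omega
    · rw [key i hi z hz hzi] at h
      exact hzi ((hg0 i hi z hz).1 h)
  have huniq : ∀ i, i ≤ q → ∀ z, col z = col (w i) → testG g0 w d (i + 1) z = d (i + 1) →
      z = w i := by
    intro i hi z hz h
    by_contra hzi
    rw [key i hi z hz hzi] at h
    exact hno i hi z hz h
  induction i with
  | zero =>
    intro hi
    rw [lowW_zero, ← hd0, opE_eval (hX 0 hi) rfl (hself 0) (hno1 0 hi) (huniq 0 hi), hback 0 hi]
    rfl
  | succ i ih =>
    intro hi
    have hlt : d i < d (i + 1) := hd (Nat.lt_succ_self i)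
    have hl : ∀ m, HasLabel col (lowW n a d c i m X) (d (i + 1)) (col (w (i + 1))) :=
      fun m => (hX (i + 1) hi).lowW hd hd0 i hlt m
    have hzero : ∀ Y : LFun F n, HasLabel col Y (d (i + 1)) (col (w (i + 1))) →
        Y (testG g0 w d (i + 1 + 1)) = 0 := by
      intro Y hY
      by_contra hne
      obtain ⟨u, hu, hk⟩ := hY _ hne
      exact hno1 (i + 1) hi u hu hk
    rw [lowW_succ, Pi.add_apply, Pi.smul_apply, Finset.sum_apply, hzero _ (hl _), smul_zero,
      zero_add, Finset.sum_eq_single_of_mem (d (i + 1)) (by rw [Finset.mem_Ioc]; omega)]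
    · rw [opE_eval (hl _) rfl (hself (i + 1)) (hno1 (i + 1) hi) (huniq (i + 1) hi),
        hback (i + 1) hi]
      exact ih (by omega)
    · intro j _ hj
      exact hzero _ ((hl j).opE hj)

end Lowering

/-! ### Placements, antisymmetry and polytabloids as functions -/

section Place

variable {α : Partition n} (T : Placement α)

/-- The row of a symbol. -/
def Placement.row (k : Fin n) : ℕ := (T.pos k).1

/-- The column of a symbol. -/
def Placement.col (k : Fin n) : ℕ := (T.pos k).2

lemma Placement.row_pos (k : Fin n) : 0 < T.row k := (T.mem k).1

lemma Placement.col_pos (k : Fin n) : 0 < T.col k := (T.mem k).2.1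

lemma Placement.col_le (k : Fin n) : T.col k ≤ α.parts (T.row k) := (T.mem k).2.2

lemma Placement.eq_of {u v : Fin n} (h1 : T.row u = T.row v) (h2 : T.col u = T.col v) : u = v :=
  T.inj (Prod.ext h1 h2)

lemma Placement.exists_cell {i j : ℕ} (hi : 0 < i) (hj : 0 < j) (h : j ≤ α.parts i) :
    ∃ k, T.row k = i ∧ T.col k = j := by
  obtain ⟨k, hk⟩ := T.surj (i, j) ⟨hi, hj, h⟩
  exact ⟨k, by simp [Placement.row, hk], by simp [Placement.col, hk]⟩

lemma mem_colStab {π : Equiv.Perm (Fin n)} :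
    π ∈ colStab T ↔ ∀ k, T.col (π k) = T.col k := by
  simp [colStab, Placement.col]

end Place

section Anti

variable {F : Type*} [Field F]

/-- Antisymmetry with respect to the column permutations. -/
def Anti (col : Fin n → ℕ) (X : LFun F n) : Prop :=
  ∀ π : Equiv.Perm (Fin n), (∀ k, col (π k) = col k) → ∀ g : Fin n → ℕ,
    X (g ∘ π) = ((Equiv.Perm.sign π : ℤ) : F) * X g

lemma swap_col {col : Fin n → ℕ} {u v : Fin n} (h : col u = col v) (k : Fin n) :
    col (Equiv.swap u v k) = col k := by
  by_cases h1 : k = u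
  · subst h1; simp [h]
  · by_cases h2 : k = v
    · subst h2; simp [h]
    · rw [Equiv.swap_apply_of_ne_of_ne h1 h2]

lemma Anti.swap {col : Fin n → ℕ} {X : LFun F n} (hX : Anti col X) {u v : Fin n} (huv : u ≠ v)
    (h : col u = col v) (g : Fin n → ℕ) : X (g ∘ Equiv.swap u v) = - X g := by
  rw [hX _ (swap_col h), Equiv.Perm.sign_swap huv]; simp

lemma Anti.dup (h2 : (2 : F) ≠ 0) {col : Fin n → ℕ} {X : LFun F n} (hX : Anti col X)
    {u v : Fin n} (huv : u ≠ v) (h : col u = col v) {g : Fin n → ℕ} (hg : g u = g v) :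
    X g = 0 := by
  have h1 := hX.swap huv h g
  have h3 : g ∘ Equiv.swap u v = g := by
    funext k
    by_cases h1 : k = u
    · subst h1; simp [hg]
    · by_cases h2 : k = v
      · subst h2; simp [hg]
      · rw [Function.comp_apply, Equiv.swap_apply_of_ne_of_ne h1 h2]
  rw [h3] at h1
  have : (2 : F) * X g = 0 := by linear_combination h1
  exact (mul_eq_zero.1 this).resolve_left h2

lemma Anti.opE {col : Fin n → ℕ} {X : LFun F n} (hX : Anti col X) (i j : ℕ) :
    Anti col (opE F i j X) := by
  intro π hπ g
  have h1 : opP F π X = ((Equiv.Perm.sign π : ℤ) : F) • X := by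
    funext g; rw [opP_apply, hX π hπ]; rfl
  have h2 := congrFun (opE_opP i j π X) g
  rw [h1, map_smul] at h2
  rw [opP_apply] at h2
  rw [← h2]; rfl

/-- The coefficient function of an element of the permutation module. -/
noncomputable def ext (F : Type*) [Field F] {n : ℕ} (c : ℕ → ℕ) : PermMod F n c →ₗ[F] LFun F n where
  toFun x := fun g => by
    classical
    exact if h : ∀ i, (Finset.univ.filter fun k => g k = i).card = c i then x ⟨g, h⟩ else 0
  map_add' x y := by
    funext g
    by_cases h : ∀ i, (Finset.univ.filter fun k => g k = i).card = c i
    · simp only [Pi.add_apply, dif_pos h]; rfl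
    · simp only [Pi.add_apply, dif_neg h, add_zero]
  map_smul' r x := by
    funext g
    by_cases h : ∀ i, (Finset.univ.filter fun k => g k = i).card = c i
    · simp only [RingHom.id_apply, Pi.smul_apply, dif_pos h]; rfl
    · simp only [RingHom.id_apply, Pi.smul_apply, dif_neg h, smul_zero]

lemma ext_pos {c : ℕ → ℕ} (x : PermMod F n c) (t : Tabloid n c) : ext F c x t.1 = x t := by
  have h : ∀ i, (Finset.univ.filter fun k => t.1 k = i).card = c i := t.2
  exact dif_pos h

lemma ext_content {c : ℕ → ℕ} (x : PermMod F n c) : HasContent (ext F c x) c := by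
  intro g hg
  by_contra h
  exact hg (dif_neg h)

lemma ext_inj {c : ℕ → ℕ} : Function.Injective (ext F (n := n) c) := by
  intro x y h
  refine Finsupp.ext fun t => ?_
  rw [← ext_pos, ← ext_pos, h]

lemma content_comp {c : ℕ → ℕ} {g : Fin n → ℕ} (π : Equiv.Perm (Fin n))
    (h : ∀ i, (Finset.univ.filter fun k => g k = i).card = c i) (i : ℕ) :
    (Finset.univ.filter fun k => (g ∘ π) k = i).card = c i := by
  rw [← h i]
  exact Finset.card_equiv π fun a => by simp

lemma ext_permM (c : ℕ → ℕ) (π : Equiv.Perm (Fin n)) (x : PermMod F n c) :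
    ext F c (permM F c π x) = opP F π (ext F c x) := by
  funext g
  rw [opP_apply]
  by_cases hg : ∀ i, (Finset.univ.filter fun k => g k = i).card = c i
  · have h2 := content_comp π hg
    have e1 := ext_pos (permM F c π x) ⟨g, hg⟩
    have e2 := ext_pos x ⟨g ∘ π, h2⟩
    refine e1.trans (Eq.trans ?_ e2.symm)
    have h3 : (⟨g, hg⟩ : Tabloid n c) = permTabloid c π ⟨g ∘ π, h2⟩ := by
      apply Subtype.ext
      funext k
      simp [permTabloid]
    have hinj : Function.Injective (permTabloid (n := n) c π) := by
      intro s t hst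
      apply Subtype.ext
      funext k
      have := congrFun (congrArg Subtype.val hst) (π k)
      simpa [permTabloid] using this
    rw [h3]
    exact Finsupp.mapDomain_apply hinj _ _
  · have h1 : ext F c (permM F c π x) g = 0 := dif_neg hg
    have h2 : ext F c x (g ∘ π) = 0 := by
      apply dif_neg
      intro h
      apply hg
      intro i
      have := content_comp π.symm h i
      simpa [Function.comp_assoc] using this
    rw [h1, h2]

/-- the polytabloid as a function on labelings -/
lemma ext_poly {α : Partition n} (T : Placement α) (g : Fin n → ℕ) :
    ext F α.parts (polytabloid F T) g =
      ∑ σ ∈ colStab T, if T.row ∘ σ = g then ((Equiv.Perm.sign σ : ℤ) : F) else 0 := by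
  classical
  by_cases hg : ∀ i, (Finset.univ.filter fun k => g k = i).card = α.parts i
  · obtain ⟨t, rfl⟩ : ∃ t : Tabloid n α.parts, t.1 = g := ⟨⟨g, hg⟩, rfl⟩
    rw [ext_pos, polytabloid, Finsupp.finsetSum_apply]
    refine Finset.sum_congr rfl fun σ _ => ?_
    rw [Finsupp.smul_apply, Finsupp.single_apply]
    have : rowTabloid T σ = t ↔ T.row ∘ σ = t.1 := by
      constructor
      · intro h; exact congrArg Subtype.val h
      · intro h; exact Subtype.ext h
    by_cases h : T.row ∘ σ = t.1
    · rw [if_pos h, if_pos (this.2 h)]; simp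
    · rw [if_neg h, if_neg (fun h' => h (this.1 h'))]; simp
  · rw [show ext F α.parts (polytabloid F T) g = 0 from dif_neg hg]
    symm
    refine Finset.sum_eq_zero fun σ _ => ?_
    rw [if_neg]
    rintro rfl
    exact hg (rowTabloid T σ).2

variable {α : Partition n} (T : Placement α)

lemma poly_anti : Anti T.col (ext F α.parts (polytabloid F T)) := by
  intro π hπ g
  rw [ext_poly, ext_poly, Finset.mul_sum]
  refine Finset.sum_nbij' (fun σ => σ * π⁻¹) (fun σ => σ * π) ?_ ?_ ?_ ?_ ?_
  · intro σ hσ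
    rw [mem_colStab] at hσ ⊢
    intro k
    rw [Equiv.Perm.mul_apply, hσ]
    have := hπ (π⁻¹ k)
    simpa using this.symm
  · intro σ hσ
    rw [mem_colStab] at hσ ⊢
    intro k
    rw [Equiv.Perm.mul_apply, hσ, hπ]
  · intro σ _; simp
  · intro σ _; simp
  · intro σ _
    have h1 : T.row ∘ σ = g ∘ π ↔ T.row ∘ (σ * π⁻¹ : Equiv.Perm (Fin n)) = g := by
      constructor
      · intro h; funext k
        have := congrFun h (π⁻¹ k)
        simpa using this
      · intro h; funext k
        have := congrFun h (π k)
        simpa using this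
    by_cases h : T.row ∘ σ = g ∘ π
    · rw [if_pos h, if_pos (h1.1 h)]
      have : Equiv.Perm.sign σ = Equiv.Perm.sign π * Equiv.Perm.sign (σ * π⁻¹) := by
        rw [Equiv.Perm.sign_mul, Equiv.Perm.sign_inv, mul_comm (Equiv.Perm.sign σ), ← mul_assoc,
          Int.units_mul_self, one_mul]
      rw [this]; push_cast; ring
    · rw [if_neg h, if_neg (fun h' => h (h1.2 h')), mul_zero]

lemma poly_supp {g : Fin n → ℕ} (hg : ext F α.parts (polytabloid F T) g ≠ 0) :
    ∃ σ : Equiv.Perm (Fin n), (∀ k, T.col (σ k) = T.col k) ∧ g = T.row ∘ σ := by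
  rw [ext_poly] at hg
  obtain ⟨σ, hσ, h⟩ := Finset.exists_ne_zero_of_sum_ne_zero hg
  refine ⟨σ, (mem_colStab T).1 hσ, ?_⟩
  by_contra h'
  exact h (if_neg fun e => h' e.symm)

lemma poly_row : ext F α.parts (polytabloid F T) T.row = 1 := by
  rw [ext_poly, Finset.sum_eq_single 1]
  · simp
  · intro σ hσ h1
    rw [if_neg]
    intro h
    apply h1
    ext k
    rw [mem_colStab] at hσ
    have := T.eq_of (congrFun h k) (hσ k)
    simp [this]
  · intro h
    exact absurd ((mem_colStab T).2 fun k => rfl) h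

/-- If a row label occurs in a column, so does every label of a longer row. -/
lemma poly_label {g : Fin n → ℕ} (hg : ext F α.parts (polytabloid F T) g ≠ 0) (u : Fin n) {x y : ℕ}
    (hx : 0 < x) (hy : 0 < y) (hyu : y ≤ T.col u) (h : α.parts (g u) ≤ α.parts x) :
    ∃ v, T.col v = y ∧ g v = x := by
  obtain ⟨σ, hσ, rfl⟩ := poly_supp T hg
  have h1 := T.col_le (σ u)
  rw [hσ] at h1
  obtain ⟨k, hk1, hk2⟩ := T.exists_cell hx hy (le_trans hyu (le_trans h1 h))
  refine ⟨σ.symm k, ?_, ?_⟩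
  · have := hσ (σ.symm k)
    rw [← this]; simpa using hk2
  · simpa using hk1

lemma poly_killed (h2 : (2 : F) ≠ 0) {x y : ℕ} (hxy : x ≠ y) (hx : 0 < x)
    (h : α.parts y ≤ α.parts x) : opE F x y (ext F α.parts (polytabloid F T)) = 0 := by
  funext g
  by_contra hne
  obtain ⟨u, hu, hX⟩ := exists_of_opE_ne_zero hne
  obtain ⟨v, hv1, hv2⟩ := poly_label T hX u hx (T.col_pos u) le_rfl (by simpa using h)
  have huv : v ≠ u := by
    rintro rfl
    simp at hv2
    exact hxy hv2.symm
  rw [Function.update_of_ne huv] at hv2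
  exact hne (((poly_anti T).opE x y).dup h2 huv hv1 (hv2.trans hu.symm))

lemma poly_garnir (h2 : (2 : F) ≠ 0) (x : Fin n) (y : ℕ) (hy : 0 < y) (hyx : y < T.col x)
    (g : Fin n → ℕ) :
    ext F α.parts (polytabloid F T) g = ∑ u ∈ Finset.univ.filter (fun u => T.col u = y),
      ext F α.parts (polytabloid F T) (g ∘ Equiv.swap x u) := by
  classical
  set X := ext F α.parts (polytabloid F T) with hXdef
  have hA : Anti T.col X := poly_anti T
  have hne : ∀ u, T.col u = y → u ≠ x := by rintro u hu rfl; omega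
  have hsw : ∀ u v, T.col u = y → T.col v = y → v ≠ u → (g ∘ Equiv.swap x u) v = g v := by
    intro u v hu hv huv
    rw [Function.comp_apply, Equiv.swap_apply_of_ne_of_ne (hne v hv) huv]
  have hswu : ∀ u, (g ∘ Equiv.swap x u) u = g x := by intro u; simp
  have hswx : ∀ u, (g ∘ Equiv.swap x u) x = g u := by intro u; simp
  by_cases hd : ∃ u1 u2, u1 ≠ u2 ∧ T.col u1 = y ∧ T.col u2 = y ∧ g u1 = g u2
  · obtain ⟨u1, u2, h12, hu1, hu2, he⟩ := hd
    rw [hA.dup h2 h12 (hu1.trans hu2.symm) he]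
    symm
    rw [← Finset.sum_subset (s₁ := {u1, u2})]
    · rw [Finset.sum_pair h12]
      have : (g ∘ Equiv.swap x u1) ∘ Equiv.swap u1 u2 = g ∘ Equiv.swap x u2 := by
        funext k
        by_cases k1 : k = u1
        · subst k1
          rw [Function.comp_apply, Equiv.swap_apply_left, hsw k u2 hu1 hu2 h12.symm,
            hsw u2 k hu2 hu1 h12, he]
        · by_cases k2 : k = u2
          · subst k2
            rw [Function.comp_apply, Equiv.swap_apply_right, hswu, hswu]
          · rw [Function.comp_apply, Equiv.swap_apply_of_ne_of_ne k1 k2]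
            by_cases k3 : k = x
            · subst k3; rw [hswx, hswx, he]
            · rw [Function.comp_apply, Function.comp_apply, Equiv.swap_apply_of_ne_of_ne k3 k1,
                Equiv.swap_apply_of_ne_of_ne k3 k2]
      rw [← this, hA.swap h12 (hu1.trans hu2.symm)]
      ring
    · intro u hu
      simp only [Finset.mem_insert, Finset.mem_singleton] at hu
      rcases hu with rfl | rfl <;> simp [*]
    · intro u hu hu'
      simp only [Finset.mem_insert, Finset.mem_singleton, not_or] at hu'
      simp only [Finset.mem_filter, Finset.mem_univ, true_and] at hu
      refine hA.dup h2 h12 (hu1.trans hu2.symm) ?_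
      rw [hsw u u1 hu hu1 (Ne.symm hu'.1), hsw u u2 hu hu2 (Ne.symm hu'.2), he]
  · push Not at hd
    by_cases hx : ∃ u0, T.col u0 = y ∧ g u0 = g x
    · obtain ⟨u0, hu0, he⟩ := hx
      rw [Finset.sum_eq_single u0]
      · congr 1
        funext k
        by_cases k1 : k = x
        · subst k1; rw [hswx, he]
        · by_cases k2 : k = u0
          · subst k2; rw [hswu, he]
          · rw [Function.comp_apply, Equiv.swap_apply_of_ne_of_ne k1 k2]
      · intro u hu hu'
        simp only [Finset.mem_filter, Finset.mem_univ, true_and] at hu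
        refine hA.dup h2 hu' (hu.trans hu0.symm) ?_
        rw [hswu, hsw u u0 hu hu0 (Ne.symm hu'), he]
      · intro h; simp [hu0] at h
    · have hpos : ∀ g', X g' ≠ 0 → 0 < g' x := by
        intro g' h
        obtain ⟨σ, _, rfl⟩ := poly_supp T h
        exact T.row_pos _
      have h0 : X g = 0 := by
        by_contra h
        obtain ⟨v, hv⟩ := poly_label T h x (hpos g h) hy hyx.le le_rfl
        exact hx ⟨v, hv⟩
      rw [h0]
      symm
      refine Finset.sum_eq_zero fun u hu => ?_
      simp only [Finset.mem_filter, Finset.mem_univ, true_and] at hu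
      by_contra h
      obtain ⟨v, hv1, hv2⟩ := poly_label T h x (hpos _ h) hy hyx.le le_rfl
      rw [hswx] at hv2
      by_cases hvu : v = u
      · subst hvu
        rw [hswu] at hv2
        exact hx ⟨v, hu, hv2.symm⟩
      · rw [hsw u v hu hv1 hvu] at hv2
        exact hd v u hvu hv1 hu hv2

/-- The action of a permutation on placements. -/
def Placement.perm (π : Equiv.Perm (Fin n)) : Placement α where
  pos k := T.pos (π.symm k)
  mem k := T.mem _
  inj := T.inj.comp π.symm.injective
  surj c hc := by
    obtain ⟨k, hk⟩ := T.surj c hc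
    exact ⟨π k, by simpa using hk⟩

lemma permM_poly (π : Equiv.Perm (Fin n)) :
    permM F α.parts π (polytabloid F T) = polytabloid F (T.perm π) := by
  apply ext_inj
  rw [ext_permM]
  funext g
  rw [opP_apply, ext_poly, ext_poly]
  refine Finset.sum_nbij' (fun σ => π * σ * π⁻¹) (fun σ => π⁻¹ * σ * π) ?_ ?_ ?_ ?_ ?_
  · intro σ hσ
    rw [mem_colStab] at hσ ⊢
    intro k
    have := hσ (π⁻¹ k)
    simpa [Placement.col, Placement.perm] using this
  · intro σ hσ
    rw [mem_colStab] at hσ ⊢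
    intro k
    have := hσ (π k)
    simpa [Placement.col, Placement.perm] using this
  · intro σ _; group
  · intro σ _; group
  · intro σ _
    have h1 : T.row ∘ σ = g ∘ π ↔
        (T.perm π).row ∘ (π * σ * π⁻¹ : Equiv.Perm (Fin n)) = g := by
      constructor
      · intro h; funext k
        have := congrFun h (π⁻¹ k)
        simpa [Placement.row, Placement.perm] using this
      · intro h; funext k
        have := congrFun h (π k)
        simpa [Placement.row, Placement.perm] using this
    by_cases h : T.row ∘ σ = g ∘ π
    · rw [if_pos h, if_pos (h1.1 h)]
      have : Equiv.Perm.sign (π * σ * π⁻¹) = Equiv.Perm.sign σ := by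
        rw [Equiv.Perm.sign_mul, Equiv.Perm.sign_mul, Equiv.Perm.sign_inv,
          mul_comm (Equiv.Perm.sign π), mul_assoc, Int.units_mul_self, mul_one]
      rw [this]
    · rw [if_neg h, if_neg (fun h' => h (h1.2 h'))]

lemma exists_perm (T' : Placement α) : ∃ π, T' = T.perm π := by
  choose φ hφ using fun k => T'.surj (T.pos k) (T.mem k)
  have hinj : Function.Injective φ := by
    intro u v h
    apply T.inj
    rw [← hφ u, ← hφ v, h]
  let π : Equiv.Perm (Fin n) := Equiv.ofBijective φ (Finite.injective_iff_bijective.1 hinj)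
  refine ⟨π, ?_⟩
  have : T'.pos = (T.perm π).pos := by
    funext k
    have h := hφ (π.symm k)
    have h' : φ (π.symm k) = k := π.apply_symm_apply k
    rw [h'] at h
    exact h
  cases T'
  cases hT : T.perm π
  rw [hT] at this
  simp only at this
  subst this
  rfl

end Anti

/-! ### Semi-invariant functions and their unique determining value -/

section Semi

variable {F : Type*} [Field F]

/-- The properties of the image of a polytabloid under a homomorphism. -/
structure Semi {α : Partition n} (T : Placement α) (β : ℕ → ℕ) (X : LFun F n) : Prop where
  anti : Anti T.col X
  content : HasContent X β
  raise : ∀ k, 0 < k → opE F k (k + 1) X = 0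
  garnir : ∀ x y, 0 < y → y < T.col x → ∀ g : Fin n → ℕ,
    X g = ∑ u ∈ Finset.univ.filter (fun u => T.col u = y), X (g ∘ Equiv.swap x u)

/-- The composition `β` arises from `α` by moving a box from row `a` down to row `b`. -/
structure Shift (α : Partition n) (β : ℕ → ℕ) (a b : ℕ) : Prop where
  a_pos : 0 < a
  lt : a < b
  eq : ∀ i, β i + (if a = i then 1 else 0) = α.parts i + (if b = i then 1 else 0)

variable {α : Partition n} {T : Placement α} {β : ℕ → ℕ} {a b : ℕ}

/-- Labelings where each symbol has its row as label, or a label below its column. -/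
def InPlace (T : Placement α) (g : Fin n → ℕ) : Prop :=
  ∀ c, g c = T.row c ∨ (T.row c < g c ∧ α.parts (g c) < T.col c)

lemma Shift.zero (hs : Shift α β a b) : β 0 = 0 := by
  have h := hs.eq 0
  have h1 := hs.a_pos
  have h2 := hs.lt
  rw [α.parts_zero, if_neg (by omega), if_neg (by omega)] at h
  omega

lemma exists_inPlace (h2 : (2 : F) ≠ 0) {X : LFun F n} (hA : Anti T.col X) (hC : HasContent X β)
    (h0 : β 0 = 0) {g : Fin n → ℕ} (hg : X g ≠ 0) :
    ∃ π : Equiv.Perm (Fin n), (∀ k, T.col (π k) = T.col k) ∧ InPlace T (g ∘ π) := by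
  classical
  have hne : ∀ π : Equiv.Perm (Fin n), (∀ k, T.col (π k) = T.col k) → X (g ∘ π) ≠ 0 := by
    intro π hπ h
    rw [hA π hπ] at h
    rcases mul_eq_zero.1 h with h | h
    · rcases Int.units_eq_one_or (Equiv.Perm.sign π) with e | e <;> simp [e] at h
    · exact hg h
  have hpos : ∀ k, g k ≠ 0 := by
    intro k hk
    have := hC g hg 0
    rw [h0, Finset.card_eq_zero] at this
    have hm : k ∈ Finset.univ.filter fun k => g k = 0 := by simp [hk]
    rw [this] at hm
    simp at hm
  obtain ⟨π, hπ, hmax⟩ := Finset.exists_max_image (colStab T)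
    (fun π => (Finset.univ.filter fun k => g (π k) = T.row k).card)
    ⟨1, (mem_colStab T).2 fun k => rfl⟩
  rw [mem_colStab] at hπ
  refine ⟨π, hπ, fun c => ?_⟩
  by_contra hc
  simp only [Function.comp_apply, not_or, not_and, not_lt] at hc
  obtain ⟨hc1, hc3⟩ := hc
  have hle : T.col c ≤ α.parts (g (π c)) := by
    by_cases h : T.row c < g (π c)
    · exact hc3 h
    · exact le_trans (T.col_le c) (α.antitone (Nat.pos_of_ne_zero (hpos _)) (by omega))
  obtain ⟨v, hv1, hv2⟩ := T.exists_cell (Nat.pos_of_ne_zero (hpos (π c))) (T.col_pos c) hle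
  have hvc : v ≠ c := by rintro rfl; exact hc1 hv1.symm
  have hgv : g (π v) ≠ T.row v := by
    intro h
    exact hne π hπ (hA.dup h2 hvc hv2 (by simp [h, hv1]))
  have hmem : π * Equiv.swap c v ∈ colStab T := by
    rw [mem_colStab]
    intro k
    rw [Equiv.Perm.mul_apply, hπ, swap_col hv2.symm]
  have := hmax _ hmem
  refine absurd this (not_le.2 (Finset.card_lt_card ?_))
  rw [Finset.ssubset_iff_of_subset]
  · exact ⟨v, Finset.mem_filter.2 ⟨Finset.mem_univ _, by simp [hv1]⟩, by simp [hgv]⟩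
  · intro k hk
    simp only [Finset.mem_filter, Finset.mem_univ, true_and] at hk ⊢
    have k1 : k ≠ c := by rintro rfl; exact hc1 hk
    have k2 : k ≠ v := by rintro rfl; exact hgv hk
    rw [Equiv.Perm.mul_apply, Equiv.swap_apply_of_ne_of_ne k1 k2, hk]

lemma card_le_eq (g : Fin n → ℕ) (k : ℕ) :
    (Finset.univ.filter fun c => g c ≤ k).card =
      ∑ i ∈ Finset.range (k + 1), (Finset.univ.filter fun c => g c = i).card := by
  classical
  rw [Finset.card_eq_sum_card_fiberwise (f := g) (t := Finset.range (k + 1))]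
  · refine Finset.sum_congr rfl fun i hi => ?_
    rw [Finset.mem_range] at hi
    congr 1
    ext c
    simp only [Finset.mem_filter, Finset.mem_univ, true_and]
    omega
  · intro c hc
    simp only [Finset.coe_filter, Finset.mem_univ, true_and, Set.mem_ofPred_eq] at hc
    simp only [Finset.coe_range, Set.mem_Iio]
    omega

lemma InPlace.row_le {g : Fin n → ℕ} (hg : InPlace T g) (c : Fin n) : T.row c ≤ g c := by
  rcases hg c with h | h <;> omega

lemma cross_card (hs : Shift α β a b) {g : Fin n → ℕ} (hg : InPlace T g)
    (hC : ∀ i, (Finset.univ.filter fun k => g k = i).card = β i) (k : ℕ) :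
    (Finset.univ.filter fun c => T.row c ≤ k ∧ k < g c).card = if a ≤ k ∧ k < b then 1 else 0 := by
  classical
  have h1 : (Finset.univ.filter fun c => g c ≤ k).card +
      (Finset.univ.filter fun c => T.row c ≤ k ∧ k < g c).card =
      (Finset.univ.filter fun c => T.row c ≤ k).card := by
    rw [← Finset.card_union_of_disjoint]
    · congr 1
      ext c
      simp only [Finset.mem_union, Finset.mem_filter, Finset.mem_univ, true_and]
      have := hg.row_le c
      omega
    · rw [Finset.disjoint_left]
      intro c
      simp only [Finset.mem_filter, Finset.mem_univ, true_and]
      omega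
  rw [card_le_eq, card_le_eq] at h1
  have h3 : ∀ i, (Finset.univ.filter fun c => T.row c = i).card = α.parts i := rowFiber_card T
  simp only [hC, h3] at h1
  have h4 : ∑ i ∈ Finset.range (k + 1), (β i + (if a = i then 1 else 0)) =
      ∑ i ∈ Finset.range (k + 1), (α.parts i + (if b = i then 1 else 0)) :=
    Finset.sum_congr rfl fun i _ => hs.eq i
  rw [Finset.sum_add_distrib, Finset.sum_add_distrib, Finset.sum_ite_eq, Finset.sum_ite_eq] at h4
  simp only [Finset.mem_range] at h4
  have := hs.lt
  split_ifs at h4 ⊢ <;> omega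

lemma cross_range (hs : Shift α β a b) {g : Fin n → ℕ} (hg : InPlace T g)
    (hC : ∀ i, (Finset.univ.filter fun k => g k = i).card = β i) {k : ℕ} {c : Fin n}
    (h1 : T.row c ≤ k) (h2 : k < g c) : a ≤ k ∧ k < b := by
  by_contra h
  have := cross_card hs hg hC k
  rw [if_neg h, Finset.card_eq_zero] at this
  have hm : c ∈ Finset.univ.filter fun c => T.row c ≤ k ∧ k < g c := by simp [h1, h2]
  rw [this] at hm
  simp at hm

lemma cross_exists (hs : Shift α β a b) {g : Fin n → ℕ} (hg : InPlace T g)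
    (hC : ∀ i, (Finset.univ.filter fun k => g k = i).card = β i) {k : ℕ}
    (h : a ≤ k ∧ k < b) : ∃ c, T.row c ≤ k ∧ k < g c := by
  have := cross_card hs hg hC k
  rw [if_pos h, Finset.card_eq_one] at this
  obtain ⟨c, hc⟩ := this
  have hm : c ∈ Finset.univ.filter fun c => T.row c ≤ k ∧ k < g c := by rw [hc]; simp
  exact ⟨c, by simpa using hm⟩

lemma cross_unique (hs : Shift α β a b) {g : Fin n → ℕ} (hg : InPlace T g)
    (hC : ∀ i, (Finset.univ.filter fun k => g k = i).card = β i) {c c' : Fin n}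
    (h : T.row c < g c) (h' : T.row c' < g c') (h1 : T.row c < g c') (h2 : T.row c' < g c) :
    c = c' := by
  have hk1 : T.row c ≤ max (T.row c) (T.row c') ∧ max (T.row c) (T.row c') < g c := by omega
  have hk2 : T.row c' ≤ max (T.row c) (T.row c') ∧ max (T.row c) (T.row c') < g c' := by omega
  have := cross_card hs hg hC (max (T.row c) (T.row c'))
  rw [if_pos (cross_range hs hg hC hk1.1 hk1.2), Finset.card_eq_one] at this
  obtain ⟨d, hd⟩ := this
  have e1 : c = d := by
    have hm : c ∈ ({d} : Finset (Fin n)) := by rw [← hd]; simpa using hk1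
    simpa using hm
  have e2 : c' = d := by
    have hm : c' ∈ ({d} : Finset (Fin n)) := by rw [← hd]; simpa using hk2
    simpa using hm
  rw [e1, e2]

/-- a longer row is higher up -/
lemma row_lt_of {x y : ℕ} (hx : 0 < x) (h : α.parts x < α.parts y) : y < x := by
  by_contra h'
  exact absurd (α.antitone hx (not_lt.1 h')) (not_le.2 h)

lemma exists_lex_max {ι : Type*} (S : Finset ι) (hS : S.Nonempty) (f1 f2 f3 : ι → ℕ) :
    ∃ g ∈ S, ∀ g' ∈ S, f1 g' ≤ f1 g ∧ (f1 g' = f1 g → f2 g' ≤ f2 g ∧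
      (f2 g' = f2 g → f3 g ≤ f3 g')) := by
  classical
  obtain ⟨g1, hg1, hm1⟩ := Finset.exists_max_image S f1 hS
  obtain ⟨g2, hg2, hm2⟩ := Finset.exists_max_image (S.filter fun g => f1 g = f1 g1) f2
    ⟨g1, by simp [hg1]⟩
  rw [Finset.mem_filter] at hg2
  obtain ⟨g3, hg3, hm3⟩ := Finset.exists_min_image
    (S.filter fun g => f1 g = f1 g1 ∧ f2 g = f2 g2) f3 ⟨g2, by simp [hg2.1, hg2.2]⟩
  rw [Finset.mem_filter] at hg3
  obtain ⟨hg3, h31, h32⟩ := hg3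
  refine ⟨g3, hg3, fun g' hg' => ⟨by rw [h31]; exact hm1 g' hg', fun h => ⟨?_, fun h' => ?_⟩⟩⟩
  · rw [h32]; exact hm2 g' (by simp [hg', h, h31])
  · exact hm3 g' (by simp [hg', h, h', h31, h32])

/-- Touched symbols. -/
def touched (T : Placement α) (g : Fin n → ℕ) : Finset (Fin n) :=
  Finset.univ.filter fun c => g c ≠ T.row c

lemma mem_touched {g : Fin n → ℕ} {c : Fin n} : c ∈ touched T g ↔ g c ≠ T.row c := by
  simp [touched]

/-- The extremal in-place labelings. -/
structure Nice (T : Placement α) (β : ℕ → ℕ) (g : Fin n → ℕ) : Prop where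
  inPlace : InPlace T g
  content : ∀ i, (Finset.univ.filter fun k => g k = i).card = β i
  col_eq : ∀ c, g c ≠ T.row c → T.col c = α.parts (T.row c)
  col_le : ∀ c, g c ≠ T.row c → T.col c ≤ α.parts (g c - 1)

lemma InPlace.lt {g : Fin n → ℕ} (hg : InPlace T g) {c : Fin n} (h : g c ≠ T.row c) :
    T.row c < g c := ((hg c).resolve_left h).1

lemma InPlace.parts_lt {g : Fin n → ℕ} (hg : InPlace T g) {c : Fin n} (h : g c ≠ T.row c) :
    α.parts (g c) < T.col c := ((hg c).resolve_left h).2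

lemma same_col (hs : Shift α β a b) {g : Fin n → ℕ} (hg : InPlace T g)
    (hC : ∀ i, (Finset.univ.filter fun k => g k = i).card = β i) {c c' : Fin n}
    (h : g c ≠ T.row c) (h' : g c' ≠ T.row c') (hcol : T.col c = T.col c') : c = c' := by
  have h1 := hg.lt h
  have h2 := hg.lt h'
  have h3 := hg.parts_lt h
  have h4 := hg.parts_lt h'
  have h5 := T.col_le c
  have h6 := T.col_le c'
  exact cross_unique hs hg hC h1 h2 (row_lt_of (α := α) (by omega) (by omega))
    (row_lt_of (α := α) (by omega) (by omega))

lemma Nice.sub (hs : Shift α β a b) {g g' : Fin n → ℕ} (hg : Nice T β g) (hg' : Nice T β g')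
    {c : Fin n} (h : g c ≠ T.row c) : g' c ≠ T.row c := by
  have hr := cross_range hs hg.inPlace hg.content le_rfl (hg.inPlace.lt h)
  obtain ⟨c0, h1, h2⟩ := cross_exists hs hg'.inPlace hg'.content hr
  have ht0 : g' c0 ≠ T.row c0 := by omega
  have e1 := hg'.col_eq c0 ht0
  have e2 := hg'.col_le c0 ht0
  have e3 := hg.col_eq c h
  have e4 := α.antitone (T.row_pos c0) h1
  have e5 := α.antitone (T.row_pos c) (show T.row c ≤ g' c0 - 1 by omega)
  have ecol : T.col c0 = T.col c := by omega
  by_cases hr0 : T.row c0 = T.row c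
  · rw [← T.eq_of hr0 ecol]; exact ht0
  · exfalso
    have hr1 := cross_range hs hg'.inPlace hg'.content le_rfl (hg'.inPlace.lt ht0)
    obtain ⟨c1, h3, h4⟩ := cross_exists (k := T.row c - 1) hs hg.inPlace hg.content
      ⟨by omega, by omega⟩
    have ht1 : g c1 ≠ T.row c1 := by omega
    have f1 := hg.col_eq c1 ht1
    have f2 := hg.col_le c1 ht1
    have f4 := α.antitone (T.row_pos c1) h3
    have hp : 0 < T.row c - 1 := by have := T.row_pos c0; omega
    have f5 := α.antitone hp (show T.row c - 1 ≤ g c1 - 1 by omega)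
    have f6 := α.antitone hp (show T.row c - 1 ≤ T.row c by omega)
    have f7 := α.antitone (T.row_pos c0) (show T.row c0 ≤ T.row c - 1 by omega)
    have := same_col hs hg.inPlace hg.content h ht1 (by omega)
    rw [← this] at h3
    have := T.row_pos c
    omega

lemma Nice.unique (hs : Shift α β a b) {g g' : Fin n → ℕ} (hg : Nice T β g) (hg' : Nice T β g') :
    g = g' := by
  funext c
  by_cases h : g c = T.row c
  · by_cases h' : g' c = T.row c
    · rw [h, h']
    · exact absurd h (hg'.sub hs hg h')
  · have h' := hg.sub hs hg' h
    have a1 := hg.inPlace.parts_lt h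
    have a2 := hg'.inPlace.parts_lt h'
    have b1 := hg.col_le c h
    have b2 := hg'.col_le c h'
    have c1 := hg.inPlace.lt h
    have c2 := hg'.inPlace.lt h'
    have := row_lt_of (α := α) (x := g c) (y := g' c - 1) (by omega) (by omega)
    have := row_lt_of (α := α) (x := g' c) (y := g c - 1) (by omega) (by omega)
    omega

lemma Nice.first (hs : Shift α β a b) {g : Fin n → ℕ} (hg : Nice T β g) :
    ∃ c, T.row c = a ∧ T.col c = α.parts a ∧ g c ≠ T.row c := by
  obtain ⟨c, h1, h2⟩ := cross_exists (k := a) hs hg.inPlace hg.content ⟨le_rfl, hs.lt⟩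
  have ht : g c ≠ T.row c := by omega
  have := cross_range hs hg.inPlace hg.content le_rfl (hg.inPlace.lt ht)
  have e : T.row c = a := by omega
  exact ⟨c, e, by rw [hg.col_eq c ht, e], ht⟩

end Semi

section SemiMain

variable {F : Type*} [Field F]

variable {α : Partition n} {T : Placement α} {β : ℕ → ℕ} {a b : ℕ}

lemma Semi.exists_max (h2 : (2 : F) ≠ 0) (hs : Shift α β a b) {X : LFun F n} (hX : Semi T β X)
    (hne : X ≠ 0) : ∃ g, InPlace T g ∧ X g ≠ 0 ∧ ∀ g', InPlace T g' → X g' ≠ 0 →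
      (touched T g').card ≤ (touched T g).card ∧
      ((touched T g').card = (touched T g).card →
        ∑ c ∈ touched T g', T.col c ≤ ∑ c ∈ touched T g, T.col c ∧
        (∑ c ∈ touched T g', T.col c = ∑ c ∈ touched T g, T.col c →
          ∑ c ∈ touched T g, T.row c ≤ ∑ c ∈ touched T g', T.row c)) := by
  classical
  have hfin : {g | InPlace T g ∧ X g ≠ 0}.Finite := by
    refine Set.Finite.subset (Set.Finite.pi' (t := fun c => Set.Iic (max (T.row c) b))
      fun c => Set.finite_Iic _) ?_
    rintro g ⟨hg, hg2⟩ c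
    have hC := hX.content g hg2
    by_cases h : g c = T.row c
    · exact le_trans h.le (le_max_left _ _)
    · have h1 := hg.lt h
      have := cross_range hs hg hC (k := g c - 1) (c := c) (by omega) (by omega)
      exact le_trans (by omega : g c ≤ b) (le_max_right _ _)
  have hnon : hfin.toFinset.Nonempty := by
    obtain ⟨g, hg⟩ : ∃ g, X g ≠ 0 := by
      by_contra h
      push Not at h
      exact hne (funext h)
    obtain ⟨π, hπ, hin⟩ := exists_inPlace h2 hX.anti hX.content hs.zero hg
    refine ⟨g ∘ π, hfin.mem_toFinset.2 ⟨hin, ?_⟩⟩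
    rw [hX.anti π hπ]
    refine mul_ne_zero ?_ hg
    rcases Int.units_eq_one_or (Equiv.Perm.sign π) with e | e <;> simp [e]
  obtain ⟨g, hg, hmax⟩ := exists_lex_max hfin.toFinset hnon (fun g => (touched T g).card)
    (fun g => ∑ c ∈ touched T g, T.col c) (fun g => ∑ c ∈ touched T g, T.row c)
  rw [hfin.mem_toFinset] at hg
  exact ⟨g, hg.1, hg.2, fun g' h1 h2 => hmax g' (hfin.mem_toFinset.2 ⟨h1, h2⟩)⟩

/-- Theorem U: a nonzero semi-invariant function is nonzero on a nice labeling. -/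
theorem Semi.exists_nice (h2 : (2 : F) ≠ 0) (hs : Shift α β a b) {X : LFun F n} (hX : Semi T β X)
    (hne : X ≠ 0) : ∃ g, Nice T β g ∧ X g ≠ 0 := by
  classical
  obtain ⟨g, hg, hXg, hmax⟩ := hX.exists_max h2 hs hne
  have hC := hX.content g hXg
  -- consequences of maximality
  have hcard : ∀ g', InPlace T g' → (touched T g).card < (touched T g').card → X g' = 0 := by
    intro g' h1 h3
    by_contra h4
    have := (hmax g' h1 h4).1
    omega
  have hcol : ∀ g' x c, InPlace T g' → c ∈ touched T g → x ∉ touched T g →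
      touched T g' = insert x ((touched T g).erase c) →
      (T.col c < T.col x ∨ (T.col c = T.col x ∧ T.row x < T.row c)) → X g' = 0 := by
    intro g' x c h1 hc hx he hlt
    by_contra h4
    obtain ⟨-, m1⟩ := hmax g' h1 h4
    have hx' : x ∉ (touched T g).erase c := fun h => hx (Finset.mem_of_mem_erase h)
    have k1 : (touched T g').card = (touched T g).card := by
      rw [he, Finset.card_insert_of_notMem hx', Finset.card_erase_add_one hc]
    have ks : ∀ w : Fin n → ℕ, ∑ d ∈ touched T g', w d + w c = w x + ∑ d ∈ touched T g, w d := by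
      intro w
      rw [he, Finset.sum_insert hx', add_assoc, Finset.sum_erase_add _ _ hc]
    obtain ⟨m2, m3⟩ := m1 k1
    have kc := ks T.col
    have kr := ks T.row
    rcases hlt with h | ⟨h, h'⟩
    · omega
    · have := m3 (by omega)
      omega
  refine ⟨g, ⟨hg, hC, ?_, ?_⟩, hXg⟩
  · -- the touched symbols are at the end of their rows
    intro c hc
    by_contra hcne
    have hlt : T.col c < α.parts (T.row c) := lt_of_le_of_ne (T.col_le c) hcne
    obtain ⟨x, hx1, hx2⟩ := T.exists_cell (T.row_pos c) (by omega) (le_refl (α.parts (T.row c)))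
    have hrc := hg.lt hc
    have hpc := hg.parts_lt hc
    -- the column of `x` is untouched
    have hB : ∀ z, T.col z = T.col x → g z = T.row z := by
      intro z hz
      by_contra hzt
      have q1 := hg.parts_lt hzt
      have q2 := hg.lt hzt
      have q3 := T.col_le z
      have : c = z := cross_unique hs hg hC hrc q2
        (row_lt_of (α := α) (by omega) (by omega)) (row_lt_of (α := α) (by omega) (by omega))
      subst this
      omega
    have hxc : x ≠ c := by rintro rfl; omega
    have hgx := hB x rfl
    have hin : c ∈ touched T g := mem_touched.2 hc
    have hxn : x ∉ touched T g := fun h => mem_touched.1 h hgx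
    have hgar := hX.garnir x (T.col c) (T.col_pos c) (by omega) g
    rw [Finset.sum_eq_zero] at hgar
    · exact hXg hgar
    · intro u hu
      simp only [Finset.mem_filter, Finset.mem_univ, true_and] at hu
      have hux : u ≠ x := by rintro rfl; omega
      by_cases huc : u = c
      · subst huc
        have v1 : (g ∘ Equiv.swap x u) x = g u := by simp
        have v2 : (g ∘ Equiv.swap x u) u = g x := by simp
        have v3 : ∀ k, k ≠ x → k ≠ u → (g ∘ Equiv.swap x u) k = g k := by
          intro k h h'
          rw [Function.comp_apply, Equiv.swap_apply_of_ne_of_ne h h']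
        refine hcol _ x u ?_ hin hxn ?_ (Or.inl (by omega))
        · intro k
          by_cases k1 : k = x
          · subst k1; right; rw [v1]; omega
          · by_cases k2 : k = u
            · subst k2; left; rw [v2]; omega
            · rw [v3 k k1 k2]; exact hg k
        · ext k
          rw [Finset.mem_insert, Finset.mem_erase, mem_touched, mem_touched]
          by_cases k1 : k = x
          · subst k1; rw [v1]; simp; omega
          · by_cases k2 : k = u
            · subst k2; rw [v2]; simp [k1]; omega
            · rw [v3 k k1 k2]; simp [k1, k2]
      · have hgu : g u = T.row u := by
          by_contra h
          exact huc (same_col hs hg hC h hc hu)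
        have hru : T.row u ≠ T.row c := fun h => huc (T.eq_of h hu)
        by_cases hyB : T.col x ≤ α.parts (T.row u)
        · obtain ⟨z, hz1, hz2⟩ := T.exists_cell (T.row_pos u) (T.col_pos x) hyB
          have hzx : z ≠ x := by rintro rfl; omega
          have hzu : z ≠ u := by rintro rfl; omega
          refine hX.anti.dup h2 hzx hz2 ?_
          rw [Function.comp_apply, Function.comp_apply, Equiv.swap_apply_left,
            Equiv.swap_apply_of_ne_of_ne hzx hzu, hB z hz2, hgu, hz1]
        · push Not at hyB
          have hsw := hX.anti.swap (u := c) (v := u) (Ne.symm huc) hu.symm (g ∘ Equiv.swap x u)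
          suffices h0 : X ((g ∘ Equiv.swap x u) ∘ Equiv.swap c u) = 0 by
            rw [h0] at hsw
            exact neg_eq_zero.1 hsw.symm
          set g' := (g ∘ Equiv.swap x u) ∘ Equiv.swap c u with hg'
          have v1 : g' x = g u := by
            simp [hg', Equiv.swap_apply_of_ne_of_ne hxc hux.symm]
          have v2 : g' c = g x := by simp [hg']
          have v3 : g' u = g c := by
            simp [hg', Equiv.swap_apply_of_ne_of_ne hxc.symm (Ne.symm huc)]
          have v4 : ∀ k, k ≠ x → k ≠ u → k ≠ c → g' k = g k := by
            intro k k1 k2 k3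
            rw [hg', Function.comp_apply, Function.comp_apply,
              Equiv.swap_apply_of_ne_of_ne k3 k2, Equiv.swap_apply_of_ne_of_ne k1 k2]
          have hru2 := T.col_le u
          have w1 : T.row u < g c := row_lt_of (α := α) (by omega) (by omega)
          have w2 : T.row x < T.row u := by
            rw [hx1]
            exact row_lt_of (α := α) (T.row_pos u) (by omega)
          have hun : u ∉ touched T g := fun h => mem_touched.1 h hgu
          refine hcard g' ?_ ?_
          · intro k
            by_cases k1 : k = x
            · subst k1; right; rw [v1, hgu]; omega
            · by_cases k2 : k = u
              · subst k2; right; rw [v3]; omega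
              · by_cases k3 : k = c
                · subst k3; left; rw [v2]; omega
                · rw [v4 k k1 k2 k3]; exact hg k
          · have he : touched T g' = insert u (insert x ((touched T g).erase c)) := by
              ext k
              rw [Finset.mem_insert, Finset.mem_insert, Finset.mem_erase, mem_touched, mem_touched]
              by_cases k1 : k = x
              · subst k1; rw [v1]; simp; omega
              · by_cases k2 : k = u
                · subst k2; rw [v3]; simp; omega
                · by_cases k3 : k = c
                  · subst k3; rw [v2]; simp [k1, k2]; omega
                  · rw [v4 k k1 k2 k3]; simp [k1, k2, k3]
            rw [he, Finset.card_insert_of_notMem, Finset.card_insert_of_notMem,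
              Finset.card_erase_add_one hin]
            · omega
            · simp [hxn]
            · simp [hux, hun]
  · -- the labels of touched symbols are just below their columns
    intro c hc
    by_contra hlt
    push Not at hlt
    have hrc := hg.lt hc
    have hpc := hg.parts_lt hc
    have hcc := T.col_le c
    obtain ⟨k, hk⟩ : ∃ k, g c = k + 1 := ⟨g c - 1, by omega⟩
    have hk' : g c - 1 = k := by omega
    rw [hk'] at hlt
    have hrk : T.row c < k := by
      have hne' : T.row c ≠ k := by rintro h; rw [← h] at hlt; omega
      omega
    have hin : c ∈ touched T g := mem_touched.2 hc
    have hz := congrFun (hX.raise k (by omega)) (Function.update g c k)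
    rw [opE_apply, Finset.sum_eq_single c] at hz
    · rw [if_pos (by simp), Function.update_idem, ← hk, Function.update_eq_self] at hz
      exact hXg hz
    · intro v _ hvc
      rw [Function.update_of_ne hvc]
      split_ifs with hgv
      swap
      · rfl
      have hrv : T.row v = k := by
        by_contra h
        have hv' : g v ≠ T.row v := by omega
        have := hg.lt hv'
        exact hvc (cross_unique hs hg hC (hg.lt hv') hrc (by omega) (by omega))
      have hvn : v ∉ touched T g := fun h => mem_touched.1 h (by omega)
      set g1 := Function.update (Function.update g c k) v (k + 1) with hg1
      have v1 : g1 v = k + 1 := by simp [hg1]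
      have v2 : g1 c = k := by simp [hg1, Function.update_of_ne (Ne.symm hvc)]
      have v3 : ∀ z, z ≠ v → z ≠ c → g1 z = g z := by
        intro z z1 z2
        rw [hg1, Function.update_of_ne z1, Function.update_of_ne z2]
      by_cases hy : T.col v ≤ α.parts (k + 1)
      · obtain ⟨z, hz1, hz2⟩ := T.exists_cell (Nat.succ_pos k) (T.col_pos v) hy
        have hzv : z ≠ v := by rintro rfl; omega
        have hzc : z ≠ c := by rintro rfl; omega
        by_cases hzt : g z = T.row z
        · exact hX.anti.dup h2 hzv hz2 (by rw [v1, v3 z hzv hzc, hzt, hz1])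
        · have hsw := hX.anti.swap hzv hz2 g1
          suffices h0 : X (g1 ∘ Equiv.swap z v) = 0 by
            rw [h0] at hsw
            exact neg_eq_zero.1 hsw.symm
          have w1 : (g1 ∘ Equiv.swap z v) z = k + 1 := by simp [v1]
          have w2 : (g1 ∘ Equiv.swap z v) v = g z := by simp [v3 z hzv hzc]
          have w3 : (g1 ∘ Equiv.swap z v) c = k := by
            simp [Equiv.swap_apply_of_ne_of_ne (Ne.symm hzc) (Ne.symm hvc), v2]
          have w4 : ∀ t, t ≠ z → t ≠ v → t ≠ c → (g1 ∘ Equiv.swap z v) t = g t := by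
            intro t t1 t2 t3
            rw [Function.comp_apply, Equiv.swap_apply_of_ne_of_ne t1 t2, v3 t t2 t3]
          have hpz := hg.parts_lt hzt
          have hlz := hg.lt hzt
          refine hcol _ v z ?_ (mem_touched.2 hzt) hvn ?_ (Or.inr ⟨hz2, by omega⟩)
          · intro t
            by_cases t1 : t = z
            · subst t1; left; rw [w1, hz1]
            · by_cases t2 : t = v
              · subst t2; right; rw [w2]; omega
              · by_cases t3 : t = c
                · subst t3; right; rw [w3]; omega
                · rw [w4 t t1 t2 t3]; exact hg t
          · ext t
            rw [Finset.mem_insert, Finset.mem_erase, mem_touched, mem_touched]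
            by_cases t1 : t = z
            · subst t1; rw [w1, hz1]; simp [hzv]
            · by_cases t2 : t = v
              · subst t2; rw [w2]; simp; omega
              · by_cases t3 : t = c
                · subst t3; rw [w3]; simp [t1, t2, hc]; omega
                · rw [w4 t t1 t2 t3]; simp [t1, t2]
      · push Not at hy
        refine hcard g1 ?_ ?_
        · intro t
          by_cases t2 : t = v
          · subst t2; right; rw [v1]; omega
          · by_cases t3 : t = c
            · subst t3; right; rw [v2]; omega
            · rw [v3 t t2 t3]; exact hg t
        · have he : touched T g1 = insert v (touched T g) := by
            ext t
            rw [Finset.mem_insert, mem_touched, mem_touched]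
            by_cases t2 : t = v
            · subst t2; rw [v1]; simp; omega
            · by_cases t3 : t = c
              · subst t3; rw [v2]; simp [t2, hc]; omega
              · rw [v3 t t2 t3]; simp [t2]
          rw [he, Finset.card_insert_of_notMem hvn]
          omega
    · intro h; exact absurd (Finset.mem_univ _) h

/-- Two semi-invariant functions of the same type are proportional. -/
theorem Semi.proportional (h2 : (2 : F) ≠ 0) (hs : Shift α β a b) {X Y : LFun F n}
    (hX : Semi T β X) (hY : Semi T β Y) (hne : X ≠ 0) : ∃ r : F, Y = r • X := by
  obtain ⟨g, hg, hXg⟩ := hX.exists_nice h2 hs hne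
  refine ⟨Y g / X g, ?_⟩
  by_contra hYX
  have hZ : Semi T β (Y - (Y g / X g) • X) := by
    refine ⟨?_, ?_, ?_, ?_⟩
    · intro π hπ h
      simp only [Pi.sub_apply, Pi.smul_apply, smul_eq_mul, hX.anti π hπ, hY.anti π hπ]
      ring
    · intro h hh
      by_cases hh1 : X h = 0
      · refine hY.content h fun hh2 => hh ?_
        simp [hh1, hh2]
      · exact hX.content h hh1
    · intro k hk
      rw [map_sub, map_smul, hX.raise k hk, hY.raise k hk, smul_zero, sub_zero]
    · intro x y hy hyx h
      simp only [Pi.sub_apply, Pi.smul_apply, smul_eq_mul]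
      rw [hX.garnir x y hy hyx h, hY.garnir x y hy hyx h, Finset.sum_sub_distrib, Finset.mul_sum]
  obtain ⟨g', hg', hne'⟩ := hZ.exists_nice h2 hs (sub_ne_zero.2 hYX)
  rw [← hg.unique hs hg'] at hne'
  apply hne'
  simp [div_mul_cancel₀ _ hXg]

lemma Semi.hasLabel (h2 : (2 : F) ≠ 0) (hs : Shift α β a b) {X : LFun F n} (hX : Semi T β X)
    {k y : ℕ} (hk : 0 < k) (hka : k < a) (hy : 0 < y) (hyk : y ≤ α.parts k) :
    HasLabel T.col X k y := by
  intro g hg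
  obtain ⟨π, hπ, hin⟩ := exists_inPlace h2 hX.anti hX.content hs.zero hg
  have hC := content_comp π (hX.content g hg)
  obtain ⟨v, hv1, hv2⟩ := T.exists_cell hk hy hyk
  refine ⟨π v, by rw [hπ, hv2], ?_⟩
  by_contra h
  have ht : (g ∘ π) v ≠ T.row v := by rw [hv1]; exact h
  have := cross_range hs hin hC le_rfl (hin.lt ht)
  omega

end SemiMain

/-! ### Equivariant maps on Specht modules and the lowering homomorphism -/

section Hom

variable {F : Type*} [Field F]

variable {α : Partition n}

lemma poly_mem (T : Placement α) : polytabloid F T ∈ Specht F α :=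
  Submodule.subset_span ⟨T, rfl⟩

lemma specht_killed (h2 : (2 : F) ≠ 0) {x y : ℕ} (hxy : x ≠ y) (hx : 0 < x)
    (h : α.parts y ≤ α.parts x) {v : PermMod F n α.parts} (hv : v ∈ Specht F α) :
    opE F x y (ext F α.parts v) = 0 := by
  induction hv using Submodule.span_induction with
  | mem v hv => obtain ⟨T, rfl⟩ := hv; exact poly_killed T h2 hxy hx h
  | zero => simp
  | add v w _ _ hv hw => rw [map_add, map_add, hv, hw, add_zero]
  | smul r v _ hv => rw [map_smul, map_smul, hv, smul_zero]

/-- Equivariance of a linear map from a Specht module to functions on labelings. -/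
def Equivar (Φ : ↥(Specht F α) →ₗ[F] LFun F n) : Prop :=
  ∀ (π : Equiv.Perm (Fin n)) (x y : ↥(Specht F α)),
    (x : PermMod F n α.parts) = permM F α.parts π (y : PermMod F n α.parts) →
    Φ x = opP F π (Φ y)

lemma Equivar.anti {Φ : ↥(Specht F α) →ₗ[F] LFun F n} (hΦ : Equivar Φ) (T : Placement α) :
    Anti T.col (Φ ⟨polytabloid F T, poly_mem T⟩) := by
  intro π hπ g
  have h := hΦ π (((Equiv.Perm.sign π : ℤ) : F) • ⟨polytabloid F T, poly_mem T⟩)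
    ⟨polytabloid F T, poly_mem T⟩ (by
      apply ext_inj
      rw [ext_permM]
      funext g
      rw [opP_apply, poly_anti T π hπ]
      simp)
  have h' := congrFun h g
  rw [opP_apply, map_smul] at h'
  rw [← h']; rfl

lemma Equivar.garnir (h2 : (2 : F) ≠ 0) {Φ : ↥(Specht F α) →ₗ[F] LFun F n} (hΦ : Equivar Φ)
    (T : Placement α) (x : Fin n) (y : ℕ) (hy : 0 < y) (hyx : y < T.col x) (g : Fin n → ℕ) :
    Φ ⟨polytabloid F T, poly_mem T⟩ g = ∑ u ∈ Finset.univ.filter (fun u => T.col u = y),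
      Φ ⟨polytabloid F T, poly_mem T⟩ (g ∘ Equiv.swap x u) := by
  have hu : ∀ u, Φ ⟨polytabloid F T, poly_mem T⟩ (g ∘ Equiv.swap x u) =
      Φ ⟨polytabloid F (T.perm (Equiv.swap x u)), poly_mem _⟩ g := by
    intro u
    rw [hΦ (Equiv.swap x u) ⟨polytabloid F (T.perm (Equiv.swap x u)), poly_mem _⟩
      ⟨polytabloid F T, poly_mem T⟩ (permM_poly T _).symm, opP_apply]
  simp only [hu]
  rw [← Finset.sum_apply, ← map_sum]
  refine congrFun (congrArg Φ ?_) g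
  apply Subtype.ext
  apply ext_inj
  rw [AddSubmonoidClass.coe_finsetSum, map_sum]
  funext g
  rw [Finset.sum_apply, poly_garnir T h2 x y hy hyx g]
  refine Finset.sum_congr rfl fun u _ => ?_
  have h := congrFun (ext_permM α.parts (Equiv.swap x u) (polytabloid F T)) g
  rw [permM_poly, opP_apply] at h
  exact h.symm

lemma Equivar.eq_zero {Φ : ↥(Specht F α) →ₗ[F] LFun F n} (hΦ : Equivar Φ)
    (T : Placement α) (h : Φ ⟨polytabloid F T, poly_mem T⟩ = 0) : Φ = 0 := by
  ext1 ⟨x, hx⟩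
  rw [LinearMap.zero_apply]
  induction hx using Submodule.span_induction with
  | mem v hv =>
    obtain ⟨T', rfl⟩ := hv
    obtain ⟨π, rfl⟩ := exists_perm T T'
    rw [hΦ π _ ⟨polytabloid F T, poly_mem T⟩ (permM_poly T π).symm, h, map_zero]
  | zero => exact map_zero Φ
  | add v w hv hw hv' hw' =>
    have := map_add Φ ⟨v, hv⟩ ⟨w, hw⟩
    rw [hv', hw', add_zero] at this
    exact this
  | smul r v hv hv' =>
    have := map_smul Φ r ⟨v, hv⟩
    rw [hv', smul_zero] at this
    exact this

lemma Equivar.exists_ne {Φ : ↥(Specht F α) →ₗ[F] LFun F n} (h : Φ ≠ 0) :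
    ∃ T : Placement α, Φ ⟨polytabloid F T, poly_mem T⟩ ≠ 0 := by
  by_contra hT
  push Not at hT
  apply h
  ext1 ⟨x, hx⟩
  rw [LinearMap.zero_apply]
  induction hx using Submodule.span_induction with
  | mem v hv => obtain ⟨T', rfl⟩ := hv; exact hT T'
  | zero => exact map_zero Φ
  | add v w hv hw hv' hw' =>
    have := map_add Φ ⟨v, hv⟩ ⟨w, hw⟩
    rw [hv', hw', add_zero] at this
    exact this
  | smul r v hv hv' =>
    have := map_smul Φ r ⟨v, hv⟩
    rw [hv', smul_zero] at this
    exact this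

lemma hom_equivar {c : ℕ → ℕ} {N : Submodule F (PermMod F n c)}
    {φ : ↥(Specht F α) →ₗ[F] PermMod F n c} (hφ : φ ∈ SpechtHom F α c N) :
    Equivar (ext F c ∘ₗ φ) := by
  intro π x y hxy
  rw [LinearMap.comp_apply, LinearMap.comp_apply, ← ext_permM, hφ.2 π x y hxy]

lemma ext_comp_ne {c : ℕ → ℕ} {φ : ↥(Specht F α) →ₗ[F] PermMod F n c} (h : φ ≠ 0) :
    ext F c ∘ₗ φ ≠ 0 := by
  intro h'
  apply h
  ext1 x
  apply ext_inj
  rw [LinearMap.zero_apply, map_zero]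
  exact LinearMap.congr_fun h' x

lemma hom_semi (h2 : (2 : F) ≠ 0) {ν : Partition n}
    {φ : ↥(Specht F α) →ₗ[F] PermMod F n ν.parts}
    (hφ : φ ∈ SpechtHom F α ν.parts (Specht F ν)) (T : Placement α) :
    Semi T ν.parts ((ext F ν.parts ∘ₗ φ) ⟨polytabloid F T, poly_mem T⟩) where
  anti := (hom_equivar hφ).anti T
  content := ext_content _
  raise k hk := specht_killed h2 (by omega) hk (ν.antitone hk (by omega)) (hφ.1 _)
  garnir := (hom_equivar hφ).garnir h2 T

/-- Uniqueness of homomorphisms up to scalars. -/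
lemma hom_unique (h2 : (2 : F) ≠ 0) {ν : Partition n} {a b : ℕ} (hs : Shift α ν.parts a b)
    {φ u : ↥(Specht F α) →ₗ[F] PermMod F n ν.parts}
    (hφ : φ ∈ SpechtHom F α ν.parts (Specht F ν)) (hφ0 : φ ≠ 0)
    (hu : u ∈ SpechtHom F α ν.parts (Specht F ν)) : ∃ r : F, u = r • φ := by
  obtain ⟨T, hT⟩ := Equivar.exists_ne (ext_comp_ne hφ0)
  obtain ⟨r, hr⟩ := (hom_semi h2 hφ T).proportional h2 hs (hom_semi h2 hu T) hT
  refine ⟨r, ?_⟩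
  have hmem : u - r • φ ∈ SpechtHom F α ν.parts (Specht F ν) := by
    have h := (SpechtHom F α ν.parts (Specht F ν)).add_mem hu
      ((SpechtHom F α ν.parts (Specht F ν)).smul_mem (-r) hφ)
    have e : u - r • φ = u + (-r) • φ := by
      refine LinearMap.ext fun x => ?_
      simp only [LinearMap.sub_apply, LinearMap.add_apply, LinearMap.smul_apply, neg_smul,
        sub_eq_add_neg]
    rw [e]
    exact h
  have h0 := (hom_equivar hmem).eq_zero T (by
    rw [LinearMap.comp_apply, LinearMap.sub_apply, LinearMap.smul_apply, map_sub, map_smul]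
    rw [LinearMap.comp_apply, LinearMap.comp_apply] at hr
    rw [hr, sub_self])
  by_contra h
  exact ext_comp_ne (sub_ne_zero.2 h) h0

/-- The rows at the bottom of the blocks of `β` between `a` and `b`. -/
lemma exists_blocks (β : Partition n) {a b : ℕ} (ha : 0 < a) (hab : a < b)
    (h1 : β.parts (a + 1) < β.parts a) (h2 : β.parts b < β.parts (b - 1)) :
    ∃ (d : ℕ → ℕ) (q : ℕ), StrictMono d ∧ d 0 = a ∧ d q + 1 = b ∧ d (q + 1) = b ∧
      (∀ i, i ≤ q → β.parts (d i + 1) < β.parts (d i)) ∧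
      (∀ i, i < q → ∀ j, d i < j → j ≤ d (i + 1) → β.parts j = β.parts (d i + 1)) := by
  classical
  set P : ℕ → Prop := fun k => a ≤ k ∧ (β.parts (k + 1) < β.parts k ∨ b ≤ k) with hP
  have hinf : (Set.ofPred P).Infinite := by
    refine Set.infinite_of_not_bddAbove ?_
    rintro ⟨m, hm⟩
    have : m + b + 1 ∈ Set.ofPred P := ⟨by omega, Or.inr (by omega)⟩
    have := hm this
    omega
  have hmono : StrictMono (Nat.nth P) := Nat.nth_strictMono hinf
  have hPa : P a := ⟨le_rfl, Or.inl h1⟩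
  have hPb1 : P (b - 1) := ⟨by omega, Or.inl (by rwa [Nat.sub_add_cancel (by omega)])⟩
  have hPb : P b := ⟨hab.le, Or.inr le_rfl⟩
  have hc0 : Nat.count P a = 0 := by
    rw [Nat.count_eq_card_filter_range, Finset.card_eq_zero, Finset.filter_eq_empty_iff]
    intro k hk hPk
    rw [Finset.mem_range] at hk
    have := hPk.1
    omega
  have hcb : Nat.count P b = Nat.count P (b - 1) + 1 := by
    have := Nat.count_succ P (b - 1)
    rw [if_pos hPb1] at this
    rw [← this, Nat.sub_add_cancel (by omega)]
  have hdq : Nat.nth P (Nat.count P (b - 1)) = b - 1 := Nat.nth_count hPb1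
  refine ⟨Nat.nth P, Nat.count P (b - 1), hmono, ?_, ?_, ?_, ?_, ?_⟩
  · rw [← hc0]; exact Nat.nth_count hPa
  · rw [hdq]; omega
  · rw [← hcb]; exact Nat.nth_count hPb
  · intro i hi
    have hPi : P (Nat.nth P i) := Nat.nth_mem_of_infinite hinf i
    have := hmono.monotone hi
    rcases hPi.2 with h | h
    · exact h
    · omega
  · intro i hi j hj hj'
    have hPi : P (Nat.nth P i) := Nat.nth_mem_of_infinite hinf i
    induction j, hj using Nat.le_induction with
    | base => rfl
    | succ j hj ih =>
      rw [← ih (by omega)]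
      have hnP : ¬ P j := by
        intro hPj
        have e := Nat.nth_count hPj
        have l1 : i < Nat.count P j := hmono.lt_iff_lt.1 (by rw [e]; omega)
        have l2 : Nat.count P j < i + 1 := hmono.lt_iff_lt.1 (by rw [e]; omega)
        omega
      have hge : a ≤ j := by have := hPi.1; omega
      have h3 : ¬ β.parts (j + 1) < β.parts j := fun h => hnP ⟨hge, Or.inl h⟩
      exact le_antisymm (β.antitone (by omega) (by omega)) (not_lt.1 h3)

/-- The lowering operator does not kill suitable functions. -/
lemma low_ne_zero {T : Placement α} {X : LFun F n} {g0 : Fin n → ℕ} {β : Partition n}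
    {a b q : ℕ} {d : ℕ → ℕ} {c : ℕ → F} (ha : 0 < a)
    (hd : StrictMono d) (hd0 : d 0 = a) (hdq : d q + 1 = b) (hdq1 : d (q + 1) = b)
    (hdesc : ∀ i, i ≤ q → β.parts (d i + 1) < β.parts (d i))
    (hαβ : ∀ k, k < b → α.parts k = β.parts k)
    (hX : ∀ k y, a ≤ k → k < b → 0 < y → y ≤ α.parts k → HasLabel T.col X k y)
    (hX0 : X g0 ≠ 0)
    (hg0 : ∀ z k, k < b → (g0 z = k ↔ T.row z = k))
    (hgb : ∀ z, g0 z = b → T.col z < α.parts (b - 1)) :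
    lowW n a d c q b X ≠ 0 := by
  have hlt : ∀ i, i ≤ q → a ≤ d i ∧ d i < b := by
    intro i hi
    have h1 := hd.monotone hi
    have h2 := hd.monotone (Nat.zero_le i)
    omega
  have hpos : ∀ i, i ≤ q → 0 < α.parts (d i) := by
    intro i hi
    rw [hαβ _ (hlt i hi).2]
    have := hdesc i hi
    omega
  have hw : ∀ i, ∃ w, i ≤ q → T.row w = d i ∧ T.col w = α.parts (d i) := by
    intro i
    have key : ∀ i, i ≤ q → ∃ w, T.row w = d i ∧ T.col w = α.parts (d i) := by
      intro i hi
      exact T.exists_cell (by have := hlt i hi; omega) (hpos i hi) le_rfl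
    by_cases hi : i ≤ q
    · obtain ⟨w, hw⟩ := key i hi
      exact ⟨w, fun _ => hw⟩
    · obtain ⟨w, hw⟩ := key 0 (Nat.zero_le _)
      exact ⟨w, fun h => absurd h hi⟩
  choose w hw using hw
  have hdec : ∀ i j, i < j → j ≤ q → α.parts (d j) < α.parts (d i) := by
    intro i j hij hj
    rw [hαβ _ (hlt i (by omega)).2, hαβ _ (hlt j hj).2]
    refine lt_of_le_of_lt ?_ (hdesc i (by omega))
    exact β.antitone (Nat.succ_pos _) (hd hij)
  have key := lowW_test (c := c) (col := T.col) (X := X) (g0 := g0) (w := w) (q := q) hd hd0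
    (by
      intro i hi
      rw [(hw i hi).2]
      exact hX _ _ (hlt i hi).1 (hlt i hi).2 (hpos i hi) le_rfl)
    (by
      intro i j hi hj h
      rw [(hw i hi).2, (hw j hj).2] at h
      rcases lt_trichotomy i j with h' | h' | h'
      · have := hdec i j h' hj; omega
      · exact h'
      · have := hdec j i h' hi; omega)
    (by
      intro i hi z hz
      rw [hg0 z (d i) (hlt i hi).2]
      constructor
      · intro h
        exact T.eq_of (h.trans (hw i hi).1.symm) hz
      · rintro rfl
        exact (hw i hi).1)
    (by
      intro i hi z hz h
      rw [(hw i hi).2] at hz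
      rcases Nat.lt_or_ge i q with h' | h'
      · rw [hg0 z (d (i + 1)) (hlt (i + 1) h').2] at h
        have h1 := T.col_le z
        rw [h] at h1
        have := hdec i (i + 1) (Nat.lt_succ_self i) h'
        omega
      · have : i = q := by omega
        subst this
        rw [hdq1] at h
        have h1 := hgb z h
        have h3 : b - 1 = d i := by omega
        rw [h3] at h1
        omega) q le_rfl
  intro h0
  rw [hdq1, h0] at key
  exact hX0 key.symm

lemma Shift.rem {β γ : Partition n} {a b : ℕ} (hs : Shift β γ.parts a b) :
    β.parts (a + 1) < β.parts a ∧ β.parts b < β.parts (b - 1) := by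
  have h0 := hs.lt
  have ha := hs.a_pos
  have e1 := hs.eq a
  have e2 := hs.eq b
  have e3 := hs.eq (a + 1)
  have e4 := hs.eq (b - 1)
  have g1 := γ.antitone ha (Nat.le_succ a)
  have g2 := γ.antitone (i := b - 1) (j := b) (by omega) (by omega)
  have g3 := β.antitone ha (Nat.le_succ a)
  have g4 := β.antitone (i := b - 1) (j := b) (by omega) (by omega)
  simp only [Nat.succ_eq_add_one] at g1 g3
  rw [if_pos rfl, if_neg (by omega)] at e1
  rw [if_neg (by omega), if_pos rfl] at e2
  rw [if_neg (by omega)] at e3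
  rw [if_neg (show b ≠ b - 1 by omega)] at e4
  constructor
  · split_ifs at e3 <;> omega
  · split_ifs at e4 with h
    · have hb : b = a + 1 := by omega
      subst hb
      simp only [Nat.add_sub_cancel] at *
      omega
    · omega

/-- The composite of nonzero homomorphisms is nonzero. -/
theorem comp_ne_zero (h2 : (2 : F) ≠ 0) {β γ : Partition n} {a b c : ℕ}
    (hs : Shift β γ.parts a b) (hs' : Shift α β.parts b c)
    (hres : ((β.parts a : F) - a) - ((β.parts b : F) - b) - 1 = 0)
    {f : ↥(Specht F β) →ₗ[F] PermMod F n γ.parts}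
    (hf : f ∈ SpechtHom F β γ.parts (Specht F γ)) (hf0 : f ≠ 0)
    {φ : ↥(Specht F α) →ₗ[F] PermMod F n β.parts}
    (hφ : φ ∈ SpechtHom F α β.parts (Specht F β)) (hφ0 : φ ≠ 0) :
    ∃ x, f ⟨φ x, hφ.1 x⟩ ≠ 0 := by
  have hab := hs.lt
  have ha := hs.a_pos
  have hαβ : ∀ k, k < b → α.parts k = β.parts k := by
    intro k hk
    have := hs'.eq k
    have h' := hs'.lt
    rw [if_neg (by omega), if_neg (by omega)] at this
    omega
  obtain ⟨hr1, hr2⟩ := hs.rem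
  obtain ⟨d, q, hd, hd0, hdq, hdq1, hdesc, hblock⟩ := exists_blocks β ha hab hr1 hr2
  set cc : ℕ → F := lowC F β.parts a d with hcc
  -- the lowering map
  set Φ : ↥(Specht F β) →ₗ[F] LFun F n :=
    (lowW n a d cc q b) ∘ₗ (ext F β.parts) ∘ₗ (Specht F β).subtype with hΦ
  have hΦa : ∀ x, Φ x = lowW n a d cc q b (ext F β.parts (x : PermMod F n β.parts)) :=
    fun x => rfl
  have hΦe : Equivar Φ := by
    intro π x y hxy
    rw [hΦa, hΦa, hxy, ext_permM, lowW_opP]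
  have hΦsemi : ∀ S : Placement β, Semi S γ.parts (Φ ⟨polytabloid F S, poly_mem S⟩) := by
    intro S
    refine ⟨hΦe.anti S, ?_, ?_, hΦe.garnir h2 S⟩
    · intro g hg i
      have h1 := lowW_content a d cc β.parts _ (ext_content (polytabloid F S)) q b g hg i
      have h3 := hs.eq i
      omega
    · intro t ht
      rw [hΦa, ← hdq]
      refine lowW_killed hd hd0 β.parts hcc _ q ?_ (opE_diag (ext_content _)) ?_ ?_ ha ?_ t ht
      · intro t ht
        exact specht_killed h2 (by omega) ht (β.antitone ht (by omega)) (poly_mem S)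
      · intro i hi
        exact (hblock i hi (d (i + 1)) (hd (Nat.lt_succ_self i)) le_rfl).symm
      · intro i hi j j' h1 h3 h4
        refine specht_killed h2 (by omega) (by omega) ?_ (poly_mem S)
        rw [hblock i hi j h1 (by omega), hblock i hi j' (by omega) h4]
      · rw [hcc, lowC, hdq]; exact hres
  -- it is nonzero on polytabloids
  have hΦne : ∀ S : Placement β, Φ ⟨polytabloid F S, poly_mem S⟩ ≠ 0 := by
    intro S
    rw [hΦa]
    refine low_ne_zero (T := S) (g0 := S.row) (β := β) ha hd hd0 hdq hdq1 hdesc (fun _ _ => rfl)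
      ?_ ?_ ?_ ?_
    · intro k y h1 h3 h4 h5 g hg
      obtain ⟨σ, hσ, rfl⟩ := poly_supp S hg
      obtain ⟨v, hv1, hv2⟩ := S.exists_cell (by omega) h4 h5
      refine ⟨σ.symm v, ?_, by simpa using hv1⟩
      rw [← hσ (σ.symm v)]
      simpa using hv2
    · rw [poly_row]; exact one_ne_zero
    · intro z k _; rfl
    · intro z hz
      have := S.col_le z
      rw [hz] at this
      omega
  -- `f` is a multiple of the lowering map
  obtain ⟨S, hS⟩ := Equivar.exists_ne (ext_comp_ne hf0)
  obtain ⟨r, hr⟩ := (hΦsemi S).proportional h2 hs (hom_semi h2 hf S) (hΦne S)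
  have hr0 : r ≠ 0 := by
    rintro rfl
    rw [zero_smul] at hr
    exact hS hr
  have hfe : ext F γ.parts ∘ₗ f = r • Φ := by
    have hE : Equivar (ext F γ.parts ∘ₗ f - r • Φ) := by
      intro π x y hxy
      rw [LinearMap.sub_apply, LinearMap.sub_apply, LinearMap.smul_apply, LinearMap.smul_apply,
        hom_equivar hf π x y hxy, hΦe π x y hxy, map_sub, map_smul]
    have := hE.eq_zero S (by
      rw [LinearMap.sub_apply, LinearMap.smul_apply, hr, sub_self])
    exact sub_eq_zero.1 this
  -- evaluate on the image of `φ`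
  obtain ⟨T, hT⟩ := Equivar.exists_ne (ext_comp_ne hφ0)
  have hXs := hom_semi h2 hφ T
  obtain ⟨g0, hnice, hXg⟩ := hXs.exists_nice h2 hs' hT
  refine ⟨⟨polytabloid F T, poly_mem T⟩, fun h0 => ?_⟩
  have h1 := LinearMap.congr_fun hfe ⟨φ ⟨polytabloid F T, poly_mem T⟩, hφ.1 _⟩
  rw [LinearMap.comp_apply, h0, map_zero, LinearMap.smul_apply, hΦa] at h1
  refine smul_ne_zero hr0 ?_ h1.symm
  have htouch : ∀ z, g0 z ≠ T.row z → b ≤ T.row z ∧ T.row z < g0 z := by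
    intro z hz
    have h3 := hnice.inPlace.lt hz
    exact ⟨(cross_range hs' hnice.inPlace hnice.content le_rfl h3).1, h3⟩
  refine low_ne_zero (T := T) (g0 := g0) (β := β) ha hd hd0 hdq hdq1 hdesc hαβ ?_ hXg ?_ ?_
  · intro k y h3 h4 h5 h6
    exact hXs.hasLabel h2 hs' (by omega) h4 h5 h6
  · intro z k hk
    by_cases hz : g0 z = T.row z
    · rw [hz]
    · have := htouch z hz
      omega
  · intro z hz
    have hz' : g0 z = T.row z := by
      by_contra h
      have := htouch z h
      omega
    have hrow : T.row z = b := by omega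
    have hc1 := T.col_le z
    rw [hrow] at hc1
    have hc2 := α.antitone (i := b - 1) (j := b) (by omega) (by omega)
    by_contra hlt
    obtain ⟨v, hv1, hv2, hv3⟩ := hnice.first hs'
    have : z = v := T.eq_of (by omega) (by omega)
    subst this
    exact hv3 hz'

end Hom

/-! ### Chains of maps and the main theorem -/

section Chain

variable {F : Type*} [Field F] {M : ℕ → Type*} [∀ i, AddCommGroup (M i)] [∀ i, Module F (M i)]

/-- The composites of a chain of linear maps. -/
noncomputable def chainG (fs : ∀ i, M (i + 1) →ₗ[F] M i) : ∀ i j, M i →ₗ[F] M j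
  | 0, j => if h : 0 = j then h ▸ LinearMap.id else 0
  | i + 1, j => if h : i + 1 = j then h ▸ LinearMap.id else (chainG fs i j) ∘ₗ fs i

variable (fs : ∀ i, M (i + 1) →ₗ[F] M i)

lemma chainG_self (i : ℕ) : chainG fs i i = LinearMap.id := by
  cases i <;> simp [chainG]

lemma chainG_succ {i j : ℕ} (h : j ≤ i) : chainG fs (i + 1) j = (chainG fs i j) ∘ₗ fs i := by
  rw [chainG, dif_neg (by omega)]

lemma chainG_step (i : ℕ) : chainG fs (i + 1) i = fs i := by
  rw [chainG_succ fs le_rfl, chainG_self, LinearMap.id_comp]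

lemma chainG_comp {i k j : ℕ} (hjk : j ≤ k) (hki : k ≤ i) (x : M i) :
    chainG fs i j x = chainG fs k j (chainG fs i k x) := by
  induction i, hki using Nat.le_induction with
  | base => rw [chainG_self]; rfl
  | succ i hki ih =>
    rw [chainG_succ fs (hjk.trans hki), chainG_succ fs hki, LinearMap.comp_apply,
      LinearMap.comp_apply, ih]

end Chain

section Removal

lemma removes_eq {lam : Partition (n + 1)} {mu : Partition n} {R : ℕ} (h : Removes lam mu R)
    (t : ℕ) : mu.parts t + (if R = t then 1 else 0) = lam.parts t := by
  split_ifs with ht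
  · subst ht; exact h.1.symm
  · rw [h.2 t (Ne.symm ht), add_zero]

lemma removes_pos {lam : Partition (n + 1)} {mu : Partition n} {R : ℕ} (h : Removes lam mu R) :
    0 < R := by
  rcases Nat.eq_zero_or_pos R with h0 | h0
  · subst h0
    have := h.1
    rw [lam.parts_zero] at this
    omega
  · exact h0

lemma removes_lt {lam : Partition (n + 1)} {mu nu : Partition n} {R R' : ℕ}
    (h : Removes lam mu R) (h' : Removes lam nu R') (hlt : DomLT mu nu) : R < R' := by
  rcases lt_trichotomy R R' with h1 | h1 | h1
  · exact h1
  · exfalso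
    subst h1
    apply hlt.2
    funext t
    have e1 := removes_eq h t
    have e2 := removes_eq h' t
    omega
  · exfalso
    have hd := hlt.1 R'
    have hp := removes_pos h'
    have s1 : ∑ t ∈ Finset.Icc 1 R', (mu.parts t + (if R = t then 1 else 0)) =
        ∑ t ∈ Finset.Icc 1 R', (nu.parts t + (if R' = t then 1 else 0)) :=
      Finset.sum_congr rfl fun t _ => (removes_eq h t).trans (removes_eq h' t).symm
    rw [Finset.sum_add_distrib, Finset.sum_add_distrib, Finset.sum_ite_eq, Finset.sum_ite_eq,
      if_neg (by rw [Finset.mem_Icc]; omega), if_pos (by rw [Finset.mem_Icc]; omega)] at s1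
    omega

lemma removes_shift {lam : Partition (n + 1)} {mu nu : Partition n} {R R' : ℕ}
    (h : Removes lam mu R) (h' : Removes lam nu R') (hlt : DomLT mu nu) :
    Shift nu mu.parts R R' where
  a_pos := removes_pos h
  lt := removes_lt h h' hlt
  eq t := (removes_eq h t).trans (removes_eq h' t).symm

lemma res_eq (F : Type*) [Field F] (p : ℕ) [CharP F p] {x y : ℤ} {r : ZMod p}
    (hx : (x : ZMod p) = r) (hy : (y : ZMod p) = r) : (x : F) = (y : F) := by
  have h := (ZMod.intCast_eq_intCast_iff_dvd_sub x y p).1 (hx.trans hy.symm)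
  have h' := (CharP.intCast_eq_zero_iff F p (y - x)).2 h
  rw [Int.cast_sub] at h'
  exact (sub_eq_zero.1 h').symm

end Removal

/-- Let `F` be a field of characteristic `p ≠ 2`, `λ` a partition of
`n+1`, and `r` the `p`-residue of a removable node of `[λ]`.  Let
`λ_1 ◁ λ_2 ◁ … ◁ λ_m` (here 0-indexed: `μ 0, …, μ (m-1)`) be all the partitions of `n`
obtained by removing a node of `p`-residue `r` from `[λ]`, and for each `i` let
`f_i : S^{λ_{i+1}} → S^{λ_i}` be a non-zero `FΣ_n`-homomorphism.  Then for all
`j < i < m`, the composite `f_{i} ∘ … ∘ f_{j+1}` spans `Hom_{FΣ_n}(S^{λ_i}, S^{λ_j})`;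
in particular all these composites are non-zero.  (The composites are packaged as a
system `g i j` of maps satisfying `g i i = id`, `g (i+1) i = f i`, and
`g i j = g k j ∘ g i k`.) -/
theorem stmt7 (F : Type*) [Field F] (p : ℕ) [CharP F p] (hp : p ≠ 2)
    {n : ℕ} (lam : Partition (n + 1)) (r : ZMod p) (m : ℕ) (hm : 0 < m)
    (μ : ℕ → Partition n)
    (hall : ∀ i, i < m → ∃ row, Removes lam (μ i) row ∧
      (((lam.parts row : ℤ) - (row : ℤ) : ℤ) : ZMod p) = r)
    (hcomplete : ∀ (ν : Partition n) (row : ℕ), Removes lam ν row →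
      (((lam.parts row : ℤ) - (row : ℤ) : ℤ) : ZMod p) = r → ∃ i, i < m ∧ ν.parts = (μ i).parts)
    (hchain : ∀ i j, i < j → j < m → DomLT (μ i) (μ j))
    (f : (i : ℕ) → ↥(Specht F (μ (i + 1))) →ₗ[F] PermMod F n (μ i).parts)
    (hf : ∀ i, i + 1 < m →
      f i ∈ SpechtHom F (μ (i + 1)) (μ i).parts (Specht F (μ i)) ∧ f i ≠ 0) :
    ∃ (g : (i j : ℕ) → ↥(Specht F (μ i)) →ₗ[F] PermMod F n (μ j).parts)
      (hmem : ∀ i j, i < m → ∀ x, g i j x ∈ Specht F (μ j)),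
      (∀ i, i < m → ∀ x, g i i x = (x : PermMod F n (μ i).parts)) ∧
      (∀ i, i + 1 < m → g (i + 1) i = f i) ∧
      (∀ i k j (_ : j ≤ k) (hki : k ≤ i) (him : i < m) (x : ↥(Specht F (μ i))),
        g i j x = g k j ⟨g i k x, hmem i k him x⟩) ∧
      (∀ j i, j < i → i < m → g i j ≠ 0 ∧
        ∀ u ∈ SpechtHom F (μ i) (μ j).parts (Specht F (μ j)), ∃ c : F, u = c • g i j) := by
  classical
  have h2 : (2 : F) ≠ 0 := by
    apply Ring.two_ne_zero
    rw [ringChar.eq F p]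
    exact hp
  have hex : ∀ i, ∃ row, i < m → Removes lam (μ i) row ∧
      (((lam.parts row : ℤ) - (row : ℤ) : ℤ) : ZMod p) = r := by
    intro i
    by_cases hi : i < m
    · obtain ⟨row, h⟩ := hall i hi
      exact ⟨row, fun _ => h⟩
    · exact ⟨0, fun h => absurd h hi⟩
  choose R hR using hex
  have hshift : ∀ i j, i < j → j < m → Shift (μ j) (μ i).parts (R i) (R j) := by
    intro i j hij hj
    exact removes_shift (hR i (hij.trans hj)).1 (hR j hj).1 (hchain i j hij hj)
  -- the chain of maps
  let fs : ∀ i, ↥(Specht F (μ (i + 1))) →ₗ[F] ↥(Specht F (μ i)) := fun i =>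
    if h : i + 1 < m then (f i).codRestrict (Specht F (μ i)) ((hf i h).1.1) else 0
  have hfs : ∀ i, i + 1 < m → ∀ x, ((fs i x : ↥(Specht F (μ i))) : PermMod F n (μ i).parts) =
      f i x := by
    intro i hi x
    simp only [fs, dif_pos hi]
    rfl
  let G : ∀ i j, ↥(Specht F (μ i)) →ₗ[F] ↥(Specht F (μ j)) :=
    chainG (M := fun i => ↥(Specht F (μ i))) fs
  let g : ∀ i j, ↥(Specht F (μ i)) →ₗ[F] PermMod F n (μ j).parts :=
    fun i j => (Specht F (μ j)).subtype ∘ₗ G i j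
  have hga : ∀ i j x, g i j x = ((G i j x : ↥(Specht F (μ j))) : PermMod F n (μ j).parts) :=
    fun i j x => rfl
  have hgmem : ∀ i j x, g i j x ∈ Specht F (μ j) := fun i j x => (G i j x).2
  have hself : ∀ i x, G i i x = x := by
    intro i x
    exact LinearMap.congr_fun (chainG_self (M := fun i => ↥(Specht F (μ i))) fs i) x
  have hsucc : ∀ i j, j ≤ i → ∀ x, G (i + 1) j x = G i j (fs i x) := by
    intro i j hj x
    exact LinearMap.congr_fun (chainG_succ (M := fun i => ↥(Specht F (μ i))) fs hj) x
  have hstep : ∀ i, i + 1 < m → g (i + 1) i = f i := by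
    intro i hi
    refine LinearMap.ext fun x => ?_
    rw [hga, hsucc i i le_rfl, hself, hfs i hi]
  have hcomp : ∀ i k j, j ≤ k → k ≤ i → ∀ x, g i j x = g k j ⟨g i k x, hgmem i k x⟩ := by
    intro i k j hjk hki x
    exact congrArg Subtype.val
      (chainG_comp (M := fun i => ↥(Specht F (μ i))) fs hjk hki x)
  have hhom : ∀ i j, j ≤ i → i < m →
      g i j ∈ SpechtHom F (μ i) (μ j).parts (Specht F (μ j)) := by
    intro i j hji
    induction i, hji using Nat.le_induction with
    | base =>
      intro _
      refine ⟨hgmem j j, fun π x y hxy => ?_⟩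
      rw [hga, hga, hself, hself, hxy]
    | succ i hji ih =>
      intro hi
      refine ⟨hgmem (i + 1) j, fun π x y hxy => ?_⟩
      rw [hga, hga, hsucc i j hji, hsucc i j hji]
      refine (ih (by omega)).2 π (fs i x) (fs i y) ?_
      rw [hfs i hi, hfs i hi]
      exact (hf i hi).1.2 π x y hxy
  have hne : ∀ i, i < m → ∀ t j, j + t + 1 = i → g i j ≠ 0 := by
    intro i hi t
    induction t with
    | zero =>
      intro j hj
      subst hj
      rw [show g (j + 0 + 1) j = f j from hstep j hi]
      exact (hf j hi).2
    | succ t ih =>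
      intro j hj h0
      have hφ0 := ih (j + 1) (by omega)
      have hφ := hhom i (j + 1) (by omega) hi
      have hj1 : j + 1 < m := by omega
      have hs := hshift j (j + 1) (by omega) hj1
      have hs' := hshift (j + 1) i (by omega) hi
      have hres := res_eq F p (hR j (by omega)).2 (hR (j + 1) hj1).2
      have e1 := removes_eq (hR (j + 1) hj1).1 (R j)
      have e2 := removes_eq (hR (j + 1) hj1).1 (R (j + 1))
      have hlt := hs.lt
      rw [if_neg (by omega)] at e1
      rw [if_pos rfl] at e2
      obtain ⟨x, hx⟩ := comp_ne_zero h2 hs hs' (by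
        rw [← e1, ← e2] at hres
        push_cast at hres
        linear_combination hres) (hf j hj1).1 (hf j hj1).2 hφ hφ0
      apply hx
      have h3 := hcomp i (j + 1) j (by omega) (by omega) x
      rw [h0, hstep j hj1] at h3
      exact h3.symm
  refine ⟨g, fun i j _ x => hgmem i j x, ?_, hstep, ?_, ?_⟩
  · intro i _ x
    rw [hga, hself]
  · intro i k j hjk hki _ x
    exact hcomp i k j hjk hki x
  · intro j i hji hi
    have h0 := hne i hi (i - j - 1) j (by omega)
    exact ⟨h0, fun u hu => hom_unique h2 (hshift j i hji hi) (hhom i j hji.le hi) h0 hu⟩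

end CarterPayne
end

section
/- Let F be a field of characteristic p > 2, let α be a partition of n and β a one-box-shift of α with β_a = α_a − 1 and β_b = α_b + 1 for a < b, and let T be a semistandard α-tableau of type β with associated bijection T̂ and set {T}. Let a ≤ i ≤ b−1 be such that i = a or α_{T̂^{−1}(i)} ≠ α_i (these hypotheses force T̂(i) ≠ i). Then θ̂_T ∘ ψ_i = (h_i − h_{i+1}) θ̂_W if T̂(i) = i+1, and θ̂_T ∘ ψ_i = (−1)^{|{T∨i} \ {T}|} θ̂_W otherwise, where W is the tableau obtained from T∨i by changing the unique symbol i+1 in row i to an i. -/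
namespace CarterPayne

open Finset

variable {n : ℕ}

-- finiteness of the set of tabloids
lemma tabloid_finite (n : ℕ) (c : ℕ → ℕ) :
    {g : Fin n → ℕ | ∀ i, (Finset.univ.filter fun k => g k = i).card = c i}.Finite := by
  classical
  rcases Set.eq_empty_or_nonempty
      {g : Fin n → ℕ | ∀ i, (Finset.univ.filter fun k => g k = i).card = c i} with h | ⟨g₀, hg₀⟩
  · rw [h]; exact Set.finite_empty
  · apply Set.Finite.subset (Set.Finite.pi fun _ : Fin n => Set.finite_range g₀)
    intro g hg
    simp only [Set.mem_pi, Set.mem_univ, forall_true_left]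
    intro k
    have h1 : (Finset.univ.filter fun k' => g k' = g k).card = c (g k) := hg (g k)
    have h2 : (Finset.univ.filter fun k' => g₀ k' = g k).card = c (g k) := hg₀ (g k)
    have hp : 0 < c (g k) := by
      rw [← h1]
      exact Finset.card_pos.mpr ⟨k, by simp⟩
    rw [← h2] at hp
    obtain ⟨k', hk'⟩ := Finset.card_pos.mp hp
    simp only [Finset.mem_filter] at hk'
    exact ⟨k', hk'.2⟩

noncomputable instance (c : ℕ → ℕ) : Fintype (Tabloid n c) :=
  (tabloid_finite n c).fintype

lemma cells_finite (μ : Partition n) : μ.cells.Finite := by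
  apply Set.Finite.subset (μ.finite_support.prod (Set.finite_Icc 1 (μ.parts 1)))
  rintro ⟨i, j⟩ ⟨h1, h2, h3⟩
  refine Set.mem_prod.mpr ⟨?_, ?_⟩
  · simp only [Function.mem_support]
    intro h0
    rw [h0] at h3; omega
  · exact ⟨h2, le_trans h3 (μ.antitone Nat.one_pos h1)⟩

/-- The finset of cells of the Young diagram of `μ`. -/
noncomputable def cellFinset (μ : Partition n) : Finset (ℕ × ℕ) := (cells_finite μ).toFinset

/-- An `α`-tableau (a filling of the diagram of `α` by natural numbers) has type `c`
if the entry `j` appears exactly `c j` times. -/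
def IsTypeOf (α : Partition n) (c : ℕ → ℕ) (T : ℕ × ℕ → ℕ) : Prop :=
  ∀ j, ((cellFinset α).filter fun cc => T cc = j).card = c j

/-- A filling of the diagram of `α` is semistandard if its entries are nondecreasing
along rows and strictly increasing down columns. -/
def IsSemistandard (α : Partition n) (T : ℕ × ℕ → ℕ) : Prop :=
  (∀ i j j', (i, j) ∈ α.cells → (i, j') ∈ α.cells → j ≤ j' → T (i, j) ≤ T (i, j')) ∧
  (∀ i i' j, (i, j) ∈ α.cells → (i', j) ∈ α.cells → i < i' → T (i, j) < T (i', j))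

/-- Number of entries equal to `j` in row `i` of the `α`-tableau `T`. -/
def rowContent (α : Partition n) (T : ℕ × ℕ → ℕ) (i j : ℕ) : ℕ :=
  ((Finset.Icc 1 (α.parts i)).filter fun col => T (i, col) = j).card

open Classical in
/-- James' homomorphism `θ_T : M^α → M^c` attached to an `α`-tableau `T` of type `c`:
an `α`-tabloid `f` is sent to the sum of all `c`-tabloids `g` such that, for all `i`, `j`,
exactly `rowContent α T i j` symbols lie in row `i` of `f` and row `j` of `g`.  (This is
the sum over the row-equivalence class of `T` of the corresponding tabloids.) -/
noncomputable def theta (R : Type*) [CommRing R] (α : Partition n) (c : ℕ → ℕ)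
    (T : ℕ × ℕ → ℕ) : PermMod R n α.parts →ₗ[R] PermMod R n c :=
  Finsupp.lift (PermMod R n c) R (Tabloid n α.parts) fun f =>
    ∑ g ∈ Finset.univ.filter (fun g : Tabloid n c =>
        ∀ i j, (Finset.univ.filter fun k => f.1 k = i ∧ g.1 k = j).card = rowContent α T i j),
      Finsupp.single g (1 : R)

/-- The restriction `θ̂_T` of `θ_T` to the Specht module `S^α`. -/
noncomputable def thetaHat (R : Type*) [CommRing R] (α : Partition n) (c : ℕ → ℕ)
    (T : ℕ × ℕ → ℕ) : ↥(Specht R α) →ₗ[R] PermMod R n c :=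
  (theta R α c T).comp (Specht R α).subtype

/-- The composition `ν` obtained from `c` by replacing the rows `i`, `i+1` with rows of
sizes `c i + c (i+1) - r` and `r`. -/
def nuComp (c : ℕ → ℕ) (i r : ℕ) : ℕ → ℕ :=
  fun j => if j = i then c i + c (i + 1) - r else if j = i + 1 then r else c j

open Classical in
/-- James' homomorphism `ψ_{i,r} : M^c → M^ν`: a tabloid is sent to the sum of all
tabloids obtained from it by changing all but `r` of the entries in row `i+1` to `i`. -/
noncomputable def psi (R : Type*) [CommRing R] (c : ℕ → ℕ) (i r : ℕ) :
    PermMod R n c →ₗ[R] PermMod R n (nuComp c i r) :=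
  Finsupp.lift (PermMod R n (nuComp c i r)) R (Tabloid n c) fun f =>
    ∑ g ∈ Finset.univ.filter (fun g : Tabloid n (nuComp c i r) =>
        ∀ k, g.1 k = f.1 k ∨ (f.1 k = i + 1 ∧ g.1 k = i)),
      Finsupp.single g (1 : R)

/-- Normalized semistandard `α`-tableaux of type `c` (entries outside the diagram are `0`). -/
def SSTSet (α : Partition n) (c : ℕ → ℕ) : Set (ℕ × ℕ → ℕ) :=
  {T | IsSemistandard α T ∧ IsTypeOf α c T ∧ ∀ cc, cc ∉ α.cells → T cc = 0}

lemma SSTSet_finite (α : Partition n) (c : ℕ → ℕ) (hc : (Function.support c).Finite) :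
    (SSTSet α c).Finite := by
  classical
  have hinj : Set.InjOn (fun T (cc : ↥(cellFinset α)) => T cc.1) (SSTSet α c) := by
    intro T hT S hS h
    funext cc
    by_cases hcc : cc ∈ α.cells
    · have hmem : cc ∈ cellFinset α := (Set.Finite.mem_toFinset _).mpr hcc
      exact congrFun h ⟨cc, hmem⟩
    · rw [hT.2.2 cc hcc, hS.2.2 cc hcc]
  have himage : ((fun T (cc : ↥(cellFinset α)) => T cc.1) '' SSTSet α c) ⊆
      Set.univ.pi (fun _ : ↥(cellFinset α) => insert 0 (Function.support c)) := by
    rintro _ ⟨T, hT, rfl⟩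
    intro cc _
    have h1 := hT.2.1 (T cc.1)
    have h2 : cc.1 ∈ (cellFinset α).filter fun d => T d = T cc.1 :=
      Finset.mem_filter.mpr ⟨cc.2, rfl⟩
    have h3 : 0 < c (T cc.1) := h1 ▸ Finset.card_pos.mpr ⟨cc.1, h2⟩
    exact Set.mem_insert_iff.mpr (Or.inr (by
      simp only [Function.mem_support]
      omega))
  exact Set.Finite.of_finite_image
    (Set.Finite.subset (Set.Finite.pi fun _ => hc.insert 0) himage) hinj

/-- The finset of all (normalized) semistandard `α`-tableaux of type `β`. -/
noncomputable def sstFinset (α β : Partition n) : Finset (ℕ × ℕ → ℕ) :=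
  (SSTSet_finite α β.parts β.finite_support).toFinset

/-- `T̂(u)`, the entry at the end of row `u` of `T`. -/
def hatOf (α : Partition n) (T : ℕ × ℕ → ℕ) (u : ℕ) : ℕ := T (u, α.parts u)

/-- The semistandard `α`-set `{T}` of `T`: those rows `u ∈ {a, …, b-1}` with `T̂(u) ≠ u`. -/
def Tset (α : Partition n) (a b : ℕ) (T : ℕ × ℕ → ℕ) : Finset ℕ :=
  (Finset.Icc a (b - 1)).filter fun u => hatOf α T u ≠ u

/-- The removable set `{R}`: those rows `i ∈ {a, …, b-1}` such that `(i, α_i)` is a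
removable node of `[α]`. -/
def Rset (α : Partition n) (a b : ℕ) : Finset ℕ :=
  (Finset.Icc a (b - 1)).filter fun i => α.parts (i + 1) < α.parts i

/-- The hook lengths `h_i` in the `(α_b + 1)`-th column of `[α]` (with `h_i = 0` for `i ≥ b`):
`h_i = α_i - α_b + b - i - 1`. -/
def hook (α : Partition n) (b i : ℕ) : ℤ :=
  if i < b then (α.parts i : ℤ) - (α.parts b : ℤ) + (b : ℤ) - (i : ℤ) - 1 else 0

/-- `T̂⁻¹(v)`: the row `u ∈ {a, …, b-1}` with `T̂(u) = v`. -/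
noncomputable def invHat (α : Partition n) (a b : ℕ) (T : ℕ × ℕ → ℕ) (v : ℕ) : ℕ :=
  sInf {u | a ≤ u ∧ u ≤ b - 1 ∧ hatOf α T u = v}

/-- The smallest element of `X` greater than `u`, or `b` if there is none. -/
noncomputable def nextIn (X : Finset ℕ) (b u : ℕ) : ℕ := sInf ({v | v ∈ X ∧ u < v} ∪ {b})

/-- The bijection `T̂ : {a,…,b-1} → {a+1,…,b}` determined by a semistandard set `X`:
`T̂` maps each `u ∈ X` to the next element of `X ∪ {b}` above it, and fixes `u ∉ X`. -/
noncomputable def hatOfSet (X : Finset ℕ) (b u : ℕ) : ℕ :=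
  if u ∈ X then nextIn X b u else u

open Classical in
/-- The (normalized) semistandard `α`-tableau of type `β` whose semistandard set is `X`:
every cell of row `i` contains `i`, except that for `a ≤ i ≤ b-1` the last cell of row `i`
contains `T̂(i)` (where `T̂` is the bijection determined by `X`). -/
noncomputable def tableauOfSet (α : Partition n) (a b : ℕ) (X : Finset ℕ) : ℕ × ℕ → ℕ :=
  fun cc =>
    if cc ∈ α.cells then
      (if a ≤ cc.1 ∧ cc.1 ≤ b - 1 ∧ cc.2 = α.parts cc.1 then hatOfSet X b cc.1 else cc.1)
    else 0

/-- `X` is a semistandard `α`-set of type `β` (for the one-box shift from row `a` to row `b`):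
`a ∈ X ⊆ {a, …, b-1}`, and `u ∈ X` together with `α_{u+1} = α_u` forces `u+1 ∈ X`. -/
def IsSSSet (α : Partition n) (a b : ℕ) (X : Finset ℕ) : Prop :=
  a ∈ X ∧ (∀ u ∈ X, a ≤ u ∧ u ≤ b - 1) ∧
    ∀ u ∈ X, α.parts (u + 1) = α.parts u → u + 1 ∈ X

/-- The coefficient `(-1)^{|T|} ∏_{u ∈ {R}\{T}} h_u` of `θ̂_T` in the Carter-Payne
homomorphism. -/
noncomputable def cpCoeff (α : Partition n) (a b : ℕ) (T : ℕ × ℕ → ℕ) : ℤ :=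
  (-1) ^ (Tset α a b T).card * ∏ u ∈ Rset α a b \ Tset α a b T, hook α b u

/-- Given a semistandard tableau `T` whose set contains `i`, the semistandard set
`{T ∨ i}`: it equals `{T}` if `T̂(i) = i+1`, and otherwise is `{T} ∪ {i+1, …, i+k}` where
`k ≥ 1` is such that `(i+k, α_{i+k})` is a removable node of `α` and `α_{i+1} = α_{i+k}`. -/
noncomputable def veeSet {n : ℕ} (α : Partition n) (a b : ℕ) (T : ℕ × ℕ → ℕ) (i : ℕ) :
    Finset ℕ :=
  if hatOf α T i = i + 1 then Tset α a b T
  else Tset α a b T ∪ Finset.Icc (i + 1)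
    (i + sInf {k | 1 ≤ k ∧ α.parts (i + k) = α.parts (i + 1) ∧
      α.parts (i + k + 1) < α.parts (i + k)})

/-! ## Content matrices -/

/-- Elementary integer matrix. -/
def eM (r j : ℕ) : ℕ → ℕ → ℤ := fun r' j' => if r = r' ∧ j = j' then 1 else 0

/-- The content matrix of a pair of row-assignments. -/
def cont (f g : Fin n → ℕ) : ℕ → ℕ → ℤ := ∑ k, eM (f k) (g k)

lemma cont_apply (f g : Fin n → ℕ) (r j : ℕ) :
    cont f g r j = ((Finset.univ.filter fun k => f k = r ∧ g k = j).card : ℤ) := by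
  simp only [cont, Finset.sum_apply, eM, Finset.card_filter]
  push_cast
  rfl

lemma sum_update {M : Type*} [AddCommGroup M] (G : Fin n → ℕ → M) (g : Fin n → ℕ)
    (x : Fin n) (v : ℕ) :
    ∑ k, G k (Function.update g x v k) = ∑ k, G k (g k) - G x (g x) + G x v := by
  classical
  rw [← Finset.add_sum_erase _ _ (Finset.mem_univ x),
    ← Finset.add_sum_erase Finset.univ (fun k => G k (g k)) (Finset.mem_univ x)]
  have : ∑ k ∈ Finset.univ.erase x, G k (Function.update g x v k)
      = ∑ k ∈ Finset.univ.erase x, G k (g k) := by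
    apply Finset.sum_congr rfl
    intro k hk
    rw [Function.update_of_ne (Finset.ne_of_mem_erase hk)]
  rw [this, Function.update_self]
  abel

lemma cont_update_right (f g : Fin n → ℕ) (x : Fin n) (v : ℕ) :
    cont f (Function.update g x v) = cont f g - eM (f x) (g x) + eM (f x) v :=
  sum_update (fun k u => eM (f k) u) g x v

lemma cont_update_left (f g : Fin n → ℕ) (x : Fin n) (v : ℕ) :
    cont (Function.update f x v) g = cont f g - eM (f x) (g x) + eM v (g x) :=
  sum_update (fun k u => eM u (g k)) f x v

lemma cont_nonneg (f g : Fin n → ℕ) (r j : ℕ) : 0 ≤ cont f g r j := by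
  rw [cont_apply]; positivity

open Classical in
/-- Coefficient at `g` of the image of the polytabloid `e_t` under the map given by the
content matrix `C`. -/
noncomputable def pv (F : Type*) [CommRing F] {α : Partition n} (t : Placement α)
    (C : ℕ → ℕ → ℤ) (g : Fin n → ℕ) : F :=
  ∑ π ∈ colStab t, ((Equiv.Perm.sign π : ℤ) : F) *
    if cont (rowTabloid t π).1 g = C then 1 else 0

open Classical in
/-- The Garnir relation. -/
lemma garnir (F : Type*) [CommRing F] {α : Partition n} (t : Placement α)
    (r1 r2 : ℕ) (hr : r1 ≠ r2) (h1 : 0 < r1) (hα : α.parts r2 ≤ α.parts r1)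
    (U : ℕ → ℕ → ℤ) (g : Fin n → ℕ) :
    ∑ π ∈ colStab t, ((Equiv.Perm.sign π : ℤ) : F) *
      ∑ x : Fin n, (if (rowTabloid t π).1 x = r2 ∧
        cont (Function.update (rowTabloid t π).1 x r1) g = U then (1 : F) else 0) = 0 := by
  have hex : ∀ (π : Equiv.Perm (Fin n)) (x : Fin n), ∃ y, (t.pos (π x)).1 = r2 →
      t.pos (π y) = (r1, (t.pos (π x)).2) := by
    intro π x
    by_cases hx : (t.pos (π x)).1 = r2
    · obtain ⟨m1, m2, m3⟩ := t.mem (π x)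
      obtain ⟨y, hy⟩ := t.surj (r1, (t.pos (π x)).2) ⟨h1, m2, by
        rw [hx] at m3; exact m3.trans hα⟩
      exact ⟨π.symm y, fun _ => by simpa using hy⟩
    · exact ⟨x, fun h => absurd h hx⟩
  choose Y hY using hex
  simp_rw [Finset.mul_sum]
  rw [← Finset.sum_product']
  have hrow : ∀ (π : Equiv.Perm (Fin n)) (x : Fin n), (rowTabloid t π).1 x = (t.pos (π x)).1 :=
    fun _ _ => rfl
  rw [← Finset.sum_filter_of_ne (p := fun q : Equiv.Perm (Fin n) × Fin n =>
    (t.pos (q.1 q.2)).1 = r2)]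
  swap
  · intro q _ hq
    by_contra hne
    apply hq
    rw [if_neg (fun h => hne h.1), mul_zero]
  refine Finset.sum_involution
    (fun q _ => (q.1 * Equiv.swap q.2 (Y q.1 q.2), Y q.1 q.2)) ?_ ?_ ?_ ?_
  · rintro ⟨π, x⟩ hq
    simp only [Finset.mem_filter, Finset.mem_product, Finset.mem_univ, and_true] at hq
    have hy := hY π x hq.2
    have hxy : x ≠ Y π x := by
      intro h
      rw [← h] at hy
      apply hr
      rw [← hq.2, hy]
    have hupd : Function.update (rowTabloid t (π * Equiv.swap x (Y π x))).1 (Y π x) r1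
        = Function.update (rowTabloid t π).1 x r1 := by
      funext k
      by_cases hkx : k = x
      · subst hkx
        rw [Function.update_of_ne hxy, Function.update_self]
        simp [hrow, hy]
      · by_cases hky : k = Y π x
        · subst hky
          rw [Function.update_self, Function.update_of_ne hkx]
          simp [hrow, hy]
        · rw [Function.update_of_ne hky, Function.update_of_ne hkx]
          simp [hrow, Equiv.swap_apply_of_ne_of_ne hkx hky]
    have hr2 : (rowTabloid t (π * Equiv.swap x (Y π x))).1 (Y π x) = r2 := by
      simp [hrow, hq.2]
    simp only [hupd, hr2]
    rw [hrow, hq.2, Equiv.Perm.sign_mul, Equiv.Perm.sign_swap hxy]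
    by_cases hU : cont (Function.update (rowTabloid t π).1 x r1) g = U <;> simp [hU]
  · rintro ⟨π, x⟩ hq _ heq
    simp only [Finset.mem_filter, Finset.mem_product, Finset.mem_univ, and_true] at hq
    have hy := hY π x hq.2
    have : Y π x = x := congrArg Prod.snd heq
    rw [this] at hy
    apply hr
    rw [← hq.2, hy]
  · rintro ⟨π, x⟩ hq
    simp only [Finset.mem_filter, Finset.mem_product, Finset.mem_univ, and_true] at hq ⊢
    have hy := hY π x hq.2
    refine ⟨?_, by simp [hq.2]⟩
    have hc := hq.1
    simp only [colStab, Finset.mem_filter, Finset.mem_univ, true_and] at hc ⊢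
    intro k
    rw [← hc k]
    by_cases hkx : k = x
    · subst hkx; simp [hy]
    · by_cases hky : k = Y π x
      · rw [hky]; simp [hy]
      · simp [Equiv.swap_apply_of_ne_of_ne hkx hky]
  · rintro ⟨π, x⟩ hq
    simp only [Finset.mem_filter, Finset.mem_product, Finset.mem_univ, and_true] at hq
    have hy := hY π x hq.2
    have key : Y (π * Equiv.swap x (Y π x)) (Y π x) = x := by
      have h2 := hY (π * Equiv.swap x (Y π x)) (Y π x) (by simp [hq.2])
      have h3 : t.pos ((π * Equiv.swap x (Y π x)) x) = (r1, (t.pos (π x)).2) := by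
        simp [hy]
      have h4 : t.pos ((π * Equiv.swap x (Y π x)) (Y (π * Equiv.swap x (Y π x)) (Y π x)))
        = t.pos ((π * Equiv.swap x (Y π x)) x) := by
        rw [h2, h3]; simp
      exact (Equiv.injective _ (t.inj h4))
    simp only [key]
    ext : 1
    · simp only [mul_assoc]
      rw [Equiv.swap_comm (Y π x) x, Equiv.swap_mul_self, mul_one]
    · rfl

lemma eM_self (r j : ℕ) : eM r j r j = 1 := by simp [eM]

open Classical in
/-- Two-term Garnir relation. -/
lemma garnir2 (F : Type*) [CommRing F] {α : Partition n} (t : Placement α)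
    (r1 r2 d e : ℕ) (hr : r1 ≠ r2) (h1 : 0 < r1) (hα : α.parts r2 ≤ α.parts r1) (hde : d ≠ e)
    (S S' : ℕ → ℕ → ℤ) (hS' : S' = S - eM r2 d + eM r1 d + eM r2 e - eM r1 e)
    (hS : ∀ j, j ≠ d → j ≠ e → S r1 j ≤ 0) (g : Fin n → ℕ) :
    (S r2 d : F) * pv F t S g + ((S r2 e + 1 : ℤ) : F) * pv F t S' g = 0 := by
  rw [← garnir F t r1 r2 hr h1 hα (S - eM r2 d + eM r1 d) g]
  simp only [pv, Finset.mul_sum, ← Finset.sum_add_distrib]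
  apply Finset.sum_congr rfl
  intro π _
  rw [← Finset.mul_sum]
  set f := (rowTabloid t π).1
  have hcount : ∀ j, (∑ x : Fin n, if f x = r2 ∧ g x = j then (1 : F) else 0)
      = (cont f g r2 j : F) := by
    intro j
    rw [cont_apply]; simp
  have hx : ∀ x : Fin n, (if f x = r2 ∧ cont (Function.update f x r1) g = S - eM r2 d + eM r1 d
      then (1 : F) else 0) =
      (if f x = r2 ∧ g x = d then 1 else 0) * (if cont f g = S then 1 else 0) +
      (if f x = r2 ∧ g x = e then 1 else 0) * (if cont f g = S' then 1 else 0) := by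
    intro x
    by_cases hf : f x = r2
    swap
    · simp [hf]
    rw [cont_update_left, hf]
    by_cases hgd : g x = d
    · have : (cont f g - eM r2 (g x) + eM r1 (g x) = S - eM r2 d + eM r1 d) ↔ cont f g = S := by
        rw [hgd]; simp
      simp [hgd, hde]
    by_cases hge : g x = e
    · have : (cont f g - eM r2 (g x) + eM r1 (g x) = S - eM r2 d + eM r1 d) ↔
          cont f g = S' := by
        rw [hge, hS', ← sub_eq_zero, ← sub_eq_zero (a := cont f g)]
        apply Eq.congr _ rfl
        abel
      rw [hge] at this
      simp [hge, hde.symm, this]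
    · have : ¬ (cont f g - eM r2 (g x) + eM r1 (g x) = S - eM r2 d + eM r1 d) := by
        intro h
        have h2 := congrFun (congrFun h r1) (g x)
        have h3 := hS _ hgd hge
        have h4 := cont_nonneg f g r1 (g x)
        simp [eM, hr.symm, Ne.symm hgd] at h2
        omega
      simp [this, hgd, hge]
  simp_rw [hx]
  rw [Finset.sum_add_distrib, ← Finset.sum_mul, ← Finset.sum_mul, hcount, hcount]
  have e1 : (cont f g r2 d : F) * (if cont f g = S then 1 else 0)
      = (S r2 d : F) * (if cont f g = S then 1 else 0) := by
    split_ifs with h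
    · rw [h]
    · simp
  have e2 : (cont f g r2 e : F) * (if cont f g = S' then 1 else 0)
      = ((S r2 e + 1 : ℤ) : F) * (if cont f g = S' then 1 else 0) := by
    split_ifs with h
    · rw [h, hS']
      simp [eM, hr, hde]
    · simp
  rw [e1, e2]
  ring

/-- Integer-valued row content of a tableau. -/
def rcZ (α : Partition n) (T : ℕ × ℕ → ℕ) : ℕ → ℕ → ℤ := fun r j => (rowContent α T r j : ℤ)

open Classical in
lemma theta_single_apply (F : Type*) [CommRing F] (α : Partition n) (c : ℕ → ℕ)
    (T : ℕ × ℕ → ℕ) (f : Tabloid n α.parts) (g : Tabloid n c) :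
    theta F α c T (Finsupp.single f 1) g = if cont f.1 g.1 = rcZ α T then 1 else 0 := by
  have hiff : (∀ i j, (Finset.univ.filter fun k => f.1 k = i ∧ g.1 k = j).card
      = rowContent α T i j) ↔ cont f.1 g.1 = rcZ α T := by
    constructor
    · intro h
      funext i j
      rw [cont_apply, h, rcZ]
    · intro h i j
      have := congrFun (congrFun h i) j
      rw [cont_apply, rcZ] at this
      exact_mod_cast this
  simp only [theta, Finsupp.lift_apply]
  rw [Finsupp.sum_single_index (by simp), one_smul, Finsupp.finsetSum_apply]
  simp only [Finsupp.single_apply]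
  rw [Finset.sum_ite_eq']
  simp only [Finset.mem_filter, Finset.mem_univ, true_and, hiff]

open Classical in
lemma psi_apply (F : Type*) [CommRing F] (c : ℕ → ℕ) (i r : ℕ) (φ : PermMod F n c)
    (g : Tabloid n (nuComp c i r)) :
    psi F c i r φ g = ∑ h : Tabloid n c,
      φ h * if (∀ k, g.1 k = h.1 k ∨ (h.1 k = i + 1 ∧ g.1 k = i)) then 1 else 0 := by
  simp only [psi, Finsupp.lift_apply]
  rw [Finsupp.sum_fintype _ _ (by simp), Finsupp.finsetSum_apply]
  apply Finset.sum_congr rfl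
  intro h _
  rw [Finsupp.smul_apply, Finsupp.finsetSum_apply, smul_eq_mul]
  congr 1
  simp only [Finsupp.single_apply]
  rw [Finset.sum_ite_eq']
  simp only [Finset.mem_filter, Finset.mem_univ, true_and]

lemma card_eq_sum (g : Fin n → ℕ) (j : ℕ) :
    ((Finset.univ.filter fun k => g k = j).card : ℤ) = ∑ k, if g k = j then (1 : ℤ) else 0 := by
  simp

open Classical in
lemma psi_theta_single (F : Type*) [CommRing F] (α : Partition n) (c : ℕ → ℕ) (i : ℕ)
    (hc : 0 < c (i + 1)) (T : ℕ × ℕ → ℕ) (f : Tabloid n α.parts)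
    (g : Tabloid n (nuComp c i (c (i + 1) - 1))) :
    psi F c i (c (i + 1) - 1) (theta F α c T (Finsupp.single f 1)) g =
      ∑ x : Fin n, if g.1 x = i ∧
        cont f.1 (Function.update g.1 x (i + 1)) = rcZ α T then (1 : F) else 0 := by
  rw [psi_apply]
  have hite : ∀ (P Q : Prop) [Decidable P] [Decidable Q], (if P then (1 : F) else 0) * (if Q then (1 : F) else 0)
      = if P ∧ Q then 1 else 0 := by
    intro P Q _ _
    by_cases hP : P <;> simp [hP]
  simp_rw [theta_single_apply, hite]
  rw [Finset.sum_boole, Finset.sum_boole]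
  congr 1
  symm
  have gt : ∀ j, (∑ k, if g.1 k = j then (1 : ℤ) else 0) =
      if j = i then (c i : ℤ) + 1 else if j = i + 1 then (c (i + 1) : ℤ) - 1 else c j := by
    intro j
    rw [← card_eq_sum, g.2 j]
    simp only [nuComp]
    split_ifs <;> omega
  have ht : ∀ x, g.1 x = i → ∀ j,
      (Finset.univ.filter fun k => Function.update g.1 x (i + 1) k = j).card = c j := by
    intro x hx j
    apply Nat.cast_injective (R := ℤ)
    rw [card_eq_sum, sum_update (fun _ u => if u = j then (1 : ℤ) else 0), gt, hx]
    by_cases h1 : j = i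
    · subst h1; simp
    · by_cases h2 : j = i + 1
      · subst h2; simp
      · simp [h1, h2, Ne.symm h1, Ne.symm h2]
  refine Finset.card_bij (fun x hx => ⟨Function.update g.1 x (i + 1),
    ht x (Finset.mem_filter.mp hx).2.1⟩) ?_ ?_ ?_
  · intro x hx
    have hx' := (Finset.mem_filter.mp hx).2
    refine Finset.mem_filter.mpr ⟨Finset.mem_univ _, hx'.2, fun k => ?_⟩
    by_cases hk : k = x
    · subst hk; right; simp [hx'.1]
    · left; exact (Function.update_of_ne hk _ _).symm
  · intro x hx y hy hxy
    have hx' := (Finset.mem_filter.mp hx).2.1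
    have h := congrFun (congrArg Subtype.val hxy) x
    simp only [Function.update_self] at h
    by_contra hne
    rw [Function.update_of_ne hne, hx'] at h
    omega
  · intro h hh
    simp only [Finset.mem_filter, Finset.mem_univ, true_and] at hh
    obtain ⟨hcont, hrel⟩ := hh
    have hcard : (Finset.univ.filter fun k => h.1 k ≠ g.1 k).card = 1 := by
      apply Nat.cast_injective (R := ℤ)
      rw [Finset.card_filter]
      push_cast
      have e1 : (∑ k, if h.1 k = i + 1 then (1 : ℤ) else 0) = c (i + 1) := by
        rw [← card_eq_sum, h.2]
      have e2 := gt (i + 1)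
      have e3 : ∀ k, (if h.1 k ≠ g.1 k then (1 : ℤ) else 0) =
        (if h.1 k = i + 1 then (1 : ℤ) else 0) - (if g.1 k = i + 1 then (1 : ℤ) else 0) := by
        intro k
        rcases hrel k with h1 | ⟨h1, h2⟩
        · simp [h1]
        · simp [h1, h2]
      rw [Finset.sum_congr rfl (fun k _ => e3 k), Finset.sum_sub_distrib, e1, e2]
      simp
    obtain ⟨x, hx⟩ := Finset.card_eq_one.mp hcard
    have hx1 : h.1 x ≠ g.1 x := by
      have : x ∈ (Finset.univ.filter fun k => h.1 k ≠ g.1 k) := by rw [hx]; simp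
      simpa using this
    have hx2 : ∀ k, k ≠ x → h.1 k = g.1 k := by
      intro k hk
      by_contra hne
      have : k ∈ (Finset.univ.filter fun k => h.1 k ≠ g.1 k) := by simpa using hne
      rw [hx] at this
      exact hk (by simpa using this)
    have hx3 : h.1 x = i + 1 ∧ g.1 x = i := by
      rcases hrel x with h1 | h1
      · exact absurd h1.symm hx1
      · exact h1
    have heq : Function.update g.1 x (i + 1) = h.1 := by
      funext k
      by_cases hk : k = x
      · subst hk; simp [hx3.1]
      · rw [Function.update_of_ne hk, hx2 k hk]
    exact ⟨x, by simp only [Finset.mem_filter, Finset.mem_univ, true_and, heq]; exact ⟨hx3.2, hcont⟩,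
      Subtype.ext heq⟩

lemma theta_poly (F : Type*) [CommRing F] (α : Partition n) (c : ℕ → ℕ)
    (T : ℕ × ℕ → ℕ) (t : Placement α) (g : Tabloid n c) :
    theta F α c T (polytabloid F t) g = pv F t (rcZ α T) g.1 := by
  classical
  rw [polytabloid, map_sum, Finsupp.finsetSum_apply, pv]
  apply Finset.sum_congr rfl
  intro π _
  rw [map_smul, Finsupp.smul_apply, theta_single_apply, smul_eq_mul]

open Classical in
/-- `ψ_i ∘ θ_T` on a polytabloid, when the symbol `i+1` only lies in rows `r, s` of `T`. -/
lemma psi_theta_poly (F : Type*) [CommRing F] (α : Partition n) (c : ℕ → ℕ) (i : ℕ)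
    (hc : 0 < c (i + 1)) (T : ℕ × ℕ → ℕ) (r s : ℕ) (hrs : r ≠ s)
    (hT : ∀ q, q ≠ r → q ≠ s → rcZ α T q (i + 1) ≤ 0)
    (t : Placement α) (g : Tabloid n (nuComp c i (c (i + 1) - 1))) :
    psi F c i (c (i + 1) - 1) (theta F α c T (polytabloid F t)) g =
      ((rcZ α T r i + 1 : ℤ) : F) * pv F t (rcZ α T - eM r (i + 1) + eM r i) g.1 +
      ((rcZ α T s i + 1 : ℤ) : F) * pv F t (rcZ α T - eM s (i + 1) + eM s i) g.1 := by
  rw [polytabloid, map_sum, map_sum, Finsupp.finsetSum_apply]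
  simp only [pv, Finset.mul_sum, ← Finset.sum_add_distrib]
  apply Finset.sum_congr rfl
  intro π _
  rw [map_smul, map_smul, Finsupp.smul_apply, psi_theta_single F α c i hc, smul_eq_mul]
  set f := (rowTabloid t π).1
  set C := rcZ α T
  have hcount : ∀ q, (∑ x : Fin n, if f x = q ∧ g.1 x = i then (1 : F) else 0)
      = (cont f g.1 q i : F) := by
    intro q
    rw [cont_apply]; simp
  have hq : ∀ q, (cont f g.1 = C - eM q (i + 1) + eM q i) ↔
      cont f g.1 - eM q i + eM q (i + 1) = C := by
    intro q
    rw [← sub_eq_zero, ← sub_eq_zero (b := C)]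
    apply Eq.congr _ rfl
    abel
  have hx : ∀ x : Fin n, (if g.1 x = i ∧ cont f (Function.update g.1 x (i + 1)) = C
      then (1 : F) else 0) =
      (if f x = r ∧ g.1 x = i then 1 else 0) *
        (if cont f g.1 = C - eM r (i + 1) + eM r i then 1 else 0) +
      (if f x = s ∧ g.1 x = i then 1 else 0) *
        (if cont f g.1 = C - eM s (i + 1) + eM s i then 1 else 0) := by
    intro x
    by_cases hg : g.1 x = i
    swap
    · simp [hg]
    rw [cont_update_right, hg, hq, hq]
    by_cases h1 : f x = r
    · simp [h1, hrs]
    by_cases h2 : f x = s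
    · simp [h2, hrs.symm]
    have : ¬ (cont f g.1 - eM (f x) i + eM (f x) (i + 1) = C) := by
      intro h
      have h3 := congrFun (congrFun h (f x)) (i + 1)
      have h4 := hT _ h1 h2
      have h5 := cont_nonneg f g.1 (f x) (i + 1)
      simp [eM] at h3
      omega
    simp [h1, h2, this]
  simp_rw [hx]
  rw [Finset.sum_add_distrib, ← Finset.sum_mul, ← Finset.sum_mul, hcount, hcount]
  have e1 : ∀ q, (cont f g.1 q i : F) * (if cont f g.1 = C - eM q (i + 1) + eM q i then 1 else 0)
      = ((C q i + 1 : ℤ) : F) * (if cont f g.1 = C - eM q (i + 1) + eM q i then 1 else 0) := by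
    intro q
    split_ifs with h
    · rw [h]
      simp [eM]
    · simp
  rw [e1, e1]
  ring

lemma specht_ext (F : Type*) [CommRing F] (α : Partition n) {N : Type*} [AddCommGroup N]
    [Module F N] (φ χ : PermMod F n α.parts →ₗ[F] N)
    (h : ∀ t : Placement α, φ (polytabloid F t) = χ (polytabloid F t)) :
    φ.comp (Specht F α).subtype = χ.comp (Specht F α).subtype := by
  ext1 ⟨v, hv⟩
  simp only [LinearMap.comp_apply, Submodule.subtype_apply]
  refine Submodule.span_induction (p := fun v _ => φ v = χ v) ?_ ?_ ?_ ?_ hv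
  · rintro _ ⟨t, rfl⟩; exact h t
  · simp
  · intro x y _ _ hx hy; rw [map_add, map_add, hx, hy]
  · intro c x _ hx; rw [map_smul, map_smul, hx]

/-- The content matrix of the tableau whose last entries in rows `a..b-1` are given by `H`. -/
def conm (α : Partition n) (a b : ℕ) (H : ℕ → ℕ) : ℕ → ℕ → ℤ := fun r j =>
  (if j = r then (α.parts r : ℤ) else 0) +
    if a ≤ r ∧ r ≤ b - 1 then (if j = H r then 1 else 0) - (if j = r then 1 else 0) else 0

lemma mem_cellFinset (α : Partition n) (cc : ℕ × ℕ) : cc ∈ cellFinset α ↔ cc ∈ α.cells := by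
  simp [cellFinset]

lemma rcZ_eq (α : Partition n) (a b : ℕ) (ha : 0 < a)
    (hpos : ∀ r, a ≤ r → r ≤ b - 1 → 0 < α.parts r) (H : ℕ → ℕ) (T : ℕ × ℕ → ℕ)
    (hT : ∀ r c, (r, c) ∈ α.cells →
      T (r, c) = if a ≤ r ∧ r ≤ b - 1 ∧ c = α.parts r then H r else r) :
    rcZ α T = conm α a b H := by
  funext r j
  simp only [rcZ, rowContent, conm]
  rcases Nat.eq_zero_or_pos r with h0 | h0
  · subst h0
    have : ¬ (a ≤ 0 ∧ 0 ≤ b - 1) := by omega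
    rw [if_neg this, α.parts_zero]
    simp
  rw [Finset.card_filter]
  push_cast
  by_cases hr : a ≤ r ∧ r ≤ b - 1
  · rw [if_pos hr]
    obtain ⟨m, hm⟩ : ∃ m, α.parts r = m + 1 := ⟨α.parts r - 1, by
      have := hpos r hr.1 hr.2; omega⟩
    rw [hm, Finset.sum_Icc_succ_top (by omega)]
    have e1 : ∑ k ∈ Finset.Icc 1 m, (if T (r, k) = j then (1 : ℤ) else 0)
        = ∑ k ∈ Finset.Icc 1 m, (if j = r then (1 : ℤ) else 0) := by
      apply Finset.sum_congr rfl
      intro k hk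
      rw [Finset.mem_Icc] at hk
      have hn : ¬ (a ≤ r ∧ r ≤ b - 1 ∧ k = α.parts r) := by omega
      rw [hT r k ⟨h0, hk.1, by simp only [hm]; omega⟩, if_neg hn]
      simp only [eq_comm]
    have e2 : T (r, m + 1) = H r := by
      rw [hT r (m + 1) ⟨h0, by simp, by simp only [hm]; omega⟩, if_pos ⟨hr.1, hr.2, hm.symm⟩]
    rw [e1, e2, Finset.sum_const, Nat.card_Icc]
    simp only [eq_comm (a := H r)]
    split_ifs <;> simp
  · rw [if_neg hr]
    have e1 : ∑ k ∈ Finset.Icc 1 (α.parts r), (if T (r, k) = j then (1 : ℤ) else 0)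
        = ∑ k ∈ Finset.Icc 1 (α.parts r), (if j = r then (1 : ℤ) else 0) := by
      apply Finset.sum_congr rfl
      intro k hk
      rw [Finset.mem_Icc] at hk
      have hn : ¬ (a ≤ r ∧ r ≤ b - 1 ∧ k = α.parts r) := fun h => hr ⟨h.1, h.2.1⟩
      rw [hT r k ⟨h0, hk.1, hk.2⟩, if_neg hn]
      simp only [eq_comm]
    rw [e1, Finset.sum_const, Nat.card_Icc]
    split_ifs <;> simp

lemma sst_ge (α β : Partition n) (T : ℕ × ℕ → ℕ) (hT : T ∈ SSTSet α β.parts) :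
    ∀ r c, (r, c) ∈ α.cells → r ≤ T (r, c) := by
  intro r
  induction r with
  | zero => intro c _; omega
  | succ r ih =>
    intro c hc
    rcases Nat.eq_zero_or_pos r with h0 | h0
    · subst h0
      by_contra hlt
      have hz : T (0 + 1, c) = 0 := by omega
      have h1 := hT.2.1 0
      rw [β.parts_zero, Finset.card_eq_zero] at h1
      have : (0 + 1, c) ∈ (cellFinset α).filter fun cc => T cc = 0 :=
        Finset.mem_filter.mpr ⟨(mem_cellFinset _ _).mpr hc, hz⟩
      rw [h1] at this
      simp at this
    · have hc' : (r, c) ∈ α.cells := ⟨h0, hc.2.1, hc.2.2.trans (α.antitone h0 (by simp))⟩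
      have h1 := ih c hc'
      have h2 := hT.1.2 r (r + 1) c hc' hc (by omega)
      omega

lemma card_cells_le (α : Partition n) (j : ℕ) :
    ((cellFinset α).filter fun cc => cc.1 ≤ j).card = ∑ r ∈ Finset.range (j + 1), α.parts r := by
  classical
  rw [Finset.card_eq_sum_card_fiberwise (f := Prod.fst) (t := Finset.range (j + 1))]
  · apply Finset.sum_congr rfl
    intro r hr
    rw [Finset.mem_range] at hr
    have : (((cellFinset α).filter fun cc => cc.1 ≤ j).filter fun cc => cc.1 = r)
        = (Finset.Icc 1 (α.parts r)).image (fun c => (r, c)) := by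
      ext ⟨x, y⟩
      simp only [Finset.mem_filter, mem_cellFinset, Finset.mem_image, Finset.mem_Icc,
        Prod.mk.injEq]
      constructor
      · rintro ⟨⟨⟨h1, h2, h3⟩, h4⟩, h5⟩
        simp only at h1 h2 h3 h5
        subst h5
        exact ⟨y, ⟨h2, h3⟩, rfl, rfl⟩
      · rintro ⟨c, ⟨h1, h2⟩, rfl, rfl⟩
        refine ⟨⟨⟨?_, h1, h2⟩, by omega⟩, rfl⟩
        rcases Nat.eq_zero_or_pos r with h0 | h0
        · subst h0; rw [α.parts_zero] at h2; omega
        · exact h0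
    rw [this, Finset.card_image_of_injective _ (fun x y h => (Prod.mk.inj h).2), Nat.card_Icc]
    omega
  · intro cc hcc
    have := (Finset.mem_filter.mp hcc).2
    simp only [Finset.coe_range, Set.mem_Iio]
    omega

lemma card_vals_le (α β : Partition n) (T : ℕ × ℕ → ℕ) (hT : T ∈ SSTSet α β.parts) (j : ℕ) :
    ((cellFinset α).filter fun cc => T cc ≤ j).card = ∑ r ∈ Finset.range (j + 1), β.parts r := by
  classical
  rw [Finset.card_eq_sum_card_fiberwise (f := T) (t := Finset.range (j + 1))]
  · apply Finset.sum_congr rfl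
    intro r hr
    rw [Finset.mem_range] at hr
    rw [← hT.2.1 r, Finset.filter_filter]
    congr 1
    apply Finset.filter_congr
    intro cc _
    constructor
    · exact fun h => h.2
    · exact fun h => ⟨by omega, h⟩
  · intro cc hcc
    have := (Finset.mem_filter.mp hcc).2
    simp only [Finset.coe_range, Set.mem_Iio]
    omega

lemma shift_sum (α β : Partition n) (a b : ℕ) (hs : OneBoxShift α β a b) (j : ℕ) :
    ∑ r ∈ Finset.range (j + 1), α.parts r =
      ∑ r ∈ Finset.range (j + 1), β.parts r + if a ≤ j ∧ j < b then 1 else 0 := by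
  have ha := hs.a_pos
  have hab := hs.a_lt_b
  have h1 := hs.rem
  have h2 := hs.at_a
  have h3 := hs.at_b
  induction j with
  | zero =>
    rw [if_neg (by omega)]
    simp [α.parts_zero, β.parts_zero]
  | succ j ih =>
    rw [Finset.sum_range_succ, Finset.sum_range_succ (fun r => β.parts r), ih]
    by_cases hja : j + 1 = a
    · rw [if_neg (by omega), if_pos (by omega), hja, h2]; omega
    · by_cases hjb : j + 1 = b
      · rw [if_pos (by omega), if_neg (by omega), hjb, h3]; omega
      · rw [hs.elsewhere _ hja hjb]
        by_cases hc : a ≤ j ∧ j < b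
        · rw [if_pos hc, if_pos (by omega)]; omega
        · rw [if_neg hc, if_neg (by omega)]; omega

lemma excess_card (α β : Partition n) (a b : ℕ) (hs : OneBoxShift α β a b)
    (T : ℕ × ℕ → ℕ) (hT : T ∈ SSTSet α β.parts) (j : ℕ) :
    ((cellFinset α).filter fun cc => cc.1 ≤ j ∧ j < T cc).card =
      if a ≤ j ∧ j < b then 1 else 0 := by
  classical
  have h1 := card_cells_le α j
  have h2 := card_vals_le α β T hT j
  have h3 := shift_sum α β a b hs j
  have h4 : (((cellFinset α).filter fun cc => cc.1 ≤ j).filter fun cc => T cc ≤ j).card +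
      (((cellFinset α).filter fun cc => cc.1 ≤ j).filter fun cc => ¬ T cc ≤ j).card =
      ((cellFinset α).filter fun cc => cc.1 ≤ j).card :=
    Finset.card_filter_add_card_filter_not _
  rw [Finset.filter_filter, Finset.filter_filter] at h4
  have h5 : ((cellFinset α).filter fun cc => cc.1 ≤ j ∧ T cc ≤ j)
      = (cellFinset α).filter fun cc => T cc ≤ j := by
    apply Finset.filter_congr
    rintro ⟨r, c⟩ hcc
    have := sst_ge α β T hT r c ((mem_cellFinset _ _).mp hcc)
    simp only
    constructor
    · exact fun h => h.2
    · exact fun h => ⟨by omega, h⟩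
  simp only [not_le] at h4
  rw [h5] at h4
  omega

/-- Structure of semistandard tableaux of one-box-shift type. -/
structure HatLike (α : Partition n) (a b : ℕ) (H : ℕ → ℕ) : Prop where
  ge : ∀ u, a ≤ u → u ≤ b - 1 → u ≤ H u
  le : ∀ u, a ≤ u → u ≤ b - 1 → H u ≤ b
  uniq : ∀ u u' j, a ≤ u → a ≤ u' → u ≤ j → u' ≤ j → j ≤ b - 1 → j < H u → j < H u' → u = u'
  exist : ∀ j, a ≤ j → j ≤ b - 1 → ∃ u, a ≤ u ∧ u ≤ j ∧ j < H u
  ss : ∀ u, a ≤ u → u + 1 ≤ b - 1 → α.parts (u + 1) = α.parts u → H u ≠ u → H (u + 1) ≠ u + 1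

lemma pos_of_shift (α β : Partition n) (a b : ℕ) (hs : OneBoxShift α β a b) :
    ∀ r, a ≤ r → r ≤ b - 1 → 0 < α.parts r := by
  intro r h1 h2
  have := hs.add
  have h3 := α.antitone (lt_of_lt_of_le hs.a_pos h1) h2
  omega

lemma sst_entry (α β : Partition n) (a b : ℕ) (hs : OneBoxShift α β a b)
    (T : ℕ × ℕ → ℕ) (hT : T ∈ SSTSet α β.parts) (r c : ℕ) (hc : (r, c) ∈ α.cells) :
    T (r, c) = if a ≤ r ∧ r ≤ b - 1 ∧ c = α.parts r then hatOf α T r else r := by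
  have hab := hs.a_lt_b
  split_ifs with h
  · rw [hatOf, ← h.2.2]
  · by_contra hne
    have hge := sst_ge α β T hT r c hc
    have hcard := excess_card α β a b hs T hT r
    have m1 : (r, c) ∈ (cellFinset α).filter fun cc => cc.1 ≤ r ∧ r < T cc :=
      Finset.mem_filter.mpr ⟨(mem_cellFinset _ _).mpr hc, le_refl _, by omega⟩
    have hc2 : (r, α.parts r) ∈ α.cells := ⟨hc.1, hc.2.1.trans_le hc.2.2, le_refl _⟩
    have hmono := hT.1.1 r c (α.parts r) hc hc2 hc.2.2
    have m2 : (r, α.parts r) ∈ (cellFinset α).filter fun cc => cc.1 ≤ r ∧ r < T cc :=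
      Finset.mem_filter.mpr ⟨(mem_cellFinset _ _).mpr hc2, le_refl _, by omega⟩
    split_ifs at hcard with hr
    · have := Finset.card_le_one.mp hcard.le _ m1 _ m2
      exact h ⟨hr.1, by omega, (Prod.mk.inj this).2⟩
    · rw [Finset.card_eq_zero] at hcard
      rw [hcard] at m1
      simp at m1

lemma sst_hatLike (α β : Partition n) (a b : ℕ) (hs : OneBoxShift α β a b)
    (T : ℕ × ℕ → ℕ) (hT : T ∈ SSTSet α β.parts) : HatLike α a b (hatOf α T) := by
  have hab := hs.a_lt_b
  have ha := hs.a_pos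
  have hpos := pos_of_shift α β a b hs
  have hcell : ∀ u, a ≤ u → u ≤ b - 1 → (u, α.parts u) ∈ α.cells :=
    fun u h1 h2 => ⟨by simp only; omega, hpos u h1 h2, le_refl _⟩
  have hge : ∀ u, a ≤ u → u ≤ b - 1 → u ≤ hatOf α T u :=
    fun u h1 h2 => sst_ge α β T hT _ _ (hcell u h1 h2)
  refine ⟨hge, ?_, ?_, ?_, ?_⟩
  · intro u h1 h2
    by_contra hlt
    have hcard := excess_card α β a b hs T hT b
    rw [if_neg (by omega), Finset.card_eq_zero] at hcard
    have m1 : (u, α.parts u) ∈ (cellFinset α).filter fun cc => cc.1 ≤ b ∧ b < T cc :=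
      Finset.mem_filter.mpr ⟨(mem_cellFinset _ _).mpr (hcell u h1 h2), by simp only; omega, by
        simp only [hatOf] at hlt; omega⟩
    rw [hcard] at m1
    simp at m1
  · intro u u' j h1 h1' h2 h2' h3 h4 h4'
    have hcard := excess_card α β a b hs T hT j
    rw [if_pos (by omega)] at hcard
    have m : ∀ w, a ≤ w → w ≤ j → j < hatOf α T w →
        (w, α.parts w) ∈ (cellFinset α).filter fun cc => cc.1 ≤ j ∧ j < T cc :=
      fun w e1 e2 e3 => Finset.mem_filter.mpr
        ⟨(mem_cellFinset _ _).mpr (hcell w e1 (by omega)), e2, e3⟩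
    have := Finset.card_le_one.mp hcard.le _ (m u h1 h2 h4) _ (m u' h1' h2' h4')
    exact (Prod.mk.inj this).1
  · intro j h1 h2
    have hcard := excess_card α β a b hs T hT j
    rw [if_pos (by omega)] at hcard
    obtain ⟨⟨r, c⟩, hrc⟩ := Finset.card_eq_one.mp hcard
    have hm : (r, c) ∈ (cellFinset α).filter fun cc => cc.1 ≤ j ∧ j < T cc := by
      rw [hrc]; exact Finset.mem_singleton_self _
    rw [Finset.mem_filter, mem_cellFinset] at hm
    obtain ⟨m1, m2, m3⟩ := hm
    simp only at m2
    have he := sst_entry α β a b hs T hT r c m1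
    split_ifs at he with hr
    · exact ⟨r, hr.1, m2, by omega⟩
    · omega
  · intro u h1 h2 h3 h4 h5
    have := hT.1.2 u (u + 1) (α.parts u) (hcell u h1 (by omega))
      (by rw [← h3]; exact hcell (u + 1) (by omega) h2) (by omega)
    have h6 := hge u h1 (by omega)
    simp only [hatOf] at h4 h5 h6
    rw [h3] at h5
    omega

section
variable {α : Partition n} {a b : ℕ} {H : ℕ → ℕ}

lemma HatLike.target (hH : HatLike α a b H) (u : ℕ) (h1 : a ≤ u) (h2 : u ≤ b - 1)
    (h3 : H u ≠ u) (h4 : H u ≠ b) : H u ≤ b - 1 ∧ H (H u) ≠ H u := by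
  have e1 := hH.ge u h1 h2
  have e2 := hH.le u h1 h2
  refine ⟨by omega, fun h => ?_⟩
  obtain ⟨w, w1, w2, w3⟩ := hH.exist (H u) (by omega) (by omega)
  have hw : w ≠ H u := by intro hw; rw [hw] at w3; omega
  have := hH.uniq w u (H u - 1) w1 h1 (by omega) (by omega) (by omega) (by omega) (by omega)
  rw [this] at w3
  omega

lemma HatLike.gap (hH : HatLike α a b H) (u w : ℕ) (h1 : a ≤ u) (h2 : w ≤ b - 1)
    (h3 : u < w) (h4 : w < H u) : H w = w := by
  by_contra hne
  have := hH.ge w (by omega) h2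
  have := hH.uniq u w w h1 (by omega) (by omega) (by omega) h2 h4 (by omega)
  omega

lemma HatLike.inj (hH : HatLike α a b H) (u w : ℕ) (h1 : a ≤ u) (h2 : w ≤ b - 1)
    (h3 : u < w) : H u ≠ H w := by
  intro h
  have e1 := hH.ge w (by omega) h2
  have e2 := hH.le w (by omega) h2
  by_cases hw : H w = w
  · exact (hH.target u h1 (by omega) (by omega) (by omega)).2 (by rw [h, hw, hw])
  · have := hH.uniq u w w h1 (by omega) (by omega) (by omega) h2 (by omega) (by omega)
    omega

end

lemma nextIn_eq (X : Finset ℕ) (b u w : ℕ) (h1 : w ∈ X ∨ w = b) (h2 : u < w) (h3 : w ≤ b)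
    (h4 : ∀ z ∈ X, u < z → w ≤ z) : nextIn X b u = w := by
  apply le_antisymm
  · apply Nat.sInf_le
    rcases h1 with h1 | h1
    · exact Or.inl ⟨h1, h2⟩
    · exact Or.inr h1
  · apply le_csInf
    · exact ⟨b, Or.inr rfl⟩
    · rintro z (⟨hz1, hz2⟩ | hz)
      · exact h4 z hz1 hz2
      · rw [Set.mem_singleton_iff.mp hz]; exact h3

lemma pv_zero (F : Type*) [CommRing F] {α : Partition n} (t : Placement α)
    (C : ℕ → ℕ → ℤ) (g : Fin n → ℕ) (r j : ℕ) (h : C r j < 0) : pv F t C g = 0 := by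
  classical
  apply Finset.sum_eq_zero
  intro π _
  rw [if_neg, mul_zero]
  intro hc
  have := cont_nonneg (rowTabloid t π).1 g r j
  rw [hc] at this
  omega

lemma conm_congr (α : Partition n) (a b : ℕ) (H H' : ℕ → ℕ)
    (h : ∀ u, a ≤ u → u ≤ b - 1 → H u = H' u) : conm α a b H = conm α a b H' := by
  funext r j
  simp only [conm]
  by_cases hr : a ≤ r ∧ r ≤ b - 1
  · rw [h r hr.1 hr.2]
  · simp only [if_neg hr]

lemma rcZ_update (α : Partition n) (a b : ℕ) (ha : 0 < a)
    (hpos : ∀ r, a ≤ r → r ≤ b - 1 → 0 < α.parts r) (X : Finset ℕ) (i : ℕ)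
    (hi1 : a ≤ i) (hi2 : i ≤ b - 1) :
    rcZ α (Function.update (tableauOfSet α a b X) (i, α.parts i) i)
      = conm α a b (Function.update (hatOfSet X b) i i) := by
  apply rcZ_eq α a b ha hpos
  intro r c hc
  by_cases h : (r, c) = (i, α.parts i)
  · obtain ⟨rfl, rfl⟩ := Prod.mk.inj h
    simp
  · rw [Function.update_of_ne h, tableauOfSet, if_pos hc]
    by_cases hr : r = i
    · subst hr
      have hc' : c ≠ α.parts r := fun h' => h (by rw [h'])
      simp [hc']
    · rw [Function.update_of_ne hr]

lemma hat_Tset {α : Partition n} {a b : ℕ} (T : ℕ × ℕ → ℕ)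
    (hH : HatLike α a b (hatOf α T)) (u : ℕ) (h1 : a ≤ u) (h2 : u ≤ b - 1) :
    hatOfSet (Tset α a b T) b u = hatOf α T u := by
  have hmem : ∀ w, w ∈ Tset α a b T ↔ (a ≤ w ∧ w ≤ b - 1) ∧ hatOf α T w ≠ w := by
    intro w; simp [Tset]
  have e1 := hH.ge u h1 h2
  have e2 := hH.le u h1 h2
  rw [hatOfSet]
  split_ifs with hu
  · have hu' := ((hmem u).mp hu).2
    apply nextIn_eq
    · by_cases hb : hatOf α T u = b
      · exact Or.inr hb
      · left
        have := hH.target u h1 h2 hu' hb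
        exact (hmem _).mpr ⟨⟨by omega, this.1⟩, this.2⟩
    · omega
    · exact e2
    · intro z hz huz
      by_contra hlt
      have hz' := (hmem z).mp hz
      exact hz'.2 (hH.gap u z h1 hz'.1.2 huz (by omega))
  · by_contra hne
    exact hu ((hmem u).mpr ⟨⟨h1, h2⟩, fun h => hne h.symm⟩)

/-- Case `T̂(i) = i+1`. -/
lemma caseA (F : Type*) [CommRing F] (α : Partition n) (c : ℕ → ℕ) (a b i : ℕ) (H : ℕ → ℕ)
    (hH : HatLike α a b H) (ha : 0 < a) (hi1 : a ≤ i) (hi2 : i ≤ b - 1) (hab : a < b)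
    (hHi : H i = i + 1)
    (hc : 0 < c (i + 1)) (T : ℕ × ℕ → ℕ) (hT : rcZ α T = conm α a b H)
    (t : Placement α) (g : Tabloid n (nuComp c i (c (i + 1) - 1))) :
    psi F c i (c (i + 1) - 1) (theta F α c T (polytabloid F t)) g =
      ((hook α b i - hook α b (i + 1) : ℤ) : F) *
        pv F t (conm α a b (Function.update H i i)) g.1 := by
  have hge : a ≤ i + 1 ∧ i + 1 ≤ b - 1 → i + 2 ≤ H (i + 1) := by
    rintro ⟨h1, h2⟩
    have h3 := hH.ge (i + 1) h1 h2
    have h4 := hH.inj i (i + 1) hi1 h2 (by omega)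
    omega
  rw [psi_theta_poly F α c i hc T i (i + 1) (by omega) ?_ t g, hT]
  swap
  · intro q h1 h2
    rw [hT]
    simp only [conm, if_neg (Ne.symm h2)]
    split_ifs with h3 h4
    · exfalso
      rcases lt_or_gt_of_ne h1 with h | h
      · exact hH.inj q i h3.1 hi2 h (by omega)
      · exact hH.inj i q hi1 h3.2 h (by omega)
    · simp
    · simp
  have hW : conm α a b H - eM i (i + 1) + eM i i = conm α a b (Function.update H i i) := by
    funext r j
    simp only [Pi.add_apply, Pi.sub_apply, conm, eM]
    by_cases hr : r = i
    · subst hr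
      simp only [Function.update_self, hHi, true_and]
      split_ifs <;> omega
    · simp [Function.update_of_ne hr, Ne.symm hr]
  have hg := garnir2 F t i (i + 1) i (i + 1) (by omega) (by omega)
    (α.antitone (by omega) (by omega)) (by omega)
    (conm α a b H - eM (i + 1) (i + 1) + eM (i + 1) i) (conm α a b (Function.update H i i))
    (by rw [← hW]; abel) (by
      intro j h1 h2
      simp only [Pi.add_apply, Pi.sub_apply, conm, eM, hHi]
      simp [h1, h2]) g.1
  have e1 : conm α a b H i i + 1 = α.parts i := by
    simp [conm, hHi, hi1, hi2]
  have e2 : conm α a b H (i + 1) i = 0 := by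
    simp only [conm]
    by_cases h : a ≤ i + 1 ∧ i + 1 ≤ b - 1
    · have := hge h
      simp [show i ≠ H (i + 1) by omega]
    · rw [if_neg h]; simp
  have e3 : (conm α a b H - eM (i + 1) (i + 1) + eM (i + 1) i) (i + 1) i = 1 := by
    simp [e2, eM]
  have e4 : (conm α a b H - eM (i + 1) (i + 1) + eM (i + 1) i) (i + 1) (i + 1) + 1
      = (α.parts i : ℤ) - (hook α b i - hook α b (i + 1)) := by
    have : conm α a b H (i + 1) (i + 1) =
        (α.parts i : ℤ) - (hook α b i - hook α b (i + 1)) := by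
      simp only [conm, hook]
      by_cases h : a ≤ i + 1 ∧ i + 1 ≤ b - 1
      · have := hge h
        rw [if_pos h, if_neg (show ¬ i + 1 = H (i + 1) by omega), if_pos (show i < b by omega),
          if_pos (show i + 1 < b by omega)]
        push_cast
        ring
      · have hb : b = i + 1 := by omega
        rw [if_neg h, if_pos (show i < b by omega), if_neg (show ¬ i + 1 < b by omega), hb]
        push_cast
        ring
    rw [← this]
    simp [eM]
  rw [e3, e4] at hg
  rw [hW, e1, e2]
  push_cast at hg ⊢
  linear_combination hg

/-- First step in the case `T̂(i) ≠ i+1`. -/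
lemma caseB0 (F : Type*) [CommRing F] (α : Partition n) (c : ℕ → ℕ) (a b i : ℕ) (H : ℕ → ℕ)
    (hH : HatLike α a b H) (ha : 0 < a) (hi1 : a ≤ i) (hi2 : i + 1 ≤ b - 1)
    (hHi : i + 1 < H i) (hHi1 : H (i + 1) = i + 1)
    (hc : 0 < c (i + 1)) (T : ℕ × ℕ → ℕ) (hT : rcZ α T = conm α a b H)
    (t : Placement α) (g : Tabloid n (nuComp c i (c (i + 1) - 1))) :
    psi F c i (c (i + 1) - 1) (theta F α c T (polytabloid F t)) g =
      - pv F t (conm α a b (Function.update (Function.update H i i) (i + 1) (H i))) g.1 := by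
  rw [psi_theta_poly F α c i hc T i (i + 1) (by omega) ?_ t g, hT]
  swap
  · intro q h1 h2
    rw [hT]
    simp only [conm, if_neg (Ne.symm h2)]
    split_ifs with h3 h4
    · exfalso
      rcases lt_or_gt_of_ne h2 with h | h
      · exact hH.inj q (i + 1) h3.1 hi2 h (by omega)
      · exact hH.inj (i + 1) q (by omega) h3.2 h (by omega)
    · simp
    · simp
  have h0 : pv F t (conm α a b H - eM i (i + 1) + eM i i) g.1 = 0 := by
    apply pv_zero F t _ _ i (i + 1)
    simp only [Pi.add_apply, Pi.sub_apply, conm, eM]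
    rw [if_neg (by omega), if_pos (by omega), if_neg (by omega), if_neg (by omega),
      if_pos (by simp), if_neg (by omega)]
    norm_num
  have e2 : conm α a b H (i + 1) i = 0 := by
    simp only [conm]
    simp [hHi1]
  have hg := garnir2 F t i (i + 1) i (H i) (by omega) (by omega)
    (α.antitone (by omega) (by omega)) (by omega)
    (conm α a b H - eM (i + 1) (i + 1) + eM (i + 1) i)
    (conm α a b (Function.update (Function.update H i i) (i + 1) (H i)))
    (by
      funext r j
      simp only [Pi.add_apply, Pi.sub_apply, conm, eM]
      by_cases hr : r = i
      · subst hr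
        simp only [Function.update_of_ne (show r ≠ r + 1 by omega), Function.update_self]
        grind
      by_cases hr1 : r = i + 1
      · subst hr1
        simp only [Function.update_self, hHi1]
        grind
      · simp [Function.update_of_ne hr, Function.update_of_ne hr1, Ne.symm hr, Ne.symm hr1])
    (by
      intro j h1 h2
      simp only [Pi.add_apply, Pi.sub_apply, conm, eM]
      simp [h1, h2]) g.1
  have e3 : (conm α a b H - eM (i + 1) (i + 1) + eM (i + 1) i) (i + 1) i = 1 := by
    simp [e2, eM]
  have e4 : (conm α a b H - eM (i + 1) (i + 1) + eM (i + 1) i) (i + 1) (H i) = 0 := by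
    simp only [Pi.add_apply, Pi.sub_apply, conm, eM, hHi1]
    grind
  rw [e3, e4] at hg
  rw [h0, e2]
  push_cast at hg ⊢
  linear_combination hg

/-- Moving the entry `v` at the end of row `u` down to row `u+1` of the same length. -/
lemma stepB (F : Type*) [CommRing F] (α : Partition n) (a b u : ℕ) (H : ℕ → ℕ)
    (hi1 : a ≤ u) (hi2 : u + 1 ≤ b - 1) (hα : α.parts u = α.parts (u + 1))
    (hHi : u + 1 < H u) (hHi1 : H (u + 1) = u + 1)
    (t : Placement α) (g : Fin n → ℕ) :
    pv F t (conm α a b H) g =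
      - pv F t (conm α a b (Function.update (Function.update H u (u + 1)) (u + 1) (H u))) g := by
  have hg := garnir2 F t (u + 1) u (H u) (u + 1) (by omega) (by omega) hα.le (by omega)
    (conm α a b H)
    (conm α a b (Function.update (Function.update H u (u + 1)) (u + 1) (H u)))
    (by
      funext r j
      simp only [Pi.add_apply, Pi.sub_apply, conm, eM]
      by_cases hr : r = u
      · subst hr
        simp only [Function.update_of_ne (show r ≠ r + 1 by omega), Function.update_self]
        grind
      by_cases hr1 : r = u + 1
      · subst hr1
        simp only [Function.update_self, hHi1]
        grind
      · simp [Function.update_of_ne hr, Function.update_of_ne hr1, Ne.symm hr, Ne.symm hr1])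
    (by
      intro j h1 h2
      simp only [conm, hHi1]
      simp [h2]) g
  have e3 : conm α a b H u (H u) = 1 := by
    simp only [conm]
    grind
  have e4 : conm α a b H u (u + 1) = 0 := by
    simp only [conm]
    grind
  rw [e3, e4] at hg
  push_cast at hg
  linear_combination hg

/-- The intermediate hat functions. -/
def hatM (H : ℕ → ℕ) (i m : ℕ) : ℕ → ℕ := fun x =>
  if x = i then i else if i < x ∧ x < i + m then x + 1 else if x = i + m then H i else H x

lemma iterB (F : Type*) [CommRing F] (α : Partition n) (a b i : ℕ) (H : ℕ → ℕ)
    (hi1 : a ≤ i) (t : Placement α) (g : Fin n → ℕ) (m : ℕ) (hb : i + (m + 1) ≤ b - 1)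
    (hv : i + (m + 1) < H i) (hfix : ∀ x, i < x → x ≤ i + (m + 1) → H x = x)
    (hα : ∀ x, i < x → x ≤ i + (m + 1) → α.parts x = α.parts (i + 1)) :
    - pv F t (conm α a b (Function.update (Function.update H i i) (i + 1) (H i))) g =
      (-1) ^ (m + 1) * pv F t (conm α a b (hatM H i (m + 1))) g := by
  induction m with
  | zero =>
    have : Function.update (Function.update H i i) (i + 1) (H i) = hatM H i (0 + 1) := by
      funext x
      simp only [Function.update_apply, hatM]
      split_ifs <;> omega
    rw [this]; simp
  | succ m ih =>
    rw [ih (by omega) (by omega) (fun x h1 h2 => hfix x h1 (by omega))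
      (fun x h1 h2 => hα x h1 (by omega))]
    have hx1 : hatM H i (m + 1) (i + (m + 1)) = H i := by
      simp [hatM]
    have hx2 : hatM H i (m + 1) (i + (m + 1) + 1) = i + (m + 1) + 1 := by
      simp only [hatM]
      rw [if_neg (by omega), if_neg (by omega), if_neg (by omega), hfix _ (by omega) (by omega)]
    rw [stepB F α a b (i + (m + 1)) (hatM H i (m + 1)) (by omega) (by omega)
      (by rw [hα _ (by omega) (by omega), hα (i + (m + 1) + 1) (by omega) (by omega)])
      (by rw [hx1]; omega) hx2]
    have : Function.update (Function.update (hatM H i (m + 1)) (i + (m + 1)) (i + (m + 1) + 1))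
        (i + (m + 1) + 1) (hatM H i (m + 1) (i + (m + 1))) = hatM H i (m + 1 + 1) := by
      rw [hx1]
      funext x
      simp only [Function.update_apply, hatM]
      split_ifs <;> omega
    rw [this, pow_succ (-1 : F) (m + 1)]
    ring

/-- Combinatorics of `T ∨ i`. -/
lemma vee_comb (α : Partition n) (a b i : ℕ) (T : ℕ × ℕ → ℕ) (ha : 0 < a)
    (hH : HatLike α a b (hatOf α T)) (hadd : α.parts b < α.parts (b - 1))
    (hi1 : a ≤ i) (hi2 : i + 1 ≤ b - 1) (hHi : i + 1 < hatOf α T i) :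
    ∃ m, i + (m + 1) ≤ b - 1 ∧ i + (m + 1) < hatOf α T i ∧
      (∀ x, i < x → x ≤ i + (m + 1) → α.parts x = α.parts (i + 1)) ∧
      ((veeSet α a b T i) \ Tset α a b T).card = m + 1 ∧
      ∀ u, a ≤ u → u ≤ b - 1 → Function.update (hatOfSet (veeSet α a b T i) b) i i u
        = hatM (hatOf α T) i (m + 1) u := by
  set H := hatOf α T with hHdef
  set X := Tset α a b T with hX
  have hmem : ∀ w, w ∈ X ↔ (a ≤ w ∧ w ≤ b - 1) ∧ H w ≠ w := by
    intro w; simp [hX, Tset, hHdef]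
  set K : Set ℕ := {k | 1 ≤ k ∧ α.parts (i + k) = α.parts (i + 1) ∧
      α.parts (i + k + 1) < α.parts (i + k)} with hK
  -- nonemptiness of `K` and the bound on its infimum
  have hKne : ∃ k ∈ K, i + k ≤ b - 1 := by
    by_contra hcon
    push Not at hcon
    have : ∀ d, i + 1 + d ≤ b - 1 → α.parts (i + 1 + d) = α.parts (i + 1) := by
      intro d
      induction d with
      | zero => simp
      | succ d ih =>
        intro hd
        have h1 := ih (by omega)
        have h2 : ¬ (1 + d ∈ K) := fun h => by have := hcon _ h; omega
        have h3 := α.antitone (show 0 < i + 1 + d by omega) (show i + 1 + d ≤ i + 1 + (d + 1) by omega)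
        by_contra hne
        apply h2
        refine ⟨by omega, by rw [← add_assoc, h1], ?_⟩
        rw [← add_assoc]
        rw [← add_assoc] at h3 hne
        omega
    have h1 := this (b - 1 - (i + 1)) (by omega)
    rw [show i + 1 + (b - 1 - (i + 1)) = b - 1 by omega] at h1
    have h2 : b - 1 - i ∈ K := by
      refine ⟨by omega, ?_, ?_⟩
      · rw [show i + (b - 1 - i) = b - 1 by omega, h1]
      · rw [show i + (b - 1 - i) = b - 1 by omega, show b - 1 + 1 = b by omega]; exact hadd
    have := hcon _ h2
    omega
  set k := sInf K with hk
  have hkK : k ∈ K := Nat.sInf_mem ⟨_, hKne.choose_spec.1⟩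
  have hkb : i + k ≤ b - 1 := by
    obtain ⟨k', h1, h2⟩ := hKne
    have := Nat.sInf_le h1
    omega
  obtain ⟨hk1, hk2, hk3⟩ := hkK
  have hpart : ∀ x, i < x → x ≤ i + k → α.parts x = α.parts (i + 1) := by
    intro x h1 h2
    have h3 := α.antitone (show 0 < i + 1 by omega) (show i + 1 ≤ x by omega)
    have h4 := α.antitone (show 0 < x by omega) h2
    omega
  have hvle := hH.le i hi1 (by omega)
  have hiX : H i ≠ i := by omega
  -- propagation
  have hprop : ∀ x, H i ≤ x → x ≤ i + k → x ∈ X := by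
    intro x h1
    induction x, h1 using Nat.le_induction with
    | base =>
      intro h2
      have := hH.target i hi1 (by omega) hiX (by omega)
      exact (hmem _).mpr ⟨⟨by omega, this.1⟩, this.2⟩
    | succ x hx ih =>
      intro h2
      have h3 := (hmem x).mp (ih (by omega))
      refine (hmem _).mpr ⟨⟨by omega, by omega⟩, ?_⟩
      refine hH.ss x h3.1.1 (by omega) ?_ h3.2
      rw [hpart x (by omega) (by omega), hpart (x + 1) (by omega) h2]
  have hgap : ∀ x, i < x → x < H i → x ∉ X := by
    intro x h1 h2 h3
    have h4 := (hmem x).mp h3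
    exact h4.2 (hH.gap i x hi1 h4.1.2 h1 h2)
  obtain ⟨m, hm⟩ : ∃ m, m + 1 = min k (H i - 1 - i) := ⟨min k (H i - 1 - i) - 1, by
    have : 1 ≤ min k (H i - 1 - i) := le_min hk1 (by omega)
    omega⟩
  have hmk : m + 1 ≤ k := by omega
  have hmv : i + (m + 1) < H i := by omega
  have hmor : m + 1 = k ∨ i + (m + 1) + 1 = H i := by omega
  have hvee : veeSet α a b T i = X ∪ Finset.Icc (i + 1) (i + k) := by
    rw [veeSet, if_neg (show ¬ hatOf α T i = i + 1 from (by omega : ¬ H i = i + 1))]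
  have hvmem : ∀ x, x ∈ veeSet α a b T i ↔ x ∈ X ∨ (i < x ∧ x ≤ i + (m + 1)) := by
    intro x
    rw [hvee, Finset.mem_union, Finset.mem_Icc]
    constructor
    · rintro (h | h)
      · exact Or.inl h
      · by_cases hx : x ≤ i + (m + 1)
        · exact Or.inr ⟨by omega, hx⟩
        · exact Or.inl (hprop x (by omega) h.2)
    · rintro (h | h)
      · exact Or.inl h
      · exact Or.inr (by omega)
  refine ⟨m, by omega, hmv, fun x h1 h2 => hpart x h1 (by omega), ?_, ?_⟩
  · have : (veeSet α a b T i) \ X = Finset.Icc (i + 1) (i + (m + 1)) := by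
      ext x
      rw [Finset.mem_sdiff, hvmem, Finset.mem_Icc]
      constructor
      · rintro ⟨h1 | h1, h2⟩
        · exact absurd h1 h2
        · omega
      · intro h
        exact ⟨Or.inr (by omega), hgap x (by omega) (by omega)⟩
    rw [this, Nat.card_Icc]
    omega
  · intro u h1 h2
    rw [Function.update_apply]
    simp only [hatM]
    by_cases hu : u = i
    · rw [if_pos hu, if_pos hu]
    rw [if_neg hu, if_neg hu, hatOfSet]
    by_cases hu1 : i < u ∧ u < i + (m + 1)
    · rw [if_pos hu1, if_pos ((hvmem u).mpr (Or.inr (by omega)))]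
      apply nextIn_eq
      · exact Or.inl ((hvmem _).mpr (Or.inr (by omega)))
      · omega
      · omega
      · intro z _ hz; omega
    rw [if_neg hu1]
    by_cases hu2 : u = i + (m + 1)
    · rw [if_pos hu2, if_pos ((hvmem u).mpr (Or.inr (by omega)))]
      apply nextIn_eq
      · by_cases hb : H i = b
        · exact Or.inr hb
        · left
          have := hH.target i hi1 (by omega) hiX hb
          exact (hvmem _).mpr (Or.inl ((hmem _).mpr ⟨⟨by omega, this.1⟩, this.2⟩))
      · omega
      · exact hvle
      · intro z hz huz
        by_contra hlt
        rcases (hvmem z).mp hz with h | h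
        · exact hgap z (by omega) (by omega) h
        · omega
    rw [if_neg hu2]
    have e1 := hH.ge u h1 h2
    have e2 := hH.le u h1 h2
    by_cases huX : u ∈ X
    · have hu' := ((hmem u).mp huX).2
      rw [if_pos ((hvmem u).mpr (Or.inl huX))]
      apply nextIn_eq
      · by_cases hb : H u = b
        · exact Or.inr hb
        · left
          have := hH.target u h1 h2 hu' hb
          exact (hvmem _).mpr (Or.inl ((hmem _).mpr ⟨⟨by omega, this.1⟩, this.2⟩))
      · omega
      · exact e2
      · intro z hz huz
        by_contra hlt
        rcases (hvmem z).mp hz with h | h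
        · have hz' := (hmem z).mp h
          exact hz'.2 (hH.gap u z h1 hz'.1.2 huz (by omega))
        · -- here `u < i`
          have : u < i := by omega
          exact hiX (hH.gap u i h1 (by omega) this (by omega))
    · rw [if_neg]
      · by_contra hne
        exact huX ((hmem u).mpr ⟨⟨h1, h2⟩, fun h => hne h.symm⟩)
      · rw [hvmem]
        rintro (h | h)
        · exact huX h
        · omega

/-- Let `F` be a field of characteristic `p > 2`, `β` a one-box-shift of
`α` (box moved from row `a` to row `b`), and `T` a (normalized) semistandard `α`-tableau
of type `β` with associated bijection `T̂` and set `{T}`.  Let `a ≤ i ≤ b-1` be such that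
`i = a` or `α_{T̂⁻¹(i)} ≠ α_i`.  Then `θ̂_T ∘ ψ_i = (h_i - h_{i+1}) θ̂_W` if
`T̂(i) = i+1`, and `θ̂_T ∘ ψ_i = (-1)^{|{T∨i} \ {T}|} θ̂_W` otherwise, where `W` is
obtained from `T ∨ i` by changing the unique entry `i+1` in row `i` to an `i`. -/
theorem stmt12 (F : Type*) [Field F] (p : ℕ) [CharP F p] (hp : 2 < p)
    {n : ℕ} (α β : Partition n) (a b : ℕ) (hshift : OneBoxShift α β a b)
    (T : ℕ × ℕ → ℕ) (hT : T ∈ SSTSet α β.parts)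
    (i : ℕ) (hi1 : a ≤ i) (hi2 : i ≤ b - 1)
    (hcase : i = a ∨ α.parts (invHat α a b T i) ≠ α.parts i) :
    (hatOf α T i = i + 1 →
      (psi F β.parts i (β.parts (i + 1) - 1)).comp (thetaHat F α β.parts T) =
        ((hook α b i - hook α b (i + 1) : ℤ) : F) •
          thetaHat F α (nuComp β.parts i (β.parts (i + 1) - 1))
            (Function.update (tableauOfSet α a b (veeSet α a b T i)) (i, α.parts i) i)) ∧
    (hatOf α T i ≠ i + 1 →
      (psi F β.parts i (β.parts (i + 1) - 1)).comp (thetaHat F α β.parts T) =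
        ((-1 : F) ^ ((veeSet α a b T i) \ Tset α a b T).card) •
          thetaHat F α (nuComp β.parts i (β.parts (i + 1) - 1))
            (Function.update (tableauOfSet α a b (veeSet α a b T i)) (i, α.parts i) i)) := by
  have ha := hshift.a_pos
  have hab := hshift.a_lt_b
  have hpos := pos_of_shift α β a b hshift
  have hH := sst_hatLike α β a b hshift T hT
  have hrc : rcZ α T = conm α a b (hatOf α T) :=
    rcZ_eq α a b ha hpos _ _ (sst_entry α β a b hshift T hT)
  have hc : 0 < β.parts (i + 1) := by
    by_cases hb : i + 1 = b
    · rw [hb, hshift.at_b]; omega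
    · rw [hshift.elsewhere _ (by omega) hb]
      exact hpos _ (by omega) (by omega)
  have hge := hH.ge i hi1 hi2
  have hne : hatOf α T i ≠ i := by
    intro h
    rcases hcase with h1 | h1
    · obtain ⟨u, u1, u2, u3⟩ := hH.exist a le_rfl (by omega)
      have : u = i := by omega
      subst this
      omega
    · apply h1
      have : invHat α a b T i = i := by
        have hset : {u | a ≤ u ∧ u ≤ b - 1 ∧ hatOf α T u = i} = {i} := by
          ext u
          simp only [Set.mem_ofPred_eq, Set.mem_singleton_iff]
          constructor
          · rintro ⟨u1, u2, u3⟩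
            rcases lt_trichotomy u i with hlt | heq | hlt
            · exact absurd (u3.trans h.symm) (hH.inj u i u1 hi2 hlt)
            · exact heq
            · exact absurd (h.trans u3.symm) (hH.inj i u hi1 u2 hlt)
          · rintro rfl
            exact ⟨hi1, hi2, h⟩
        rw [invHat, hset, csInf_singleton]
      rw [this]
  constructor
  · intro hi
    have hvee : veeSet α a b T i = Tset α a b T := by rw [veeSet, if_pos hi]
    have hW : rcZ α (Function.update (tableauOfSet α a b (veeSet α a b T i)) (i, α.parts i) i)
        = conm α a b (Function.update (hatOf α T) i i) := by
      rw [rcZ_update α a b ha hpos _ i hi1 hi2, hvee]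
      apply conm_congr
      intro u h1 h2
      by_cases hu : u = i
      · rw [hu]; simp
      · rw [Function.update_of_ne hu, Function.update_of_ne hu, hat_Tset T hH u h1 h2]
    simp only [thetaHat]
    rw [← LinearMap.comp_assoc, ← LinearMap.smul_comp]
    apply specht_ext
    intro t
    ext g
    rw [LinearMap.comp_apply, LinearMap.smul_apply, Finsupp.smul_apply, theta_poly, hW,
      caseA F α β.parts a b i _ hH ha hi1 hi2 hab hi hc T hrc t g, smul_eq_mul]
  · intro hi
    have hle := hH.le i hi1 hi2
    obtain ⟨m, m1, m2, m3, m4, m5⟩ := vee_comb α a b i T ha hH hshift.add hi1 (by omega) (by omega)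
    have hW : rcZ α (Function.update (tableauOfSet α a b (veeSet α a b T i)) (i, α.parts i) i)
        = conm α a b (hatM (hatOf α T) i (m + 1)) := by
      rw [rcZ_update α a b ha hpos _ i hi1 hi2]
      exact conm_congr _ _ _ _ _ m5
    have hfix : ∀ x, i < x → x ≤ i + (m + 1) → hatOf α T x = x :=
      fun x h1 h2 => hH.gap i x hi1 (by omega) h1 (by omega)
    simp only [thetaHat]
    rw [← LinearMap.comp_assoc, ← LinearMap.smul_comp]
    apply specht_ext
    intro t
    ext g
    rw [LinearMap.comp_apply, LinearMap.smul_apply, Finsupp.smul_apply, theta_poly, hW, m4,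
      caseB0 F α β.parts a b i _ hH ha hi1 (by omega) (by omega)
        (hfix _ (by omega) (by omega)) hc T hrc t g,
      iterB F α a b i _ hi1 t g.1 m m1 m2 hfix m3, smul_eq_mul]

end CarterPayne
end
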